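/- Let a<b be real, let p ∈ ]1,+∞[, and let ψ : ℝ → ]0,+∞[ be a bounded Borel function with ∫_{−∞}^{+∞} ψ(t)^{1/p} dt < +∞ and inf_K ψ > 0 for every compact K ⊂ ℝ. Define the relaxed functional F̄_p(u) := inf{ liminf_{k→∞} F_p(u_k) : u_k → u in L¹(]a,b[) }. Then F̄_p(u) = |u'|(]a,b[) + ∫_a^b |v'|^p dx if u ∈ X^p_ψ(]a,b[), where v := Ψ_p∘(u')^a, and F̄_p(u) = +∞ otherwise. -/

import Mathlib

open MeasureTheory Filter Set Topology
open scoped ENNReal NNReal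

noncomputable section

/-- `Ψ₁(t) = ∫_{-∞}^t ψ(s) ds`. -/
def Psi1 (ψ : ℝ → ℝ) (t : ℝ) : ℝ := ∫ s in Set.Iic t, ψ s

/-- `Ψ_p(t) = ∫_{-∞}^t ψ(s)^{1/p} ds`. -/
def Psip (ψ : ℝ → ℝ) (p t : ℝ) : ℝ := ∫ s in Set.Iic t, ψ s ^ (1 / p)

/-- The natural extension of `Ψ₁` to the extended reals:
`Ψ₁(-∞) = 0`, `Ψ₁(+∞) = ∫_ℝ ψ`. -/
def Psi1E (ψ : ℝ → ℝ) (t : EReal) : ℝ :=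
  if t = ⊤ then ∫ s, ψ s else if t = ⊥ then 0 else Psi1 ψ t.toReal

/-- Standing assumptions on `ψ` in the case `p = 1`: a bounded, everywhere positive
Borel function, integrable on `ℝ`, whose infimum on every compact set is positive. -/
structure PsiHyp (ψ : ℝ → ℝ) : Prop where
  measurable : Measurable ψ
  pos : ∀ t, 0 < ψ t
  bounded : ∃ C, ∀ t, ψ t ≤ C
  integrable : MeasureTheory.Integrable ψ
  inf_pos : ∀ K : Set ℝ, IsCompact K → ∃ δ > 0, ∀ t ∈ K, δ ≤ ψ t

/-- Standing assumptions on `ψ` in the case `p > 1`: as in `PsiHyp` but with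
`ψ^{1/p}` integrable on `ℝ`. -/
structure PsiHypP (ψ : ℝ → ℝ) (p : ℝ) : Prop where
  measurable : Measurable ψ
  pos : ∀ t, 0 < ψ t
  bounded : ∃ C, ∀ t, ψ t ≤ C
  integrable : MeasureTheory.Integrable fun t => ψ t ^ (1 / p)
  inf_pos : ∀ K : Set ℝ, IsCompact K → ∃ δ > 0, ∀ t ∈ K, δ ≤ ψ t

/-- `(μp, μn)` is the Jordan decomposition of the distributional derivative of
`u ∈ L¹(]a,b[)`; the existence of such a pair encodes `u ∈ BV(]a,b[)`,
and `μp + μn` is the total variation measure `|u'|`. -/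
def IsDerivMeasures (a b : ℝ) (u : ℝ → ℝ) (μp μn : Measure ℝ) : Prop :=
  MeasureTheory.IntegrableOn u (Set.Ioo a b) ∧
  IsFiniteMeasure μp ∧ IsFiniteMeasure μn ∧ μp ⟂ₘ μn ∧
  μp (Set.Ioo a b)ᶜ = 0 ∧ μn (Set.Ioo a b)ᶜ = 0 ∧
  ∀ φ : ℝ → ℝ, ContDiff ℝ 1 φ → tsupport φ ⊆ Set.Ioo a b →
    ∫ x in Set.Ioo a b, u x * deriv φ x = (∫ x, φ x ∂μn) - ∫ x, φ x ∂μp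

/-- The density `(u')^a` of the absolutely continuous part of the derivative whose
Jordan decomposition is `(μp, μn)`. -/
def uaD (μp μn : Measure ℝ) (x : ℝ) : ℝ :=
  (μp.rnDeriv MeasureTheory.volume x).toReal - (μn.rnDeriv MeasureTheory.volume x).toReal

/-- Left approximate limit `u₋(y) = lim_{ε→0⁺} ε⁻¹ ∫_{y-ε}^y u`. -/
def leftApproxLim (u : ℝ → ℝ) (y : ℝ) : ℝ :=
  limUnder (𝓝[>] (0 : ℝ)) fun ε => (∫ x in Set.Ioo (y - ε) y, u x) / ε

/-- Right approximate limit `u₊(y) = lim_{ε→0⁺} ε⁻¹ ∫_y^{y+ε} u`. -/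
def rightApproxLim (u : ℝ → ℝ) (y : ℝ) : ℝ :=
  limUnder (𝓝[>] (0 : ℝ)) fun ε => (∫ x in Set.Ioo y (y + ε), u x) / ε

/-- Left approximate limit computed in the extended reals (may be `±∞`). -/
def leftApproxLimE (u : ℝ → ℝ) (y : ℝ) : EReal :=
  limUnder (𝓝[>] (0 : ℝ)) fun ε => (((∫ x in Set.Ioo (y - ε) y, u x) / ε : ℝ) : EReal)

/-- Right approximate limit computed in the extended reals (may be `±∞`). -/
def rightApproxLimE (u : ℝ → ℝ) (y : ℝ) : EReal :=
  limUnder (𝓝[>] (0 : ℝ)) fun ε => (((∫ x in Set.Ioo y (y + ε), u x) / ε : ℝ) : EReal)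

/-- The jump set `S_u` of `u` in `]a,b[`. -/
def jumpSet (a b : ℝ) (u : ℝ → ℝ) : Set ℝ :=
  {y | y ∈ Set.Ioo a b ∧ leftApproxLim u y ≠ rightApproxLim u y}

/-- `ν_u = sign(u₊ - u₋)`. -/
def jumpSign (u : ℝ → ℝ) (y : ℝ) : ℝ :=
  Real.sign (rightApproxLim u y - leftApproxLim u y)

/-- `Z⁺[w] = {x ∈ ]a,b[ : lim_{ε→0⁺} (2ε)⁻¹∫_{x-ε}^{x+ε} w = +∞}`. -/
def ZPlus (a b : ℝ) (w : ℝ → ℝ) : Set ℝ :=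
  {x | x ∈ Set.Ioo a b ∧
    Tendsto (fun ε => (∫ t in Set.Ioo (x - ε) (x + ε), w t) / (2 * ε)) (𝓝[>] (0 : ℝ)) atTop}

/-- `Z⁻[w] = {x ∈ ]a,b[ : lim_{ε→0⁺} (2ε)⁻¹∫_{x-ε}^{x+ε} w = -∞}`. -/
def ZMinus (a b : ℝ) (w : ℝ → ℝ) : Set ℝ :=
  {x | x ∈ Set.Ioo a b ∧
    Tendsto (fun ε => (∫ t in Set.Ioo (x - ε) (x + ε), w t) / (2 * ε)) (𝓝[>] (0 : ℝ)) atBot}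

/-- The positive part `((u')^c)⁺` of the Cantor part of the derivative of `u`:
the singular part of `μp` with the atoms on the jump set removed. -/
def cantorPos (a b : ℝ) (u : ℝ → ℝ) (μp : Measure ℝ) : Measure ℝ :=
  (μp.singularPart MeasureTheory.volume).restrict (jumpSet a b u)ᶜ

/-- The negative part `((u')^c)⁻` of the Cantor part of the derivative of `u`. -/
def cantorNeg (a b : ℝ) (u : ℝ → ℝ) (μn : Measure ℝ) : Measure ℝ :=
  (μn.singularPart MeasureTheory.volume).restrict (jumpSet a b u)ᶜ

/-- `u ∈ X¹_ψ(]a,b[)`, with derivative data `(μp, μn)`:  `u ∈ BV(]a,b[)`,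
`Ψ₁∘(u')^a ∈ BV(]a,b[)`, and `((u')^c)^±` is concentrated on `Z^±[(u')^a]`. -/
def MemX1 (ψ : ℝ → ℝ) (a b : ℝ) (u : ℝ → ℝ) (μp μn : Measure ℝ) : Prop :=
  IsDerivMeasures a b u μp μn ∧
  (∃ νp νn : Measure ℝ, IsDerivMeasures a b (fun x => Psi1 ψ (uaD μp μn x)) νp νn) ∧
  cantorPos a b u μp (ZPlus a b (uaD μp μn))ᶜ = 0 ∧
  cantorNeg a b u μn (ZMinus a b (uaD μp μn))ᶜ = 0

/-- `f ∈ W^{1,p}(]a,b[)`: `f` has an absolutely continuous representative whose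
pointwise a.e. derivative lies in `L^p(]a,b[)`. -/
def MemW1pOn (p a b : ℝ) (f : ℝ → ℝ) : Prop :=
  ∃ g w : ℝ → ℝ,
    (∀ᵐ x ∂(MeasureTheory.volume.restrict (Set.Ioo a b)), g x = f x) ∧
    MeasureTheory.IntegrableOn w (Set.Ioo a b) ∧
    MeasureTheory.IntegrableOn (fun x => |w x| ^ p) (Set.Ioo a b) ∧
    ∀ x ∈ Set.Ioo a b, ∀ y ∈ Set.Ioo a b, g y - g x = ∫ t in x..y, w t

/-- `u ∈ X^p_ψ(]a,b[)`, with derivative data `(μp, μn)`:  `u ∈ BV(]a,b[)`,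
`Ψ_p∘(u')^a ∈ W^{1,p}(]a,b[)`, and `((u')^s)^±` is concentrated on `Z^±[(u')^a]`. -/
def MemXp (ψ : ℝ → ℝ) (p a b : ℝ) (u : ℝ → ℝ) (μp μn : Measure ℝ) : Prop :=
  IsDerivMeasures a b u μp μn ∧
  MemW1pOn p a b (fun x => Psip ψ p (uaD μp μn x)) ∧
  (μp.singularPart MeasureTheory.volume) (ZPlus a b (uaD μp μn))ᶜ = 0 ∧
  (μn.singularPart MeasureTheory.volume) (ZMinus a b (uaD μp μn))ᶜ = 0

/-- `u ∈ W^{2,p}(]a,b[)` with first derivative `v` and second derivative `w`. -/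
def W2pRep (p a b : ℝ) (u v w : ℝ → ℝ) : Prop :=
  (∀ x ∈ Set.Ioo a b, HasDerivAt u (v x) x) ∧
  (∀ x ∈ Set.Ioo a b, ∀ y ∈ Set.Ioo a b, v y - v x = ∫ t in x..y, w t) ∧
  MeasureTheory.IntegrableOn u (Set.Ioo a b) ∧
  MeasureTheory.IntegrableOn v (Set.Ioo a b) ∧
  MeasureTheory.IntegrableOn w (Set.Ioo a b) ∧
  MeasureTheory.IntegrableOn (fun x => |w x| ^ p) (Set.Ioo a b)

/-- The functional `F_p(u) = ∫_a^b |u'| + ∫_a^b ψ(u')|u''|^p` if `u ∈ W^{2,p}(]a,b[)`,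
`+∞` otherwise (as an infimum over Sobolev representations). -/
def Fp (ψ : ℝ → ℝ) (p a b : ℝ) (u : ℝ → ℝ) : ℝ≥0∞ :=
  ⨅ (v : ℝ → ℝ) (w : ℝ → ℝ) (_ : W2pRep p a b u v w),
    ENNReal.ofReal ((∫ x in Set.Ioo a b, |v x|) + ∫ x in Set.Ioo a b, ψ (v x) * |w x| ^ p)

/-- Strong `L¹(]a,b[)` convergence of a sequence. -/
def TendstoL1 (a b : ℝ) (U : ℕ → ℝ → ℝ) (u : ℝ → ℝ) : Prop :=
  (∀ k, MeasureTheory.IntegrableOn (U k) (Set.Ioo a b)) ∧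
  MeasureTheory.IntegrableOn u (Set.Ioo a b) ∧
  Tendsto (fun k => ∫ x in Set.Ioo a b, |U k x - u x|) atTop (𝓝 0)

/-- The relaxed functional
`F̄_p(u) = inf { liminf_k F_p(u_k) : u_k → u in L¹(]a,b[) }`. -/
def FpRel (ψ : ℝ → ℝ) (p a b : ℝ) (u : ℝ → ℝ) : ℝ≥0∞ :=
  ⨅ (U : ℕ → ℝ → ℝ) (_ : TendstoL1 a b U u),
    liminf (fun k => Fp ψ p a b (U k)) atTop

/-- `Φ(s, t₁, t₂)` of the relaxation formula (`s` being the sign of the jump). -/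
def Phi (ψ : ℝ → ℝ) (s : ℝ) (t₁ t₂ : EReal) : ℝ :=
  if 0 < s then ((∫ t, ψ t) - Psi1E ψ t₁) + ((∫ t, ψ t) - Psi1E ψ t₂)
  else Psi1E ψ t₁ + Psi1E ψ t₂

/-- `Φ̂(s, t₁, t₂)` of Remark 2.5. -/
def PhiHat (ψ : ℝ → ℝ) (s : ℝ) (t₁ t₂ : EReal) : ℝ :=
  if 0 < s then (∫ t, ψ t) - Psi1E ψ (max t₁ t₂)
  else Psi1E ψ (min t₁ t₂)

/-- `ubar` is a `C¹([a,b])` representative of `u`. -/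
def C1Rep (a b : ℝ) (u ubar : ℝ → ℝ) : Prop :=
  (∀ᵐ x ∂(MeasureTheory.volume.restrict (Set.Ioo a b)), ubar x = u x) ∧
  ContDiffOn ℝ 1 ubar (Set.Icc a b)

/-- `u` solves `min { F̄₁(w) + λ ∫_a^b (w - G)² : w ∈ X¹_ψ(]a,b[) }`. -/
def IsSolution1 (ψ : ℝ → ℝ) (a b lam : ℝ) (G u : ℝ → ℝ) : Prop :=
  (∃ μp μn : Measure ℝ, MemX1 ψ a b u μp μn) ∧
  ∀ w : ℝ → ℝ, (∃ ηp ηn : Measure ℝ, MemX1 ψ a b w ηp ηn) →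
    FpRel ψ 1 a b u + ENNReal.ofReal (lam * ∫ x in Set.Ioo a b, (u x - G x) ^ 2) ≤
    FpRel ψ 1 a b w + ENNReal.ofReal (lam * ∫ x in Set.Ioo a b, (w x - G x) ^ 2)

/-- `u` solves `min { F̄_p(w) + λ ∫_a^b |w - G|² : w ∈ X^p_ψ(]a,b[) }`. -/
def IsSolutionP (ψ : ℝ → ℝ) (p a b lam : ℝ) (G u : ℝ → ℝ) : Prop :=
  (∃ μp μn : Measure ℝ, MemXp ψ p a b u μp μn) ∧
  ∀ w : ℝ → ℝ, (∃ ηp ηn : Measure ℝ, MemXp ψ p a b w ηp ηn) →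
    FpRel ψ p a b u + ENNReal.ofReal (lam * ∫ x in Set.Ioo a b, (u x - G x) ^ 2) ≤
    FpRel ψ p a b w + ENNReal.ofReal (lam * ∫ x in Set.Ioo a b, (w x - G x) ^ 2)

/-- The Rudin–Osher–Fatemi energy `|w'|(]a,b[) + λ∫_a^b (w-g)²`, where `(ηp, ηn)`
is the Jordan decomposition of the derivative of `w`. -/
def ROFenergy (a b lam : ℝ) (g w : ℝ → ℝ) (ηp ηn : Measure ℝ) : ℝ≥0∞ :=
  (ηp + ηn) (Set.Ioo a b) + ENNReal.ofReal (lam * ∫ x in Set.Ioo a b, (w x - g x) ^ 2)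

/-- The left-continuous generalized inverse `g^{-1}(c) = inf {x ∈ [a,b] : g(x) ≥ c}`. -/
def gInv (a b : ℝ) (g : ℝ → ℝ) (c : ℝ) : ℝ :=
  sInf {x | x ∈ Set.Icc a b ∧ c ≤ g x}

end

noncomputable section
open MeasureTheory Filter Set Topology
open scoped ENNReal NNReal

namespace PsiHypP

variable {ψ : ℝ → ℝ} {p : ℝ}

lemma measurable_rpow (hψ : PsiHypP ψ p) : Measurable fun t => ψ t ^ (1 / p) :=
  hψ.measurable.pow_const _

lemma rpow_pos (hψ : PsiHypP ψ p) (t : ℝ) : 0 < ψ t ^ (1 / p) :=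
  Real.rpow_pos_of_pos (hψ.pos t) _

lemma exists_rpow_le (hψ : PsiHypP ψ p) (hp : 1 < p) : ∃ C, 0 < C ∧ ∀ t, ψ t ^ (1 / p) ≤ C := by
  obtain ⟨C, hC⟩ := hψ.bounded
  have hC0 : 0 < C := (hψ.pos 0).trans_le (hC 0)
  exact ⟨C ^ (1 / p), Real.rpow_pos_of_pos hC0 _, fun t =>
    Real.rpow_le_rpow (hψ.pos t).le (hC t) (by positivity)⟩

lemma exists_le_rpow (hψ : PsiHypP ψ p) (hp : 1 < p) (T : ℝ) :
    ∃ δ, 0 < δ ∧ ∀ t ∈ Icc (-T) T, δ ≤ ψ t ^ (1 / p) := by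
  obtain ⟨δ, hδ, h⟩ := hψ.inf_pos (Icc (-T) T) isCompact_Icc
  exact ⟨δ ^ (1 / p), Real.rpow_pos_of_pos hδ _, fun t ht =>
    Real.rpow_le_rpow hδ.le (h t ht) (by positivity)⟩

lemma intervalIntegrable_rpow (hψ : PsiHypP ψ p) (x y : ℝ) :
    IntervalIntegrable (fun t => ψ t ^ (1 / p)) volume x y :=
  hψ.integrable.intervalIntegrable

lemma Psip_sub (hψ : PsiHypP ψ p) (x y : ℝ) :
    Psip ψ p y - Psip ψ p x = ∫ t in x..y, ψ t ^ (1 / p) :=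
  intervalIntegral.integral_Iic_sub_Iic hψ.integrable.integrableOn hψ.integrable.integrableOn

lemma Psip_strictMono (hψ : PsiHypP ψ p) : StrictMono (Psip ψ p) := by
  intro x y hxy
  have := hψ.Psip_sub x y
  have h2 : 0 < ∫ t in x..y, ψ t ^ (1 / p) :=
    intervalIntegral.intervalIntegral_pos_of_pos (hψ.intervalIntegrable_rpow x y) hψ.rpow_pos hxy
  linarith

lemma continuous_Psip (hψ : PsiHypP ψ p) : Continuous (Psip ψ p) := by
  have : Psip ψ p = fun y => Psip ψ p 0 + ∫ t in (0:ℝ)..y, ψ t ^ (1 / p) := by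
    ext y; rw [← hψ.Psip_sub]; ring
  rw [this]
  exact continuous_const.add (intervalIntegral.continuous_primitive hψ.intervalIntegrable_rpow 0)

lemma tendsto_Psip_atTop (hψ : PsiHypP ψ p) :
    Tendsto (Psip ψ p) atTop (𝓝 (∫ t, ψ t ^ (1 / p))) :=
  (aecover_Iic tendsto_id).integral_tendsto_of_countably_generated hψ.integrable

lemma tendsto_Psip_atBot (hψ : PsiHypP ψ p) :
    Tendsto (Psip ψ p) atBot (𝓝 0) := by
  have h := (aecover_Ioi (μ := (volume : Measure ℝ)) (tendsto_id (x := atBot))).integral_tendsto_of_countably_generated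
    hψ.integrable
  have h2 : ∀ t, Psip ψ p t = (∫ t, ψ t ^ (1 / p)) - ∫ s in Ioi t, ψ s ^ (1 / p) := by
    intro t
    rw [← integral_add_compl (measurableSet_Iic (a := t)) hψ.integrable, compl_Iic, Psip]
    ring
  have := (tendsto_const_nhds (x := ∫ t, ψ t ^ (1 / p))).sub h
  rw [sub_self] at this
  exact this.congr fun t => (h2 t).symm

lemma Psip_pos (hψ : PsiHypP ψ p) (t : ℝ) : 0 < Psip ψ p t := by
  have h1 : 0 ≤ Psip ψ p (t - 1) :=
    le_of_tendsto hψ.tendsto_Psip_atBot <| by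
      filter_upwards [eventually_le_atBot (t - 1)] with x hx using hψ.Psip_strictMono.monotone hx
  exact h1.trans_lt (hψ.Psip_strictMono (by linarith))

lemma Psip_lt (hψ : PsiHypP ψ p) (t : ℝ) : Psip ψ p t < ∫ t, ψ t ^ (1 / p) := by
  have h1 : Psip ψ p (t + 1) ≤ ∫ t, ψ t ^ (1 / p) :=
    ge_of_tendsto hψ.tendsto_Psip_atTop <| by
      filter_upwards [eventually_ge_atTop (t + 1)] with x hx using hψ.Psip_strictMono.monotone hx
  exact (hψ.Psip_strictMono (by linarith : t < t + 1)).trans_le h1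

lemma exists_Psip_eq (hψ : PsiHypP ψ p) {y : ℝ} (h0 : 0 < y) (h1 : y < ∫ t, ψ t ^ (1 / p)) :
    ∃ t, Psip ψ p t = y := by
  have := mem_range_of_exists_le_of_exists_ge hψ.continuous_Psip (c := y)
    (((hψ.tendsto_Psip_atBot.eventually (eventually_lt_nhds h0)).exists).imp fun _ h => h.le)
    (((hψ.tendsto_Psip_atTop.eventually (eventually_gt_nhds h1)).exists).imp fun _ h => h.le)
  exact this

/-- On bounded intervals `Ψ_p` expands distances by at least a positive factor. -/
lemma exists_mul_abs_sub_le (hψ : PsiHypP ψ p) (hp : 1 < p) (T : ℝ) :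
    ∃ δ, 0 < δ ∧ ∀ s ∈ Icc (-T) T, ∀ t ∈ Icc (-T) T,
      δ * |s - t| ≤ |Psip ψ p s - Psip ψ p t| := by
  obtain ⟨δ, hδ, h⟩ := hψ.exists_le_rpow hp T
  refine ⟨δ, hδ, fun s hs t ht => ?_⟩
  wlog hst : t ≤ s generalizing s t
  · rw [abs_sub_comm s, abs_sub_comm (Psip ψ p s)]
    exact this t ht s hs (le_of_not_ge hst)
  rw [abs_of_nonneg (sub_nonneg.2 hst), hψ.Psip_sub]
  refine le_trans ?_ (le_abs_self _)
  calc δ * (s - t) = ∫ _ in t..s, δ := by simp [mul_comm]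
    _ ≤ _ := intervalIntegral.integral_mono_on hst (by simp) (hψ.intervalIntegrable_rpow _ _)
      fun x hx => h x ⟨ht.1.trans hx.1, hx.2.trans hs.2⟩

end PsiHypP

lemma AbsolutelyContinuousOnInterval.lipschitz_comp {f v : ℝ → ℝ} {K : ℝ≥0} {a b : ℝ}
    (hf : LipschitzWith K f) (hv : AbsolutelyContinuousOnInterval v a b) :
    AbsolutelyContinuousOnInterval (f ∘ v) a b := by
  have h : Tendsto (fun E : ℕ × (ℕ → ℝ × ℝ) =>
      (K : ℝ) * ∑ i ∈ Finset.range E.1, dist (v (E.2 i).1) (v (E.2 i).2))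
      (AbsolutelyContinuousOnInterval.totalLengthFilter ⊓
        𝓟 (AbsolutelyContinuousOnInterval.disjWithin a b)) (𝓝 0) := by
    simpa using Tendsto.const_mul (K : ℝ) hv
  refine squeeze_zero (fun E => Finset.sum_nonneg fun _ _ => dist_nonneg) (fun E => ?_) h
  rw [Finset.mul_sum]
  exact Finset.sum_le_sum fun i _ => hf.dist_le_mul _ _

/-- Change of variables `∫_{v x}^{v y} f = ∫_x^y f(v) v'` for a primitive `v` of an integrable
function and `f` continuous and bounded. -/
lemma integral_comp_primitive_of_continuous {v w : ℝ → ℝ} (hw : Integrable w)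
    (hv : ∀ x y, v y - v x = ∫ t in x..y, w t) {f : ℝ → ℝ} (hf : Continuous f) {C : ℝ}
    (hC : ∀ t, |f t| ≤ C) (x y : ℝ) :
    ∫ s in v x..v y, f s = ∫ t in x..y, f (v t) * w t := by
  have hC0 : 0 ≤ C := (abs_nonneg _).trans (hC 0)
  let F : ℝ → ℝ := fun z => ∫ s in v x..z, f s
  have hF : ∀ z, HasDerivAt F (f z) z := fun z =>
    (hf.integral_hasStrictDerivAt (v x) z).hasDerivAt
  have hFL : LipschitzWith ⟨C, hC0⟩ F :=
    lipschitzWith_of_nnnorm_deriv_le (fun z => (hF z).differentiableAt) fun z => by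
      rw [(hF z).deriv]; exact hC z
  have hvac : AbsolutelyContinuousOnInterval v x y := by
    have h1 := (hw.intervalIntegrable (a := x) (b := y)).absolutelyContinuousOnInterval_intervalIntegral
      (c := x) left_mem_uIcc
    have h2 : v = (fun z => v x + z) ∘ fun z => ∫ s in x..z, w s := by
      ext z; simp [← hv]
    rw [h2]
    exact AbsolutelyContinuousOnInterval.lipschitz_comp (K := 1)
      (LipschitzWith.of_dist_le_mul fun a b => by simp) h1
  have hac := AbsolutelyContinuousOnInterval.lipschitz_comp hFL hvac
  have h := hac.integral_deriv_eq_sub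
  have h3 : F (v x) = 0 := intervalIntegral.integral_same
  rw [Function.comp_apply, Function.comp_apply, h3, sub_zero] at h
  rw [← show F (v y) = ∫ s in v x..v y, f s from rfl, ← h]
  refine intervalIntegral.integral_congr_ae ?_
  filter_upwards [LocallyIntegrable.ae_hasDerivAt_integral hw.locallyIntegrable] with t ht _
  have h4 : HasDerivAt v (w t) t := by
    have h2 : v = fun z => v x + ∫ s in x..z, w s := by
      ext z; simp [← hv]
    rw [h2]
    exact (ht x).const_add _
  exact ((hF (v t)).comp t h4).deriv

/-- Change of variables `∫_{v x}^{v y} f = ∫_x^y f(v) v'` for a primitive `v` of an integrable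
function and `f` measurable and bounded. -/
lemma integral_comp_primitive {v w : ℝ → ℝ} (hw : Integrable w)
    (hv : ∀ x y, v y - v x = ∫ t in x..y, w t) {f : ℝ → ℝ} (hf : Measurable f) {C : ℝ}
    (hC : ∀ t, |f t| ≤ C) (x y : ℝ) :
    ∫ s in v x..v y, f s = ∫ t in x..y, f (v t) * w t := by
  wlog hxy : x ≤ y generalizing x y
  · rw [intervalIntegral.integral_symm, this y x (le_of_not_ge hxy),
      ← intervalIntegral.integral_symm]
  have hvc : Continuous v := by
    have h2 : v = fun z => v x + ∫ s in x..z, w s := by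
      ext z; simp [← hv]
    rw [h2]
    exact continuous_const.add (intervalIntegral.continuous_primitive
      (fun _ _ => hw.intervalIntegrable) x)
  let P : Measure ℝ := (volume.restrict (Ioc x y)).withDensity fun t => ENNReal.ofReal (w t)
  let N : Measure ℝ := (volume.restrict (Ioc x y)).withDensity fun t => ENNReal.ofReal (-w t)
  have hPf : IsFiniteMeasure P :=
    isFiniteMeasure_withDensity_ofReal hw.integrableOn.2
  have hNf : IsFiniteMeasure N :=
    isFiniteMeasure_withDensity_ofReal hw.neg.integrableOn.2
  let α : Measure ℝ := P.map v + volume.restrict (Ioc (v y) (v x))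
  let β : Measure ℝ := N.map v + volume.restrict (Ioc (v x) (v y))
  have key : ∀ g : ℝ → ℝ, Measurable g → ∀ C, (∀ t, |g t| ≤ C) →
      (∫ t, g t ∂α) - ∫ t, g t ∂β =
        (∫ t in x..y, g (v t) * w t) - ∫ s in v x..v y, g s := by
    intro g hg C hC
    have hint : ∀ (m : Measure ℝ) [IsFiniteMeasure m], Integrable g m := fun m _ =>
      Integrable.of_bound hg.aestronglyMeasurable C (ae_of_all _ hC)
    have hgw : ∀ h : ℝ → ℝ, Integrable h → Integrable (fun t => g (v t) * h t) := fun h hh =>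
      hh.bdd_mul (hg.comp hvc.measurable).aestronglyMeasurable (c := C) (ae_of_all _ fun t => hC _)
    have hP : ∫ t, g t ∂P.map v = ∫ t in Ioc x y, g (v t) * max (w t) 0 := by
      rw [integral_map hvc.aemeasurable hg.aestronglyMeasurable,
        integral_withDensity_eq_integral_toReal_smul₀
          hw.integrableOn.aemeasurable.ennreal_ofReal (ae_of_all _ fun t => ENNReal.ofReal_lt_top)]
      simp only [ENNReal.toReal_ofReal', smul_eq_mul, mul_comm]
    have hN : ∫ t, g t ∂N.map v = ∫ t in Ioc x y, g (v t) * max (-w t) 0 := by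
      rw [integral_map hvc.aemeasurable hg.aestronglyMeasurable,
        integral_withDensity_eq_integral_toReal_smul₀
          (f := fun t => ENNReal.ofReal (-w t)) hw.neg.integrableOn.aemeasurable.ennreal_ofReal
            (ae_of_all _ fun t => ENNReal.ofReal_lt_top)]
      simp only [ENNReal.toReal_ofReal', smul_eq_mul, mul_comm]
    rw [integral_add_measure (hint _) (hint _), integral_add_measure (hint _) (hint _), hP, hN,
      intervalIntegral.integral_of_le hxy, intervalIntegral]
    have : ∫ t in Ioc x y, g (v t) * w t = (∫ t in Ioc x y, g (v t) * max (w t) 0) -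
        ∫ t in Ioc x y, g (v t) * max (-w t) 0 := by
      rw [← integral_sub (hgw _ hw.pos_part).integrableOn (hgw _ hw.neg_part).integrableOn]
      refine integral_congr_ae (ae_of_all _ fun t => ?_)
      simp only
      rw [← mul_sub, max_zero_sub_max_neg_zero_eq_self]
    rw [this]; ring
  have hαβ : α = β := by
    refine ext_of_forall_integral_eq_of_IsFiniteMeasure fun g => ?_
    have h1 := key g g.continuous.measurable ‖g‖ g.norm_coe_le_norm
    rw [integral_comp_primitive_of_continuous hw hv g.continuous g.norm_coe_le_norm, sub_self] at h1
    linarith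
  have := key f hf C hC
  rw [hαβ, sub_self] at this
  linarith

/-- Change of variables for a primitive given on an open interval only. -/
lemma integral_comp_primitive_on {a b : ℝ} {v w : ℝ → ℝ} (hw : IntegrableOn w (Ioo a b))
    (hv : ∀ x ∈ Ioo a b, ∀ y ∈ Ioo a b, v y - v x = ∫ t in x..y, w t)
    {f : ℝ → ℝ} (hf : Measurable f) {C : ℝ} (hC : ∀ t, |f t| ≤ C) {x y : ℝ}
    (hx : x ∈ Ioo a b) (hy : y ∈ Ioo a b) :
    ∫ s in v x..v y, f s = ∫ t in x..y, f (v t) * w t := by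
  let w' := (Ioo a b).indicator w
  let v' : ℝ → ℝ := fun z => v x + ∫ t in x..z, w' t
  have hw' : Integrable w' := hw.integrable_indicator measurableSet_Ioo
  have hsub : ∀ z ∈ Ioo a b, uIcc x z ⊆ Ioo a b := fun z hz =>
    (ordConnected_Ioo (a := a) (b := b)).uIcc_subset hx hz
  have hv' : ∀ z ∈ Ioo a b, v' z = v z := by
    intro z hz
    have : ∫ t in x..z, w' t = ∫ t in x..z, w t :=
      intervalIntegral.integral_congr fun t ht => indicator_of_mem (hsub z hz ht) _
    simp only [v', this, ← hv x hx z hz]; ring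
  have h := integral_comp_primitive hw' (v := v') (fun s t => by
    simp only [v', add_sub_add_left_eq_sub]
    exact intervalIntegral.integral_interval_sub_left hw'.intervalIntegrable
      hw'.intervalIntegrable) hf hC x y
  rw [hv' x hx, hv' y hy] at h
  rw [h]
  refine intervalIntegral.integral_congr fun t ht => ?_
  have ht' := hsub y hy ht
  simp only [hv' t ht', w', indicator_of_mem ht']

lemma exists_contDiff_one_on_compact {K V : Set ℝ} (hK : IsCompact K) (hV : IsOpen V)
    (hKV : K ⊆ V) : ∃ φ : ℝ → ℝ, ContDiff ℝ 1 φ ∧ HasCompactSupport φ ∧ tsupport φ ⊆ V ∧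
      (∀ x, 0 ≤ φ x) ∧ (∀ x, φ x ≤ 1) ∧ ∀ x ∈ K, φ x = 1 := by
  obtain ⟨δ, hδ, hKδ⟩ := hK.exists_cthickening_subset_open hV hKV
  obtain ⟨φ, h1, h2, h3, h4⟩ := exists_contMDiff_support_eq_eq_one_iff (n := 1)
    (modelWithCornersSelf ℝ ℝ)
    (Metric.isOpen_thickening (δ := δ) (E := K)) hK.isClosed (Metric.self_subset_thickening hδ K)
  have hts : tsupport φ ⊆ Metric.cthickening δ K := by
    rw [tsupport, h3]; exact Metric.closure_thickening_subset_cthickening δ K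
  refine ⟨φ, h1.contDiff, hK.cthickening.of_isClosed_subset (isClosed_tsupport φ) hts,
    hts.trans hKδ, fun x => (h2 (mem_range_self x)).1, fun x => (h2 (mem_range_self x)).2,
    fun x hx => (h4 x).1 hx⟩

/-- A comparison of integrals of nonnegative test functions supported in an open set yields a
comparison of the measures there. -/
lemma measure_le_of_forall_integral_le {μ ν : Measure ℝ} [IsFiniteMeasure μ] [IsFiniteMeasure ν]
    {O : Set ℝ} (hO : IsOpen O)
    (h : ∀ φ : ℝ → ℝ, ContDiff ℝ 1 φ → HasCompactSupport φ → tsupport φ ⊆ O → (∀ x, 0 ≤ φ x) →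
      ∫ x, φ x ∂μ ≤ ∫ x, φ x ∂ν) {A : Set ℝ} (hA : MeasurableSet A) (hAO : A ⊆ O) :
    μ A ≤ ν A := by
  have hcomp : ∀ K ⊆ O, IsCompact K → μ K ≤ ν K := by
    intro K hKO hK
    rw [K.measure_eq_iInf_isOpen ν]
    refine le_iInf₂ fun V hKV => le_iInf fun hV => ?_
    obtain ⟨φ, hφ, hφc, hφs, hφ0, hφ1, hφK⟩ :=
      exists_contDiff_one_on_compact hK (hV.inter hO) (subset_inter hKV hKO)
    have hi : ∀ (m : Measure ℝ) [IsFiniteMeasure m], Integrable φ m := fun m _ =>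
      hφ.continuous.integrable_of_hasCompactSupport hφc
    have h1 : μ.real K ≤ ∫ x, φ x ∂μ := by
      rw [← integral_indicator_one hK.measurableSet]
      refine integral_mono ((integrable_const 1).indicator hK.measurableSet) (hi μ) fun x => ?_
      by_cases hx : x ∈ K
      · simp [hx, hφK x hx]
      · simp [hx, hφ0 x]
    have h2 : ∫ x, φ x ∂ν ≤ ν.real V := by
      rw [← integral_indicator_one hV.measurableSet]
      refine integral_mono (hi ν) ((integrable_const 1).indicator hV.measurableSet) fun x => ?_
      by_cases hx : x ∈ V
      · simp [hx, hφ1 x]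
      · have : φ x = 0 := image_eq_zero_of_notMem_tsupport fun hx' => hx (hφs hx').1
        simp [hx, this]
    have h3 := h1.trans ((h φ hφ hφc (hφs.trans inter_subset_right) hφ0).trans h2)
    exact (ENNReal.toReal_le_toReal (measure_ne_top _ _) (measure_ne_top _ _)).1 h3
  rw [hA.measure_eq_iSup_isCompact_of_ne_top (measure_ne_top μ A)]
  exact iSup₂_le fun K hKA => iSup_le fun hK =>
    (hcomp K (hKA.trans hAO) hK).trans (measure_mono hKA)

lemma measure_eq_of_forall_integral_eq {μ ν : Measure ℝ} [IsFiniteMeasure μ] [IsFiniteMeasure ν]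
    {O : Set ℝ} (hO : IsOpen O)
    (h : ∀ φ : ℝ → ℝ, ContDiff ℝ 1 φ → HasCompactSupport φ → tsupport φ ⊆ O → (∀ x, 0 ≤ φ x) →
      ∫ x, φ x ∂μ = ∫ x, φ x ∂ν) {A : Set ℝ} (hA : MeasurableSet A) (hAO : A ⊆ O) :
    μ A = ν A :=
  le_antisymm
    (measure_le_of_forall_integral_le hO (fun φ h1 h2 h3 h4 => (h φ h1 h2 h3 h4).le) hA hAO)
    (measure_le_of_forall_integral_le hO (fun φ h1 h2 h3 h4 => (h φ h1 h2 h3 h4).ge) hA hAO)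

lemma measure_eq_of_compl_null {μ ν : Measure ℝ} {O : Set ℝ} (hO : MeasurableSet O)
    (hμ : μ Oᶜ = 0) (hν : ν Oᶜ = 0) (h : ∀ A, MeasurableSet A → A ⊆ O → μ A = ν A) : μ = ν := by
  ext A hA
  rw [← measure_inter_add_sdiff A hO, ← measure_inter_add_sdiff (μ := ν) A hO,
    h _ (hA.inter hO) inter_subset_right,
    measure_mono_null (s := A \ O) (fun x hx => hx.2) hμ,
    measure_mono_null (s := A \ O) (fun x hx => hx.2) hν]

/-- Mutually singular decompositions of a difference of finite measures are unique. -/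
lemma eq_of_add_eq_add_of_mutuallySingular {μp μn νp νn : Measure ℝ} [IsFiniteMeasure μp]
    [IsFiniteMeasure μn] [IsFiniteMeasure νp] [IsFiniteMeasure νn] (hμ : μp ⟂ₘ μn)
    (hν : νp ⟂ₘ νn) (h : μp + νn = νp + μn) : μp = νp ∧ μn = νn := by
  let j₁ : JordanDecomposition ℝ := ⟨μp, μn, hμ⟩
  let j₂ : JordanDecomposition ℝ := ⟨νp, νn, hν⟩
  have : j₁ = j₂ := by
    apply JordanDecomposition.toSignedMeasure_injective
    simp only [JordanDecomposition.toSignedMeasure, j₁, j₂]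
    rw [sub_eq_sub_iff_add_eq_add, ← Measure.toSignedMeasure_add, ← Measure.toSignedMeasure_add]
    simp only [h]
  exact ⟨congrArg JordanDecomposition.posPart this, congrArg JordanDecomposition.negPart this⟩

lemma IsDerivMeasures.unique {a b : ℝ} {u : ℝ → ℝ} {μp μn νp νn : Measure ℝ}
    (hμ : IsDerivMeasures a b u μp μn) (hν : IsDerivMeasures a b u νp νn) :
    μp = νp ∧ μn = νn := by
  obtain ⟨-, h1, h2, h3, h4, h5, h6⟩ := hμ
  obtain ⟨-, k1, k2, k3, k4, k5, k6⟩ := hν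
  refine eq_of_add_eq_add_of_mutuallySingular h3 k3 ?_
  refine measure_eq_of_compl_null (O := Ioo a b) measurableSet_Ioo (by simp [h4, k5])
    (by simp [h5, k4]) fun A hA hAO =>
      measure_eq_of_forall_integral_eq isOpen_Ioo (fun φ hφ hφc hφs _ => ?_) hA hAO
  have hi : ∀ (m : Measure ℝ) [IsFiniteMeasure m], Integrable φ m := fun m _ =>
    hφ.continuous.integrable_of_hasCompactSupport hφc
  rw [integral_add_measure (hi _) (hi _), integral_add_measure (hi _) (hi _)]
  have := h6 φ hφ hφs
  rw [k6 φ hφ hφs] at this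
  linarith

lemma monotone_real_Iio (μ : Measure ℝ) [IsFiniteMeasure μ] :
    Monotone fun x => μ.real (Iio x) := fun _ _ hxy =>
  measureReal_mono (Iio_subset_Iio hxy)

lemma integral_real_Iio_mul_deriv (μ : Measure ℝ) [IsFiniteMeasure μ] {φ : ℝ → ℝ}
    (hφ : ContDiff ℝ 1 φ) (hφc : HasCompactSupport φ) :
    ∫ x, μ.real (Iio x) * deriv φ x = -∫ t, φ t ∂μ := by
  have hd : Integrable (deriv φ) :=
    (hφ.continuous_deriv le_rfl).integrable_of_hasCompactSupport hφc.deriv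
  have hi : Integrable (Function.uncurry fun x t : ℝ => (Iio x).indicator (fun _ => deriv φ x) t)
      ((volume : Measure ℝ).prod μ) :=
    (hd.comp_fst μ).indicator (measurableSet_lt measurable_snd measurable_fst)
  calc ∫ x, μ.real (Iio x) * deriv φ x
      = ∫ x, ∫ t, (Iio x).indicator (fun _ => deriv φ x) t ∂μ := by
        congr 1; ext x; rw [integral_indicator_const _ measurableSet_Iio, smul_eq_mul]
    _ = ∫ t, (∫ x, (Ioi t).indicator (deriv φ) x) ∂μ := by
        rw [integral_integral_swap hi]
        simp [indicator]
    _ = -∫ t, φ t ∂μ := by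
        rw [← integral_neg]
        congr 1; ext t
        rw [integral_indicator measurableSet_Ioi, hφc.integral_Ioi_deriv_eq hφ]

/-- A smooth function with compact support in an interval and vanishing integral is the
derivative of a test function. -/
lemma exists_deriv_eq_of_integral_eq_zero {a b : ℝ} {η : ℝ → ℝ} (hη : Continuous η)
    (hηc : HasCompactSupport η) (hηs : tsupport η ⊆ Ioo a b) (h0 : ∫ x, η x = 0) :
    ∃ φ : ℝ → ℝ, ContDiff ℝ 1 φ ∧ tsupport φ ⊆ Ioo a b ∧ deriv φ = η := by
  rcases (tsupport η).eq_empty_or_nonempty with he | hne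
  · refine ⟨fun _ => 0, contDiff_const, by simp [tsupport], ?_⟩
    ext x
    have : x ∉ tsupport η := by simp [he]
    rw [image_eq_zero_of_notMem_tsupport this]; simp
  set c := sInf (tsupport η) with hc
  set d := sSup (tsupport η) with hd
  have hcm : c ∈ Ioo a b := hηs (hηc.isCompact.sInf_mem hne)
  have hdm : d ∈ Ioo a b := hηs (hηc.isCompact.sSup_mem hne)
  have hz : ∀ x, x ∉ Icc c d → η x = 0 := fun x hx =>
    image_eq_zero_of_notMem_tsupport fun hx' =>
      hx ⟨csInf_le hηc.isCompact.bddBelow hx', le_csSup hηc.isCompact.bddAbove hx'⟩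
  have hηi : Integrable η := hη.integrable_of_hasCompactSupport hηc
  have hder : ∀ x, HasDerivAt (fun x => ∫ t in c..x, η t) (η x) x := fun x =>
    (hη.integral_hasStrictDerivAt c x).hasDerivAt
  have hderiv : deriv (fun x => ∫ t in c..x, η t) = η := funext fun x => (hder x).deriv
  refine ⟨fun x => ∫ t in c..x, η t, ?_, ?_, hderiv⟩
  · rw [contDiff_one_iff_deriv]
    exact ⟨fun x => (hder x).differentiableAt, by rw [hderiv]; exact hη⟩
  · refine (closure_minimal ?_ isClosed_Icc).trans
      (Icc_subset_Ioo hcm.1 hdm.2 : Icc c d ⊆ Ioo a b)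
    intro x hx
    by_contra hx'
    apply hx
    rcases lt_or_ge x c with h | h
    · change ∫ t in c..x, η t = 0
      rw [intervalIntegral.integral_symm, intervalIntegral.integral_of_le h.le,
        integral_Ioc_eq_integral_Ioo, setIntegral_eq_zero_of_forall_eq_zero, neg_zero]
      exact fun t ht => hz t fun ht' => absurd ht'.1 (not_le.2 ht.2)
    · have hd' : d < x := lt_of_not_ge fun h2 => hx' ⟨h, h2⟩
      change ∫ t in c..x, η t = 0
      rw [intervalIntegral.integral_of_le h, ← integral_Icc_eq_integral_Ioc,
        setIntegral_eq_integral_of_forall_compl_eq_zero, h0]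
      exact fun t ht => hz t fun ht' => ht ⟨ht'.1, ht'.2.trans hd'.le⟩

/-- A function with vanishing distributional derivative on an interval is constant. -/
lemma exists_ae_eq_const_of_forall_integral_deriv {a b : ℝ} (hab : a < b) {f : ℝ → ℝ}
    (hf : IntegrableOn f (Ioo a b))
    (h : ∀ φ : ℝ → ℝ, ContDiff ℝ 1 φ → tsupport φ ⊆ Ioo a b →
      ∫ x in Ioo a b, f x * deriv φ x = 0) :
    ∃ C, ∀ᵐ x ∂(volume.restrict (Ioo a b)), f x = C := by
  have hmid : (a + b) / 2 ∈ Ioo a b := ⟨by linarith, by linarith⟩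
  let β : ContDiffBump ((a + b) / 2) :=
    ⟨(b - a) / 8, (b - a) / 4, by linarith, by linarith⟩
  let φ₀ : ℝ → ℝ := β.normed volume
  have hφ₀ : ContDiff ℝ 1 φ₀ := β.contDiff_normed (n := 1)
  have hφ₀c : HasCompactSupport φ₀ := β.hasCompactSupport_normed
  have hφ₀s : tsupport φ₀ ⊆ Ioo a b := by
    change tsupport (β.normed volume) ⊆ Ioo a b
    rw [β.tsupport_normed_eq, Real.closedBall_eq_Icc]
    refine Icc_subset_Ioo ?_ ?_ <;> simp only [β] <;> linarith
  have hφ₀1 : ∫ x, φ₀ x = 1 := β.integral_normed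
  have hmul : ∀ g : ℝ → ℝ, Continuous g → HasCompactSupport g → 
      IntegrableOn (fun x => f x * g x) (Ioo a b) := fun g hg hgc => by
    obtain ⟨C, hC⟩ := hgc.exists_bound_of_continuous hg
    exact Integrable.mul_bdd (c := C) hf hg.aestronglyMeasurable (Eventually.of_forall hC)
  set C := ∫ x in Ioo a b, f x * φ₀ x with hC
  refine ⟨C, ?_⟩
  have key : ∀ᵐ x ∂volume, x ∈ Ioo a b → f x - C = 0 := by
    refine isOpen_Ioo.ae_eq_zero_of_integral_contDiff_smul_eq_zero
      (f := fun x => f x - C) ((hf.sub (integrableOn_const (by simp))).locallyIntegrableOn)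
        fun g hg hgc hgs => ?_
    have hgi : Integrable g := hg.continuous.integrable_of_hasCompactSupport hgc
    obtain ⟨Φ, hΦ, hΦs, hΦd⟩ := exists_deriv_eq_of_integral_eq_zero (a := a) (b := b)
      (η := fun x => g x - (∫ y, g y) * φ₀ x) (hg.continuous.sub (hφ₀.continuous.const_mul _))
      (hgc.sub (hφ₀c.mul_left)) ((tsupport_sub _ _).trans (union_subset hgs
        ((closure_mono (Function.support_mul_subset_right _ _)).trans hφ₀s)))
      (by rw [integral_sub hgi ((hφ₀.continuous.integrable_of_hasCompactSupport hφ₀c).const_mul _),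
            integral_const_mul, hφ₀1]; ring)
    have h1 := h Φ hΦ hΦs
    rw [hΦd] at h1
    have h2 : ∫ x in Ioo a b, f x * (g x - (∫ y, g y) * φ₀ x) =
        (∫ x in Ioo a b, f x * g x) - (∫ y, g y) * C := by
      rw [hC, ← integral_const_mul, ← integral_sub (hmul g hg.continuous hgc)
        ((hmul φ₀ hφ₀.continuous hφ₀c).const_mul _)]
      congr 1; ext x; ring
    have h3 : ∫ x, g x • (f x - C) = ∫ x in Ioo a b, (f x * g x - C * g x) := by
      rw [← setIntegral_eq_integral_of_forall_compl_eq_zero (s := Ioo a b)]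
      · congr 1; ext x; simp; ring
      · intro x hx
        rw [image_eq_zero_of_notMem_tsupport fun hx' => hx (hgs hx'), zero_smul]
    rw [h3, integral_sub (hmul g hg.continuous hgc) (hgi.integrableOn.const_mul _),
      integral_const_mul, setIntegral_eq_integral_of_forall_compl_eq_zero (s := Ioo a b) (f := g)]
    · linarith
    · intro x hx
      exact image_eq_zero_of_notMem_tsupport fun hx' => hx (hgs hx')
  rw [ae_restrict_iff' measurableSet_Ioo]
  filter_upwards [key] with x hx hxm
  linarith [hx hxm]

lemma hasCompactSupport_of_tsupport_subset_Ioo {a b : ℝ} {φ : ℝ → ℝ}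
    (h : tsupport φ ⊆ Ioo a b) : HasCompactSupport φ :=
  isCompact_Icc.of_isClosed_subset (isClosed_tsupport φ) (h.trans Ioo_subset_Icc_self)

/-- Functions of bounded variation are a.e. given by the distribution function of their
derivative. -/
lemma IsDerivMeasures.exists_ae_eq {a b : ℝ} (hab : a < b) {u : ℝ → ℝ} {μp μn : Measure ℝ}
    (h : IsDerivMeasures a b u μp μn) :
    ∃ C, ∀ᵐ x ∂(volume.restrict (Ioo a b)), u x = C + (μp.real (Iio x) - μn.real (Iio x)) := by
  obtain ⟨hu, h1, h2, -, -, -, h6⟩ := h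
  have hi : ∀ (m : Measure ℝ) [IsFiniteMeasure m],
      IntegrableOn (fun x => m.real (Iio x)) (Ioo a b) := fun m _ =>
    Measure.integrableOn_of_bounded (M := m.real univ) (by simp)
      (monotone_real_Iio m).measurable.aestronglyMeasurable
      (Eventually.of_forall fun x => by
        rw [Real.norm_of_nonneg measureReal_nonneg]; exact measureReal_mono (subset_univ _))
  obtain ⟨C, hC⟩ := exists_ae_eq_const_of_forall_integral_deriv hab
    (f := fun x => u x - (μp.real (Iio x) - μn.real (Iio x)))
    (hu.sub ((hi μp).sub (hi μn))) fun φ hφ hφs => by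
      have hφc := hasCompactSupport_of_tsupport_subset_Ioo hφs
      have hdc := hφ.continuous_deriv le_rfl
      obtain ⟨K, hK⟩ := hφc.deriv.exists_bound_of_continuous hdc
      have hmul : ∀ g : ℝ → ℝ, IntegrableOn g (Ioo a b) → 
          IntegrableOn (fun x => g x * deriv φ x) (Ioo a b) := fun g hg =>
        Integrable.mul_bdd (c := K) hg hdc.aestronglyMeasurable (Eventually.of_forall hK)
      have hE : ∀ (m : Measure ℝ) [IsFiniteMeasure m],
          ∫ x in Ioo a b, m.real (Iio x) * deriv φ x = -∫ t, φ t ∂m := fun m _ => by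
        rw [← integral_real_Iio_mul_deriv m hφ hφc,
          setIntegral_eq_integral_of_forall_compl_eq_zero]
        intro x hx
        rw [image_eq_zero_of_notMem_tsupport
          fun hx' => hx (hφs (closure_minimal (support_deriv_subset) (isClosed_tsupport φ) hx')),
          mul_zero]
      simp only [sub_mul]
      rw [integral_sub (g := fun x => μp.real (Iio x) * deriv φ x - μn.real (Iio x) * deriv φ x)
          (hmul _ hu) ((hmul _ (hi μp)).sub (hmul _ (hi μn))),
        integral_sub (hmul _ (hi μp)) (hmul _ (hi μn)), h6 φ hφ hφs, hE, hE]
      ring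
  refine ⟨C, hC.mono fun x hx => by linarith⟩

lemma setIntegral_abs_rpow_le {p : ℝ} (hp : 1 < p) {W : ℝ → ℝ} {s : Set ℝ}
    (hs : volume s ≠ ⊤) (hW : IntegrableOn W s) (hWp : IntegrableOn (fun x => |W x| ^ p) s) :
    (∫ x in s, |W x|) ^ p ≤ volume.real s ^ (p - 1) * ∫ x in s, |W x| ^ p := by
  rcases eq_or_ne (volume s) 0 with h0 | h0
  · rw [Measure.restrict_eq_zero.2 h0]
    simp [Real.zero_rpow (by linarith : p ≠ 0)]
  have hm : 0 < volume.real s := ENNReal.toReal_pos h0 hs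
  have hJ := (convexOn_rpow hp.le).map_set_average_le
    (Real.continuous_rpow_const (by linarith : 0 ≤ p)).continuousOn isClosed_Ici h0 hs
    (Eventually.of_forall fun x => abs_nonneg (W x)) hW.abs hWp
  rw [setAverage_eq, setAverage_eq, smul_eq_mul, smul_eq_mul,
    Real.mul_rpow (by positivity) (by positivity), Real.inv_rpow hm.le] at hJ
  have h1 := mul_le_mul_of_nonneg_left hJ (Real.rpow_nonneg hm.le p)
  rw [← mul_assoc, mul_inv_cancel₀ (Real.rpow_pos_of_pos hm p).ne', one_mul] at h1
  rwa [Real.rpow_sub_one hm.ne', div_mul_eq_mul_div, ← mul_div_assoc', div_eq_inv_mul]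

lemma setIntegral_abs_le {p : ℝ} (hp : 1 < p) {W : ℝ → ℝ} {s : Set ℝ} {m B : ℝ}
    (hs : volume s ≠ ⊤) (hm : volume.real s ≤ m) (hW : Integrable W)
    (hWp : Integrable (fun x => |W x| ^ p)) (hB : ∫ x, |W x| ^ p ≤ B) :
    ∫ x in s, |W x| ≤ m ^ ((p - 1) / p) * B ^ (1 / p) := by
  have hp0 : 0 < p := by linarith
  have hm0 : 0 ≤ m := measureReal_nonneg.trans hm
  have hB0 : 0 ≤ B := (integral_nonneg fun x => by positivity).trans hB
  have h1 := setIntegral_abs_rpow_le hp hs hW.integrableOn hWp.integrableOn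
  have h2 : ∫ x in s, |W x| ^ p ≤ B :=
    (setIntegral_le_integral hWp (Eventually.of_forall fun x => by positivity)).trans hB
  have h3 : (∫ x in s, |W x|) ^ p ≤ m ^ (p - 1) * B :=
    h1.trans (mul_le_mul (Real.rpow_le_rpow measureReal_nonneg hm (by linarith)) h2
      (integral_nonneg fun x => by positivity) (by positivity))
  have h4 := Real.rpow_le_rpow (by positivity) h3 (by positivity : 0 ≤ 1 / p)
  rwa [← Real.rpow_mul (integral_nonneg fun x => abs_nonneg _), mul_one_div_cancel hp0.ne',
    Real.rpow_one, Real.mul_rpow (by positivity) hB0, ← Real.rpow_mul hm0, mul_one_div] at h4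

lemma abs_sub_le_of_primitive {p : ℝ} (hp : 1 < p) {V W : ℝ → ℝ} {B : ℝ} (hW : Integrable W)
    (hWp : Integrable (fun x => |W x| ^ p)) (hB : ∫ x, |W x| ^ p ≤ B)
    (hV : ∀ x y, V y - V x = ∫ t in x..y, W t) (x y : ℝ) :
    |V y - V x| ≤ |y - x| ^ ((p - 1) / p) * B ^ (1 / p) := by
  rw [hV, intervalIntegral.abs_intervalIntegral_eq]
  refine (abs_integral_le_integral_abs).trans (setIntegral_abs_le hp (by simp [uIoc]) ?_ hW hWp hB)
  rw [measureReal_def, uIoc, Real.volume_Ioc, max_sub_min_eq_abs,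
    ENNReal.toReal_ofReal (abs_nonneg _)]

section
open AbsolutelyContinuousOnInterval

lemma sum_dist_le_of_primitive {p : ℝ} (hp : 1 < p) {V W : ℝ → ℝ} {B : ℝ} (hW : Integrable W)
    (hWp : Integrable (fun x => |W x| ^ p)) (hB : ∫ x, |W x| ^ p ≤ B)
    (hV : ∀ x y, V y - V x = ∫ t in x..y, W t) {a b : ℝ} {E : ℕ × (ℕ → ℝ × ℝ)}
    (hE : E ∈ disjWithin a b) :
    ∑ i ∈ Finset.range E.1, dist (V (E.2 i).1) (V (E.2 i).2) ≤
      (∑ i ∈ Finset.range E.1, dist (E.2 i).1 (E.2 i).2) ^ ((p - 1) / p) * B ^ (1 / p) := by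
  have hvol : ∀ x y : ℝ, volume.real (uIoc x y) = dist x y := fun x y => by
    rw [measureReal_def, uIoc, Real.volume_Ioc, max_sub_min_eq_abs,
      ENNReal.toReal_ofReal (abs_nonneg _), Real.dist_eq, abs_sub_comm]
  calc ∑ i ∈ Finset.range E.1, dist (V (E.2 i).1) (V (E.2 i).2)
      ≤ ∑ i ∈ Finset.range E.1, ∫ x in uIoc (E.2 i).1 (E.2 i).2, |W x| :=
        Finset.sum_le_sum fun i _ => by
          rw [dist_comm, Real.dist_eq, hV, intervalIntegral.abs_intervalIntegral_eq]
          exact abs_integral_le_integral_abs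
    _ = ∫ x in ⋃ i ∈ Finset.range E.1, uIoc (E.2 i).1 (E.2 i).2, |W x| :=
        (integral_biUnion_finset _ (fun i _ => measurableSet_uIoc) hE.2
          fun i _ => hW.abs.integrableOn).symm
    _ ≤ _ := by
        refine setIntegral_abs_le hp ?_ ?_ hW hWp hB
        · refine ((measure_biUnion_finset_le _ _).trans_lt ?_).ne
          exact ENNReal.sum_lt_top.2 fun i _ => by simp [uIoc]
        · refine (measureReal_biUnion_finset_le _ _).trans (Finset.sum_le_sum fun i _ => ?_)
          rw [hvol]

/-- Pointwise limits of functions with bounded `p`-energy are absolutely continuous. -/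
lemma absolutelyContinuousOnInterval_of_tendsto {p : ℝ} (hp : 1 < p) {ι : Type*} {l : Filter ι}
    [l.NeBot] {V W : ι → ℝ → ℝ} {g : ℝ → ℝ} {B : ℝ} (hW : ∀ k, Integrable (W k))
    (hWp : ∀ k, Integrable (fun x => |W k x| ^ p)) (hB : ∀ k, ∫ x, |W k x| ^ p ≤ B)
    (hV : ∀ k x y, V k y - V k x = ∫ t in x..y, W k t)
    (hg : ∀ x, Tendsto (fun k => V k x) l (𝓝 (g x))) (a b : ℝ) :
    AbsolutelyContinuousOnInterval g a b := by
  have h1 : Tendsto (fun E : ℕ × (ℕ → ℝ × ℝ) =>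
      (∑ i ∈ Finset.range E.1, dist (E.2 i).1 (E.2 i).2) ^ ((p - 1) / p) * B ^ (1 / p))
      (totalLengthFilter ⊓ 𝓟 (disjWithin a b)) (𝓝 0) := by
    have h0 : Tendsto (fun x : ℝ => x ^ ((p - 1) / p) * B ^ (1 / p)) (𝓝 0) (𝓝 0) := by
      have hpos : 0 < (p - 1) / p := div_pos (by linarith) (by linarith)
      have := ((Real.continuous_rpow_const hpos.le).mul_const (B ^ (1 / p))).tendsto 0
      simpa [Real.zero_rpow hpos.ne'] using this
    exact (h0.comp tendsto_comap).mono_left inf_le_left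
  refine squeeze_zero' (Eventually.of_forall fun E => Finset.sum_nonneg fun _ _ => dist_nonneg)
    ?_ h1
  filter_upwards [mem_inf_of_right (mem_principal_self (disjWithin a b))] with E hE
  refine le_of_tendsto (tendsto_finsetSum _ fun i _ => (hg (E.2 i).1).dist (hg (E.2 i).2))
    (Eventually.of_forall fun k => ?_)
  exact sum_dist_le_of_primitive hp (hW k) (hWp k) (hB k) (hV k) hE

end

lemma lintegral_lintegral_Ioc (F : ℝ → ℝ≥0∞) (hF : Measurable F) (h : ℝ) :
    ∫⁻ x, ∫⁻ t in Ioc x (x + h), F t = ENNReal.ofReal h * ∫⁻ t, F t := by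
  have hS : MeasurableSet {z : ℝ × ℝ | z.2 ∈ Ioc z.1 (z.1 + h)} :=
    (measurableSet_lt measurable_fst measurable_snd).inter
      (measurableSet_le measurable_snd (measurable_fst.add_const h))
  calc ∫⁻ x, ∫⁻ t in Ioc x (x + h), F t
      = ∫⁻ x, ∫⁻ t, {z : ℝ × ℝ | z.2 ∈ Ioc z.1 (z.1 + h)}.indicator (fun z => F z.2) (x, t) := by
        congr 1; ext x
        rw [← lintegral_indicator measurableSet_Ioc]
        rfl
    _ = ∫⁻ t, ∫⁻ x, {z : ℝ × ℝ | z.2 ∈ Ioc z.1 (z.1 + h)}.indicator (fun z => F z.2) (x, t) :=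
        lintegral_lintegral_swap ((hF.comp measurable_snd).indicator hS).aemeasurable
    _ = ∫⁻ t, ENNReal.ofReal h * F t := by
        congr 1; ext t
        have : (fun x => {z : ℝ × ℝ | z.2 ∈ Ioc z.1 (z.1 + h)}.indicator (fun z => F z.2) (x, t)) =
            (Ico (t - h) t).indicator fun _ => F t := by
          ext x
          have : x < t ∧ t ≤ x + h ↔ t - h ≤ x ∧ x < t := by
            constructor <;> rintro ⟨h1, h2⟩ <;> constructor <;> linarith
          simp only [indicator, mem_ofPred_eq, mem_Ioc, mem_Ico, this]
        rw [this, lintegral_indicator measurableSet_Ico, setLIntegral_const, Real.volume_Ico,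
          sub_sub_cancel, mul_comm]
    _ = _ := lintegral_const_mul _ hF

lemma lintegral_slope_le {p : ℝ} (hp : 1 < p) {V W : ℝ → ℝ} {B : ℝ} (hW : Integrable W)
    (hWp : Integrable (fun x => |W x| ^ p)) (hB : ∫ x, |W x| ^ p ≤ B)
    (hV : ∀ x y, V y - V x = ∫ t in x..y, W t) {h : ℝ} (hh : 0 < h) :
    ∫⁻ x, ENNReal.ofReal (|(V (x + h) - V x) / h| ^ p) ≤ ENNReal.ofReal B := by
  set F : ℝ → ℝ≥0∞ := (hWp.aemeasurable.ennreal_ofReal).mk _ with hFdef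
  have hF : Measurable F := AEMeasurable.measurable_mk _
  have hFeq : (fun x => ENNReal.ofReal (|W x| ^ p)) =ᵐ[volume] F := AEMeasurable.ae_eq_mk _
  have hpt : ∀ x, ENNReal.ofReal (|(V (x + h) - V x) / h| ^ p) ≤
      ENNReal.ofReal h⁻¹ * ∫⁻ t in Ioc x (x + h), F t := fun x => by
    have hvol : volume.real (Ioc x (x + h)) = h := by simp [measureReal_def, hh.le]
    have h1 := setIntegral_abs_rpow_le hp (s := Ioc x (x + h)) (by simp) hW.integrableOn
      hWp.integrableOn
    rw [hvol] at h1
    have h2 : |V (x + h) - V x| ≤ ∫ t in Ioc x (x + h), |W t| := by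
      rw [hV, intervalIntegral.integral_of_le (by linarith)]
      exact abs_integral_le_integral_abs
    have h3 : |(V (x + h) - V x) / h| ^ p ≤ h⁻¹ * ∫ t in Ioc x (x + h), |W t| ^ p := by
      rw [abs_div, abs_of_pos hh, Real.div_rpow (abs_nonneg _) hh.le,
        div_le_iff₀ (Real.rpow_pos_of_pos hh p)]
      refine ((Real.rpow_le_rpow (abs_nonneg _) h2 (by linarith)).trans h1).trans_eq ?_
      rw [Real.rpow_sub_one hh.ne']; field_simp
    refine (ENNReal.ofReal_le_ofReal h3).trans_eq ?_
    rw [ENNReal.ofReal_mul (by positivity), ofReal_integral_eq_lintegral_ofReal hWp.integrableOn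
      (Eventually.of_forall fun x => by positivity)]
    congr 1
    exact lintegral_congr_ae (ae_restrict_of_ae hFeq)
  refine (lintegral_mono hpt).trans ?_
  rw [lintegral_const_mul' _ _ (by simp), lintegral_lintegral_Ioc F hF, ← mul_assoc,
    ← ENNReal.ofReal_mul (by positivity), inv_mul_cancel₀ hh.ne', ENNReal.ofReal_one, one_mul,
    ← lintegral_congr_ae hFeq, ← ofReal_integral_eq_lintegral_ofReal hWp
      (Eventually.of_forall fun x => by positivity)]
  exact ENNReal.ofReal_le_ofReal hB

/-- Lower semicontinuity of the `p`-energy under pointwise convergence. -/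
lemma lintegral_deriv_le_of_tendsto {p : ℝ} (hp : 1 < p) {V W : ℕ → ℝ → ℝ} {g : ℝ → ℝ} {B : ℝ}
    (hW : ∀ k, Integrable (W k)) (hWp : ∀ k, Integrable (fun x => |W k x| ^ p))
    (hB : ∀ k, ∫ x, |W k x| ^ p ≤ B) (hV : ∀ k x y, V k y - V k x = ∫ t in x..y, W k t)
    (hg : ∀ x, Tendsto (fun k => V k x) atTop (𝓝 (g x))) (a b : ℝ) :
    ∫⁻ x in Ioo a b, ENNReal.ofReal (|deriv g x| ^ p) ≤ ENNReal.ofReal B := by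
  have hp0 : 0 ≤ p := by linarith
  have hVc : ∀ k, Continuous (V k) := fun k => by
    have : V k = fun z => V k 0 + ∫ s in (0:ℝ)..z, W k s := by
      ext z; rw [← hV k 0 z]; ring
    rw [this]
    exact continuous_const.add (intervalIntegral.continuous_primitive
      (fun _ _ => (hW k).intervalIntegrable) 0)
  have hgm : Measurable g := measurable_of_tendsto_metrizable (fun k => (hVc k).measurable)
    (tendsto_pi_nhds.2 hg)
  have hslope : ∀ h : ℝ, 0 < h →
      ∫⁻ x, ENNReal.ofReal (|(g (x + h) - g x) / h| ^ p) ≤ ENNReal.ofReal B := fun h hh => by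
    refine (lintegral_congr fun x => ?_).trans_le ((lintegral_liminf_le (u := atTop)
      (f := fun k x => ENNReal.ofReal (|(V k (x + h) - V k x) / h| ^ p)) fun k => ?_).trans ?_)
    · refine (Tendsto.liminf_eq ?_).symm
      exact ENNReal.tendsto_ofReal (((((hg (x + h)).sub (hg x)).div_const h).abs).rpow_const
        (Or.inr hp0))
    · have := (hVc k).measurable
      fun_prop
    · refine (liminf_le_liminf (Eventually.of_forall fun k =>
        lintegral_slope_le hp (hW k) (hWp k) (hB k) (hV k) hh)).trans_eq (by simp)
  have hac := absolutelyContinuousOnInterval_of_tendsto hp hW hWp hB hV hg a b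
  have hlim : ∀ᵐ x ∂(volume.restrict (Ioo a b)), ENNReal.ofReal (|deriv g x| ^ p) =
      liminf (fun n : ℕ => ENNReal.ofReal
        (|(g (x + 1 / ((n : ℝ) + 1)) - g x) / (1 / ((n : ℝ) + 1))| ^ p)) atTop := by
    rw [ae_restrict_iff' measurableSet_Ioo]
    filter_upwards [hac.ae_differentiableAt] with x hx hxm
    have hd := (hx (Ioo_subset_Icc_self.trans Icc_subset_uIcc hxm)).hasDerivAt
    rw [hasDerivAt_iff_tendsto_slope_zero] at hd
    refine (Tendsto.liminf_eq ?_).symm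
    have h0 : Tendsto (fun n : ℕ => 1 / ((n : ℝ) + 1)) atTop (𝓝[≠] 0) :=
      tendsto_nhdsWithin_iff.2 ⟨tendsto_one_div_add_atTop_nhds_zero_nat,
        Eventually.of_forall fun n => by simp; positivity⟩
    have := hd.comp h0
    refine ENNReal.tendsto_ofReal (Tendsto.rpow_const (Tendsto.abs ?_) (Or.inr hp0))
    refine this.congr fun n => ?_
    simp [div_eq_inv_mul]
  rw [lintegral_congr_ae hlim]
  refine (lintegral_liminf_le fun n => ?_).trans ?_
  · fun_prop
  · refine (liminf_le_liminf (Eventually.of_forall fun n =>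
      (setLIntegral_le_lintegral _ _).trans (hslope _ (by positivity)))).trans_eq (by simp)

/-- A left inverse of `Ψ_p`, equal to zero off the range of `Ψ_p`. -/
def invPsip (ψ : ℝ → ℝ) (p y : ℝ) : ℝ :=
  open Classical in if h : ∃ t, Psip ψ p t = y then h.choose else 0

namespace PsiHypP

variable {ψ : ℝ → ℝ} {p : ℝ}

lemma exists_Psip_eq_iff (hψ : PsiHypP ψ p) {y : ℝ} :
    (∃ t, Psip ψ p t = y) ↔ y ∈ Ioo 0 (∫ t, ψ t ^ (1 / p)) :=
  ⟨by rintro ⟨t, rfl⟩; exact ⟨hψ.Psip_pos t, hψ.Psip_lt t⟩, fun h => hψ.exists_Psip_eq h.1 h.2⟩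

lemma Psip_invPsip (hψ : PsiHypP ψ p) {y : ℝ} (hy : y ∈ Ioo 0 (∫ t, ψ t ^ (1 / p))) :
    Psip ψ p (invPsip ψ p y) = y := by
  have h := hψ.exists_Psip_eq_iff.2 hy
  rw [invPsip, dif_pos h]
  exact h.choose_spec

lemma invPsip_Psip (hψ : PsiHypP ψ p) (t : ℝ) : invPsip ψ p (Psip ψ p t) = t :=
  hψ.Psip_strictMono.injective (hψ.Psip_invPsip ⟨hψ.Psip_pos t, hψ.Psip_lt t⟩)

lemma invPsip_of_notMem (hψ : PsiHypP ψ p) {y : ℝ} (hy : y ∉ Ioo 0 (∫ t, ψ t ^ (1 / p))) :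
    invPsip ψ p y = 0 :=
  dif_neg fun h => hy (hψ.exists_Psip_eq_iff.1 h)

lemma lt_invPsip_iff (hψ : PsiHypP ψ p) {y c : ℝ} (hy : y ∈ Ioo 0 (∫ t, ψ t ^ (1 / p))) :
    c < invPsip ψ p y ↔ Psip ψ p c < y := by
  rw [← hψ.Psip_strictMono.lt_iff_lt, hψ.Psip_invPsip hy]

lemma invPsip_lt_iff (hψ : PsiHypP ψ p) {y c : ℝ} (hy : y ∈ Ioo 0 (∫ t, ψ t ^ (1 / p))) :
    invPsip ψ p y < c ↔ y < Psip ψ p c := by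
  rw [← hψ.Psip_strictMono.lt_iff_lt, hψ.Psip_invPsip hy]

lemma measurable_invPsip (hψ : PsiHypP ψ p) : Measurable (invPsip ψ p) := by
  refine measurable_of_Ioi fun c => ?_
  have : invPsip ψ p ⁻¹' Ioi c = (Ioo 0 (∫ t, ψ t ^ (1 / p)) ∩ Ioi (Psip ψ p c)) ∪
      ((Ioo 0 (∫ t, ψ t ^ (1 / p)))ᶜ ∩ {_y | c < 0}) := by
    ext y
    by_cases hy : y ∈ Ioo 0 (∫ t, ψ t ^ (1 / p))
    · have := hψ.lt_invPsip_iff (c := c) hy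
      simp only [mem_preimage, mem_Ioi, this, mem_union, mem_inter_iff, hy, mem_compl_iff]
      simp
    · have := hψ.invPsip_of_notMem hy
      simp only [mem_preimage, mem_Ioi, this, mem_union, mem_inter_iff, hy, mem_compl_iff]
      simp
  rw [this]
  exact (measurableSet_Ioo.inter measurableSet_Ioi).union
    (measurableSet_Ioo.compl.inter (MeasurableSet.const _))

end PsiHypP

/-- Pointwise convergence of functions with bounded `p`-energy is uniform on compact sets. -/
lemma eventually_forall_Icc_abs_sub_lt {p : ℝ} (hp : 1 < p) {ι : Type*} {l : Filter ι}
    [l.NeBot] {V W : ι → ℝ → ℝ} {g : ℝ → ℝ} {B : ℝ} (hW : ∀ k, Integrable (W k))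
    (hWp : ∀ k, Integrable (fun x => |W k x| ^ p)) (hB : ∀ k, ∫ x, |W k x| ^ p ≤ B)
    (hV : ∀ k x y, V k y - V k x = ∫ t in x..y, W k t)
    (hg : ∀ x, Tendsto (fun k => V k x) l (𝓝 (g x))) (a b : ℝ) {ε : ℝ} (hε : 0 < ε) :
    ∀ᶠ k in l, ∀ x ∈ Icc a b, |V k x - g x| < ε := by
  have hpos : 0 < (p - 1) / p := div_pos (by linarith) (by linarith)
  have h0 : Tendsto (fun x : ℝ => |x| ^ ((p - 1) / p) * B ^ (1 / p)) (𝓝 0) (𝓝 0) := by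
    have := (((Real.continuous_rpow_const hpos.le).comp continuous_abs).mul_const
      (B ^ (1 / p))).tendsto 0
    simpa [Real.zero_rpow hpos.ne'] using this
  obtain ⟨δ, hδ, hδε⟩ := Metric.eventually_nhds_iff.1
    (h0.eventually (eventually_lt_nhds (by positivity : (0:ℝ) < ε / 3)))
  have hVm : ∀ k x y, dist y x < δ → |V k y - V k x| < ε / 3 := fun k x y hxy =>
    (abs_sub_le_of_primitive hp (hW k) (hWp k) (hB k) (hV k) x y).trans_lt
      (hδε (by rwa [Real.dist_eq, sub_zero, ← Real.dist_eq]))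
  have hgm : ∀ x y, dist y x < δ → |g y - g x| ≤ ε / 3 := fun x y hxy =>
    le_of_tendsto ((hg y).sub (hg x)).abs (Eventually.of_forall fun k => (hVm k x y hxy).le)
  obtain ⟨t, -, htf, hts⟩ := (isCompact_Icc (a := a) (b := b)).finite_cover_balls hδ
  have hev : ∀ᶠ k in l, ∀ y ∈ t, |V k y - g y| < ε / 3 :=
    htf.eventually_all.2 fun y _ => by
      have := ((hg y).sub_const (g y)).abs
      rw [sub_self, abs_zero] at this
      exact this.eventually (eventually_lt_nhds (by positivity))
  filter_upwards [hev] with k hk x hx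
  obtain ⟨y, hy, hxy⟩ := mem_iUnion₂.1 (hts hx)
  have h1 := abs_lt.1 (hVm k y x hxy)
  have h2 := abs_le.1 (hgm y x hxy)
  have h3 := abs_lt.1 (hk y hy)
  exact abs_lt.2 ⟨by linarith, by linarith⟩

/-- Bounded sequences of measures supported in a compact set converge weakly along
ultrafilters. -/
lemma exists_tendsto_integral_of_measure_le {ι : Type*} (l : Ultrafilter ι) {K : Set ℝ}
    (hK : IsCompact K) {α : ι → Measure ℝ} {C : ℝ≥0} (hC : ∀ k, α k univ ≤ C)
    (hα : ∀ k, α k Kᶜ = 0) :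
    ∃ μ : Measure ℝ, IsFiniteMeasure μ ∧ μ Kᶜ = 0 ∧ ∀ φ : ℝ → ℝ, Continuous φ →
      (∃ M, ∀ x, |φ x| ≤ M) → Tendsto (fun k => ∫ x, φ x ∂(α k)) l (𝓝 (∫ x, φ x ∂μ)) := by
  have hfin : ∀ k, IsFiniteMeasure (α k) := fun k => ⟨(hC k).trans_lt ENNReal.coe_lt_top⟩
  let A : ι → FiniteMeasure ℝ := fun k => ⟨α k, hfin k⟩
  obtain ⟨μ, hμ, hlim⟩ := (isCompact_iff_ultrafilter_le_nhds'.1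
    (isCompact_setOfPred_finiteMeasure_le_of_isCompact C hK)) (l.map A) (by
      refine Filter.mem_map.2 (Eventually.of_forall fun k => ⟨?_, ?_⟩)
      · have : ((A k).mass : ℝ≥0∞) ≤ C := by rw [FiniteMeasure.ennreal_mass]; exact hC k
        exact_mod_cast this
      · rw [FiniteMeasure.null_iff_toMeasure_null]; exact hα k)
  refine ⟨μ, inferInstance, ?_, fun φ hφ ⟨M, hM⟩ => ?_⟩
  · rw [← FiniteMeasure.null_iff_toMeasure_null]; exact hμ.2
  · have hT : Tendsto A l (𝓝 μ) := hlim
    exact (FiniteMeasure.tendsto_iff_forall_integral_tendsto.1 hT)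
      (BoundedContinuousFunction.ofNormedAddCommGroup φ hφ M hM)

section Identification

variable {ψ : ℝ → ℝ} {p a b : ℝ} {ι : Type*} {l : Filter ι} {v V : ι → ℝ → ℝ} {g : ℝ → ℝ}

/-- The weak limit of `h ∘ v k` has density `h (Ψ_p⁻¹ ∘ g)` where the uniform limit `g` of
`Ψ_p ∘ v k` takes values in a compact subset of the range of `Ψ_p`. -/
lemma restrict_eq_withDensity_restrict_of_tendsto [l.NeBot] (hψ : PsiHypP ψ p) (hp : 1 < p)
    (hgc : Continuous g) (hvm : ∀ k, IntegrableOn (v k) (Ioo a b))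
    (hVv : ∀ k, ∀ x ∈ Ioo a b, V k x = Psip ψ p (v k x))
    (hU : ∀ ε > 0, ∀ᶠ k in l, ∀ x ∈ Ioo a b, |V k x - g x| < ε)
    {h : ℝ → ℝ} (hh : LipschitzWith 1 h) (h0 : h 0 = 0) (hh0 : ∀ t, 0 ≤ h t)
    {α : Measure ℝ} [IsFiniteMeasure α]
    (hα : ∀ φ : ℝ → ℝ, ContDiff ℝ 1 φ → tsupport φ ⊆ Ioo a b →
      Tendsto (fun k => ∫ x in Ioo a b, φ x * h (v k x)) l (𝓝 (∫ x, φ x ∂α)))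
    {T : ℝ} {O : Set ℝ} (hO : O = {x ∈ Ioo a b | g x ∈ Ioo (Psip ψ p (-T)) (Psip ψ p T)}) :
    α.restrict O = (volume.withDensity
      fun x => ENNReal.ofReal (h (invPsip ψ p (g x)))).restrict O := by
  have hhabs : ∀ s t, |h s - h t| ≤ |s - t| := fun s t => by
    simpa [Real.dist_eq] using hh.dist_le_mul s t
  have hOo : IsOpen O := by rw [hO]; exact isOpen_Ioo.inter (isOpen_Ioo.preimage hgc)
  have hOsub : O ⊆ Ioo a b := by rw [hO]; exact fun x hx => hx.1
  have hOr : ∀ x ∈ O, g x ∈ Ioo 0 (∫ t, ψ t ^ (1 / p)) := by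
    rw [hO]; exact fun x hx => ⟨(hψ.Psip_pos _).trans hx.2.1, hx.2.2.trans (hψ.Psip_lt _)⟩
  have hOv : ∀ x ∈ O, invPsip ψ p (g x) ∈ Ioo (-T) T := fun x hx => by
    have := hx
    rw [hO] at this
    exact ⟨(hψ.lt_invPsip_iff (hOr x hx)).2 this.2.1, (hψ.invPsip_lt_iff (hOr x hx)).2 this.2.2⟩
  set f : ℝ → ℝ := fun x => invPsip ψ p (g x) with hf
  have hfm : Measurable f := hψ.measurable_invPsip.comp hgc.measurable
  have hfb : ∀ x ∈ O, h (f x) ≤ |T| := fun x hx => by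
    have h1 := hhabs (f x) 0
    rw [h0, sub_zero, sub_zero, abs_of_nonneg (hh0 _)] at h1
    exact h1.trans ((abs_lt.2 (hOv x hx)).le.trans (le_abs_self T))
  have hOvol : volume O < ⊤ := (measure_mono hOsub).trans_lt (by simp)
  let ν := (volume.withDensity fun x => ENNReal.ofReal (h (f x))).restrict O
  have hdm : Measurable fun x => ENNReal.ofReal (h (f x)) :=
    (hh.continuous.measurable.comp hfm).ennreal_ofReal
  have hνfin : IsFiniteMeasure ν := ⟨by
    rw [Measure.restrict_apply_univ, withDensity_apply _ hOo.measurableSet]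
    refine (setLIntegral_mono (g := fun _ => ENNReal.ofReal |T|) measurable_const fun x hx =>
      ENNReal.ofReal_le_ofReal (hfb x hx)).trans_lt ?_
    rw [setLIntegral_const]
    exact ENNReal.mul_lt_top ENNReal.ofReal_lt_top hOvol⟩
  obtain ⟨δ, hδ, hexp⟩ := hψ.exists_mul_abs_sub_le hp (T + 1)
  have hclose : ∀ ε > 0, ∀ᶠ k in l, ∀ x ∈ O, |h (v k x) - h (f x)| ≤ ε := by
    intro ε hε
    have e1 : 0 < Psip ψ p (T + 1) - Psip ψ p T := sub_pos.2 (hψ.Psip_strictMono (by linarith))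
    have e2 : 0 < Psip ψ p (-T) - Psip ψ p (-(T + 1)) :=
      sub_pos.2 (hψ.Psip_strictMono (by linarith))
    filter_upwards [hU (min (min (Psip ψ p (T + 1) - Psip ψ p T)
      (Psip ψ p (-T) - Psip ψ p (-(T + 1)))) (δ * ε)) (by positivity)] with k hk x hx
    have h1 := hk x (hOsub hx)
    obtain ⟨h1, h2⟩ := lt_min_iff.1 h1
    obtain ⟨h3, h4⟩ := lt_min_iff.1 h1
    rw [hVv k x (hOsub hx)] at h2 h3 h4
    have hx' := hx
    rw [hO] at hx'
    have h5 : v k x < T + 1 := hψ.Psip_strictMono.lt_iff_lt.1 (by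
      linarith [(abs_lt.1 h3).2, hx'.2.2])
    have h6 : -(T + 1) < v k x := hψ.Psip_strictMono.lt_iff_lt.1 (by
      linarith [(abs_lt.1 h4).1, hx'.2.1])
    have h7 := hexp (v k x) ⟨h6.le, h5.le⟩ (f x)
      ⟨by linarith [(hOv x hx).1], by linarith [(hOv x hx).2]⟩
    rw [hψ.Psip_invPsip (hOr x hx)] at h7
    have h8 : |v k x - f x| < ε := lt_of_mul_lt_mul_left (h7.trans_lt h2) hδ.le
    exact (hhabs _ _).trans h8.le
  have hsub : ∀ A, MeasurableSet A → A ⊆ O → α A = ν A := fun A hA hAO => by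
    refine measure_eq_of_forall_integral_eq hOo (fun φ hφ hφc hφs _ => ?_) hA hAO
    have hφi : Integrable φ := hφ.continuous.integrable_of_hasCompactSupport hφc
    obtain ⟨M, hM⟩ := hφc.exists_bound_of_continuous hφ.continuous
    have hz : ∀ x, x ∉ O → φ x = 0 := fun x hx =>
      image_eq_zero_of_notMem_tsupport fun hx' => hx (hφs hx')
    have hlim : Tendsto (fun k => ∫ x in Ioo a b, φ x * h (v k x)) l
        (𝓝 (∫ x in O, φ x * h (f x))) := by
      have hrestr : ∀ k, ∫ x in Ioo a b, φ x * h (v k x) = ∫ x in O, φ x * h (v k x) := fun k =>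
        (setIntegral_eq_of_subset_of_forall_sdiff_eq_zero measurableSet_Ioo hOsub
          fun x hx => by rw [hz x hx.2, zero_mul])
      simp only [hrestr]
      rw [Metric.tendsto_nhds]
      intro ε hε
      have hI : 0 ≤ ∫ x, |φ x| := integral_nonneg fun _ => abs_nonneg _
      filter_upwards [hclose (ε / (2 * ((∫ x, |φ x|) + 1))) (by positivity)] with k hk
      have i1 : IntegrableOn (fun x => φ x * h (v k x)) O := by
        have hhv : IntegrableOn (fun x => h (v k x)) O := by
          refine Integrable.mono ((hvm k).mono_set hOsub)
            (hh.continuous.comp_aestronglyMeasurable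
              ((hvm k).mono_set hOsub).aestronglyMeasurable) (Eventually.of_forall fun x => ?_)
          have := hhabs (v k x) 0
          rwa [h0, sub_zero, sub_zero] at this
        exact Integrable.bdd_mul (c := M) hhv hφ.continuous.aestronglyMeasurable
          (Eventually.of_forall hM)
      have i2 : IntegrableOn (fun x => φ x * h (f x)) O := by
        refine Integrable.mul_bdd (c := |T|) hφi.integrableOn
          (hh.continuous.measurable.comp hfm).aestronglyMeasurable ?_
        rw [ae_restrict_iff' hOo.measurableSet]
        refine Eventually.of_forall fun x hx => ?_
        change |h (f x)| ≤ |T|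
        rw [abs_of_nonneg (hh0 _)]; exact hfb x hx
      rw [Real.dist_eq, ← integral_sub i1 i2]
      calc |∫ x in O, (φ x * h (v k x) - φ x * h (f x))|
          ≤ ∫ x in O, |φ x * h (v k x) - φ x * h (f x)| := abs_integral_le_integral_abs
        _ ≤ ∫ x in O, |φ x| * (ε / (2 * ((∫ x, |φ x|) + 1))) := by
            refine setIntegral_mono_on (i1.sub i2).abs (hφi.abs.integrableOn.mul_const _)
              hOo.measurableSet fun x hx => ?_
            rw [← mul_sub, abs_mul]
            exact mul_le_mul_of_nonneg_left (hk x hx) (abs_nonneg _)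
        _ ≤ (∫ x, |φ x|) * (ε / (2 * ((∫ x, |φ x|) + 1))) := by
            rw [integral_mul_const]
            refine mul_le_mul_of_nonneg_right (setIntegral_le_integral hφi.abs
              (Eventually.of_forall fun x => abs_nonneg _)) (by positivity)
        _ < ε := by
            rw [mul_div_assoc', div_lt_iff₀ (by positivity)]
            nlinarith
    rw [tendsto_nhds_unique (hα φ hφ (hφs.trans hOsub)) hlim]
    change _ = ∫ x, φ x ∂((volume.withDensity fun x => ENNReal.ofReal (h (f x))).restrict O)
    rw [restrict_withDensity hOo.measurableSet,
      integral_withDensity_eq_integral_toReal_smul hdm (by simp)]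
    congr 1; ext x
    rw [ENNReal.toReal_ofReal (hh0 _), smul_eq_mul, mul_comm]
  ext A hA
  rw [Measure.restrict_apply hA, hsub _ (hA.inter hOo.measurableSet) inter_subset_right,
    Measure.restrict_apply (hA.inter hOo.measurableSet), inter_assoc, inter_self,
    Measure.restrict_apply hA]

lemma restrict_eq_withDensity_restrict_of_tendsto' [l.NeBot] (hψ : PsiHypP ψ p) (hp : 1 < p)
    (hgc : Continuous g) (hvm : ∀ k, IntegrableOn (v k) (Ioo a b))
    (hVv : ∀ k, ∀ x ∈ Ioo a b, V k x = Psip ψ p (v k x))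
    (hU : ∀ ε > 0, ∀ᶠ k in l, ∀ x ∈ Ioo a b, |V k x - g x| < ε)
    {h : ℝ → ℝ} (hh : LipschitzWith 1 h) (h0 : h 0 = 0) (hh0 : ∀ t, 0 ≤ h t)
    {α : Measure ℝ} [IsFiniteMeasure α]
    (hα : ∀ φ : ℝ → ℝ, ContDiff ℝ 1 φ → tsupport φ ⊆ Ioo a b →
      Tendsto (fun k => ∫ x in Ioo a b, φ x * h (v k x)) l (𝓝 (∫ x, φ x ∂α))) :
    α.restrict {x ∈ Ioo a b | g x ∈ Ioo 0 (∫ t, ψ t ^ (1 / p))} = (volume.withDensity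
      fun x => ENNReal.ofReal (h (invPsip ψ p (g x)))).restrict
        {x ∈ Ioo a b | g x ∈ Ioo 0 (∫ t, ψ t ^ (1 / p))} := by
  have hU' : {x ∈ Ioo a b | g x ∈ Ioo 0 (∫ t, ψ t ^ (1 / p))} = ⋃ n : ℕ,
      {x ∈ Ioo a b | g x ∈ Ioo (Psip ψ p (-(n : ℝ))) (Psip ψ p n)} := by
    ext x
    simp only [mem_iUnion, mem_ofPred_eq]
    constructor
    · rintro ⟨hx, hgx⟩
      obtain ⟨n, hn⟩ := exists_nat_gt |invPsip ψ p (g x)|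
      obtain ⟨h1, h2⟩ := abs_lt.1 hn
      exact ⟨n, hx, (hψ.lt_invPsip_iff hgx).1 h1, (hψ.invPsip_lt_iff hgx).1 h2⟩
    · rintro ⟨n, hx, h1, h2⟩
      exact ⟨hx, (hψ.Psip_pos _).trans h1, h2.trans (hψ.Psip_lt _)⟩
  rw [hU', Measure.restrict_iUnion_congr]
  exact fun n => restrict_eq_withDensity_restrict_of_tendsto hψ hp hgc hvm hVv hU hh h0 hh0 hα rfl

lemma measure_eq_zero_of_tendsto [l.NeBot] {h : ℝ → ℝ} {α : Measure ℝ} [IsFiniteMeasure α]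
    (hα : ∀ φ : ℝ → ℝ, ContDiff ℝ 1 φ → tsupport φ ⊆ Ioo a b →
      Tendsto (fun k => ∫ x in Ioo a b, φ x * h (v k x)) l (𝓝 (∫ x, φ x ∂α)))
    {O : ℕ → Set ℝ} (hO : ∀ n, IsOpen (O n)) (hOs : ∀ n, O n ⊆ Ioo a b)
    (hz : ∀ n, ∀ᶠ k in l, ∀ x ∈ O n, h (v k x) = 0) : α (⋃ n, O n) = 0 := by
  refine measure_iUnion_null fun n => ?_
  rw [measure_eq_of_forall_integral_eq (ν := 0) (hO n) (fun φ hφ hφc hφs _ => ?_)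
    (hO n).measurableSet subset_rfl, Measure.coe_zero, Pi.zero_apply]
  rw [integral_zero_measure]
  refine tendsto_nhds_unique (hα φ hφ (hφs.trans (hOs n)))
    (tendsto_const_nhds.congr' ?_)
  filter_upwards [hz n] with k hk
  refine (integral_eq_zero_of_ae (Eventually.of_forall fun x => ?_)).symm
  by_cases hx : x ∈ O n
  · simp [hk x hx]
  · have : φ x = 0 := image_eq_zero_of_notMem_tsupport fun hx' => hx (hφs hx')
    simp [this]

end Identification

lemma mem_ZPlus_of_forall_le {a b : ℝ} {D : ℝ → ℝ} (hD : Integrable D) {x : ℝ}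
    (hx : x ∈ Ioo a b)
    (h : ∀ T, ∃ ε > 0, ∀ᵐ y, y ∈ Ioo (x - ε) (x + ε) → T ≤ D y) : x ∈ ZPlus a b D := by
  refine ⟨hx, tendsto_atTop.2 fun T => ?_⟩
  obtain ⟨ε, hε, hT⟩ := h T
  filter_upwards [Ioo_mem_nhdsGT hε] with η hη
  rw [le_div_iff₀ (by linarith [hη.1])]
  have h1 : ∫ t in Ioo (x - η) (x + η), T ≤ ∫ t in Ioo (x - η) (x + η), D t := by
    refine setIntegral_mono_on_ae (by simp) hD.integrableOn measurableSet_Ioo ?_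
    filter_upwards [hT] with y hy hy'
    exact hy ⟨by linarith [hy'.1, hη.2], by linarith [hy'.2, hη.2]⟩
  rw [setIntegral_const, measureReal_def, Real.volume_Ioo, smul_eq_mul,
    ENNReal.toReal_ofReal (by linarith [hη.1])] at h1
  linarith

lemma mem_ZMinus_of_forall_le {a b : ℝ} {D : ℝ → ℝ} (hD : Integrable D) {x : ℝ}
    (hx : x ∈ Ioo a b)
    (h : ∀ T, ∃ ε > 0, ∀ᵐ y, y ∈ Ioo (x - ε) (x + ε) → D y ≤ T) : x ∈ ZMinus a b D := by
  have h1 : x ∈ ZPlus a b fun y => -D y := mem_ZPlus_of_forall_le (D := fun y => -D y) hD.neg hx fun T => by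
    obtain ⟨ε, hε, hT⟩ := h (-T)
    exact ⟨ε, hε, hT.mono fun y hy hy' => le_neg.1 (hy hy')⟩
  refine ⟨hx, ?_⟩
  have := tendsto_neg_atTop_atBot.comp h1.2
  refine this.congr fun ε => ?_
  simp only [Function.comp_apply]
  rw [integral_neg, neg_div, neg_neg]

lemma restrict_eq_withDensity_add {α : Measure ℝ} {I O S S₀ : Set ℝ} {D : ℝ → ℝ≥0∞}
    (hO : MeasurableSet O) (hS : MeasurableSet S) (hI : I = O ∪ (S ∪ S₀)) (hOS : Disjoint O S)
    (hS₀ : α S₀ = 0) (h : α.restrict O = (volume.withDensity D).restrict O) :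
    α.restrict I = volume.withDensity (O.indicator D) + α.restrict S := by
  have h1 : α.restrict I = α.restrict (O ∪ S) := by
    rw [hI, ← union_assoc]
    refine Measure.restrict_congr_set ?_
    exact union_ae_eq_left_of_ae_eq_empty (ae_eq_empty.2 hS₀)
  rw [h1, Measure.restrict_union hOS hS, h, restrict_withDensity hO, withDensity_indicator hO]

lemma integrable_uaD (μp μn : Measure ℝ) [IsFiniteMeasure μp] [IsFiniteMeasure μn] :
    Integrable (uaD μp μn) :=
  Measure.integrable_toReal_rnDeriv.sub Measure.integrable_toReal_rnDeriv

/-- Membership in `X^p_ψ` in terms of a continuous function `g` representing `Ψ_p ∘ (u')^a`. -/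
lemma memXp_of_withDensity {ψ : ℝ → ℝ} {p a b : ℝ} (hψ : PsiHypP ψ p) {u g w : ℝ → ℝ}
    (hu : IntegrableOn u (Ioo a b)) (hgc : Continuous g)
    (hgr : ∀ x ∈ Ioo a b, g x ∈ Icc 0 (∫ t, ψ t ^ (1 / p)))
    {α β : Measure ℝ} [IsFiniteMeasure α] [IsFiniteMeasure β]
    (hα : α.restrict {x ∈ Ioo a b | g x ∈ Ioo 0 (∫ t, ψ t ^ (1 / p))} = (volume.withDensity
      fun x => ENNReal.ofReal (max (invPsip ψ p (g x)) 0)).restrict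
        {x ∈ Ioo a b | g x ∈ Ioo 0 (∫ t, ψ t ^ (1 / p))})
    (hβ : β.restrict {x ∈ Ioo a b | g x ∈ Ioo 0 (∫ t, ψ t ^ (1 / p))} = (volume.withDensity
      fun x => ENNReal.ofReal (max (-invPsip ψ p (g x)) 0)).restrict
        {x ∈ Ioo a b | g x ∈ Ioo 0 (∫ t, ψ t ^ (1 / p))})
    (hα0 : α {x ∈ Ioo a b | g x < Psip ψ p 0} = 0) (hβ0 : β {x ∈ Ioo a b | Psip ψ p 0 < g x} = 0)
    (hS : volume {x ∈ Ioo a b | g x = ∫ t, ψ t ^ (1 / p)} = 0)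
    (hS₀ : volume {x ∈ Ioo a b | g x = 0} = 0)
    (hder : ∀ φ : ℝ → ℝ, ContDiff ℝ 1 φ → tsupport φ ⊆ Ioo a b →
      ∫ x in Ioo a b, u x * deriv φ x = (∫ x, φ x ∂β) - ∫ x, φ x ∂α)
    (hw : IntegrableOn w (Ioo a b)) (hwp : IntegrableOn (fun x => |w x| ^ p) (Ioo a b))
    (hgw : ∀ x ∈ Ioo a b, ∀ y ∈ Ioo a b, g y - g x = ∫ t in x..y, w t) :
    MemXp ψ p a b u (α.restrict (Ioo a b)) (β.restrict (Ioo a b)) ∧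
      ∀ᵐ x ∂(volume.restrict (Ioo a b)),
        g x = Psip ψ p (uaD (α.restrict (Ioo a b)) (β.restrict (Ioo a b)) x) := by
  set M := ∫ t, ψ t ^ (1 / p) with hM
  set O := {x ∈ Ioo a b | g x ∈ Ioo 0 M} with hO
  set S := {x ∈ Ioo a b | g x = M} with hSdef
  set S₀ := {x ∈ Ioo a b | g x = 0} with hS₀def
  set f : ℝ → ℝ := O.indicator fun x => invPsip ψ p (g x) with hf
  have h0r : Psip ψ p 0 ∈ Ioo 0 M := ⟨hψ.Psip_pos 0, hψ.Psip_lt 0⟩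
  have hOm : MeasurableSet O :=
    measurableSet_Ioo.inter (measurableSet_Ioo.preimage hgc.measurable)
  have hSm : MeasurableSet S :=
    measurableSet_Ioo.inter ((measurableSet_singleton M).preimage hgc.measurable)
  have hS₀m : MeasurableSet S₀ :=
    measurableSet_Ioo.inter ((measurableSet_singleton 0).preimage hgc.measurable)
  have hI : Ioo a b = O ∪ (S ∪ S₀) := by
    ext x
    constructor
    · intro hx
      obtain ⟨h1, h2⟩ := hgr x hx
      rcases h1.eq_or_lt with h1 | h1
      · exact Or.inr (Or.inr ⟨hx, h1.symm⟩)
      · rcases h2.eq_or_lt with h2 | h2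
        · exact Or.inr (Or.inl ⟨hx, h2⟩)
        · exact Or.inl ⟨hx, h1, h2⟩
    · rintro (hx | hx | hx) <;> exact hx.1
  have hOS : Disjoint O S := Set.disjoint_left.2 fun x h1 h2 => (h1.2.2.ne h2.2)
  have hOS₀ : Disjoint O S₀ := Set.disjoint_left.2 fun x h1 h2 => (h1.2.1.ne' h2.2)
  have hαS₀ : α S₀ = 0 :=
    measure_mono_null (show S₀ ⊆ {x ∈ Ioo a b | g x < Psip ψ p 0} from
      fun x hx => ⟨hx.1, by rw [hx.2]; exact h0r.1⟩) hα0
  have hβS : β S = 0 :=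
    measure_mono_null (show S ⊆ {x ∈ Ioo a b | Psip ψ p 0 < g x} from
      fun x hx => ⟨hx.1, by rw [hx.2]; exact h0r.2⟩) hβ0
  have hfm : Measurable f := (hψ.measurable_invPsip.comp hgc.measurable).indicator hOm
  have hμp : α.restrict (Ioo a b) =
      α.restrict S + volume.withDensity fun x => ENNReal.ofReal (f x) := by
    rw [restrict_eq_withDensity_add hOm hSm hI hOS hαS₀ hα, add_comm]
    congr 2; ext x
    by_cases hx : x ∈ O
    · simp [hf, hx]
    · simp [hf, hx]
  have hμn : β.restrict (Ioo a b) =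
      β.restrict S₀ + volume.withDensity fun x => ENNReal.ofReal (-f x) := by
    rw [restrict_eq_withDensity_add hOm hS₀m (hI.trans (by rw [union_comm S])) hOS₀ hβS hβ,
      add_comm]
    congr 2; ext x
    by_cases hx : x ∈ O
    · simp [hf, hx]
    · simp [hf, hx]
  have hsing : ∀ {γ : Measure ℝ} {E : Set ℝ}, MeasurableSet E → volume E = 0 →
      γ.restrict E ⟂ₘ volume := fun {γ E} hE h0 =>
    ⟨Eᶜ, hE.compl, by rw [Measure.restrict_apply hE.compl]; simp, by rwa [compl_compl]⟩
  have hdp : (fun x => ENNReal.ofReal (f x)) =ᵐ[volume] (α.restrict (Ioo a b)).rnDeriv volume :=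
    Measure.eq_rnDeriv hfm.ennreal_ofReal (hsing hSm hS) hμp
  have hdn : (fun x => ENNReal.ofReal (-f x)) =ᵐ[volume] (β.restrict (Ioo a b)).rnDeriv volume :=
    Measure.eq_rnDeriv hfm.neg.ennreal_ofReal (hsing hS₀m hS₀) hμn
  have hsp : α.restrict S = (α.restrict (Ioo a b)).singularPart volume :=
    Measure.eq_singularPart hfm.ennreal_ofReal (hsing hSm hS) hμp
  have hsn : β.restrict S₀ = (β.restrict (Ioo a b)).singularPart volume :=
    Measure.eq_singularPart hfm.neg.ennreal_ofReal (hsing hS₀m hS₀) hμn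
  have hua : uaD (α.restrict (Ioo a b)) (β.restrict (Ioo a b)) =ᵐ[volume] f := by
    filter_upwards [hdp, hdn] with x h1 h2
    rw [uaD, ← h1, ← h2, ENNReal.toReal_ofReal', ENNReal.toReal_ofReal']
    exact max_zero_sub_max_neg_zero_eq_self (f x)
  have hSz : ∀ᵐ x, x ∉ S ∪ S₀ := measure_eq_zero_iff_ae_notMem.1 (measure_union_null hS hS₀)
  have hrep : ∀ᵐ x, x ∈ Ioo a b →
      g x = Psip ψ p (uaD (α.restrict (Ioo a b)) (β.restrict (Ioo a b)) x) := by
    filter_upwards [hua, hSz] with x h1 h2 hx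
    rw [hI] at hx
    have hxO : x ∈ O := hx.resolve_right h2
    rw [h1, hf, indicator_of_mem hxO, hψ.Psip_invPsip hxO.2]
  rw [← ae_restrict_iff' measurableSet_Ioo] at hrep
  have hint := integrable_uaD (α.restrict (Ioo a b)) (β.restrict (Ioo a b))
  have hloc : ∀ {x : ℝ} {P : Set ℝ}, IsOpen P → x ∈ Ioo a b → g x ∈ P →
      ∃ ε > 0, ∀ y ∈ Ioo (x - ε) (x + ε), y ∈ Ioo a b ∧ g y ∈ P := fun {x P} hP hx hgx => by
    obtain ⟨ε, hε, h⟩ := Metric.isOpen_iff.1 (isOpen_Ioo.inter (hP.preimage hgc)) x ⟨hx, hgx⟩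
    exact ⟨ε, hε, fun y hy => h (by rwa [Real.ball_eq_Ioo])⟩
  refine ⟨⟨⟨hu, inferInstance, inferInstance, ?_, ?_, ?_, ?_⟩, ⟨g, w, hrep, hw, hwp, hgw⟩, ?_, ?_⟩,
    hrep⟩
  · refine ⟨{x ∈ Ioo a b | Psip ψ p 0 < g x}ᶜ, ?_, ?_, ?_⟩
    · exact (measurableSet_Ioo.inter (measurableSet_Ioi.preimage hgc.measurable)).compl
    · rw [hμp, Measure.add_apply, add_eq_zero]
      have hm : MeasurableSet {x ∈ Ioo a b | Psip ψ p 0 < g x}ᶜ :=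
        (measurableSet_Ioo.inter (measurableSet_Ioi.preimage hgc.measurable)).compl
      constructor
      · rw [Measure.restrict_apply hm]
        convert! measure_empty (μ := α)
        rw [← disjoint_iff_inter_eq_empty, Set.disjoint_left]
        exact fun x h1 h2 => h1 ⟨h2.1, by rw [h2.2]; exact h0r.2⟩
      · rw [withDensity_apply _ hm]
        refine setLIntegral_eq_zero hm fun x hx => ?_
        simp only [Pi.zero_apply, ENNReal.ofReal_eq_zero]
        by_cases hxO : x ∈ O
        · rw [hf, indicator_of_mem hxO]
          by_contra! hc
          exact hx ⟨hxO.1, (hψ.lt_invPsip_iff hxO.2).1 hc⟩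
        · rw [hf, indicator_of_notMem hxO]
    · rw [compl_compl]
      exact le_antisymm ((Measure.restrict_apply_le _ _).trans hβ0.le) zero_le
  · rw [Measure.restrict_apply measurableSet_Ioo.compl]; simp
  · rw [Measure.restrict_apply measurableSet_Ioo.compl]; simp
  · intro φ hφ hφs
    have hz : ∀ x, x ∉ Ioo a b → φ x = 0 := fun x hx =>
      image_eq_zero_of_notMem_tsupport fun hx' => hx (hφs hx')
    rw [hder φ hφ hφs, setIntegral_eq_integral_of_forall_compl_eq_zero hz,
      setIntegral_eq_integral_of_forall_compl_eq_zero hz]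
  · rw [← hsp, Measure.restrict_apply' hSm]
    convert! measure_empty (μ := α)
    rw [← disjoint_iff_inter_eq_empty, Set.disjoint_left]
    refine fun x h1 h2 => h1 (mem_ZPlus_of_forall_le hint h2.1 fun T => ?_)
    obtain ⟨ε, hε, h⟩ := hloc (isOpen_Ioi (a := Psip ψ p T)) h2.1
      (by rw [h2.2]; exact hψ.Psip_lt T)
    refine ⟨ε, hε, ?_⟩
    filter_upwards [(ae_restrict_iff' measurableSet_Ioo).1 hrep] with y hy hyε
    have h3 := (h y hyε).2
    rw [hy (h y hyε).1] at h3
    exact (hψ.Psip_strictMono.lt_iff_lt.1 h3).le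
  · rw [← hsn, Measure.restrict_apply' hS₀m]
    convert! measure_empty (μ := β)
    rw [← disjoint_iff_inter_eq_empty, Set.disjoint_left]
    refine fun x h1 h2 => h1 (mem_ZMinus_of_forall_le hint h2.1 fun T => ?_)
    obtain ⟨ε, hε, h⟩ := hloc (isOpen_Iio (a := Psip ψ p T)) h2.1
      (by rw [h2.2]; exact hψ.Psip_pos T)
    refine ⟨ε, hε, ?_⟩
    filter_upwards [(ae_restrict_iff' measurableSet_Ioo).1 hrep] with y hy hyε
    have h3 := (h y hyε).2
    rw [hy (h y hyε).1] at h3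
    exact (hψ.Psip_strictMono.lt_iff_lt.1 h3).le

lemma continuous_of_primitive {V W : ℝ → ℝ} (hW : Integrable W)
    (hV : ∀ x y, V y - V x = ∫ t in x..y, W t) : Continuous V := by
  have : V = fun z => V 0 + ∫ s in (0 : ℝ)..z, W s := by
    ext z; rw [← hV 0 z]; ring
  rw [this]
  exact continuous_const.add (intervalIntegral.continuous_primitive
    (fun _ _ => hW.intervalIntegrable) _)

namespace W2pRep

variable {a b p : ℝ} {u v w : ℝ → ℝ}

lemma integrableOn_energy {ψ : ℝ → ℝ} (hψ : PsiHypP ψ p) (h : W2pRep p a b u v w) :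
    IntegrableOn (fun x => ψ (v x) * |w x| ^ p) (Ioo a b) := by
  obtain ⟨C, hC⟩ := hψ.bounded
  refine Integrable.bdd_mul (c := C) h.2.2.2.2.2 ?_ (Eventually.of_forall fun x => ?_)
  · exact (hψ.measurable.comp_aemeasurable h.2.2.2.1.aemeasurable).aestronglyMeasurable
  · rw [Real.norm_eq_abs, abs_of_pos (hψ.pos _)]; exact hC _

/-- The function `Ψ_p ∘ u'`, extended by constants to the whole line. -/
lemma exists_primitive {ψ : ℝ → ℝ} (hψ : PsiHypP ψ p) (hp : 1 < p) (hab : a < b)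
    (h : W2pRep p a b u v w) :
    ∃ V W : ℝ → ℝ, Integrable W ∧ Integrable (fun x => |W x| ^ p) ∧
      (∀ x y, V y - V x = ∫ t in x..y, W t) ∧
      (∀ x ∈ Ioo a b, V x = Psip ψ p (v x)) ∧ (∀ x, V x = V (max a (min b x))) ∧
      (∀ x, V x ∈ Icc 0 (∫ t, ψ t ^ (1 / p))) ∧
      ∫ x, |W x| ^ p = ∫ x in Ioo a b, ψ (v x) * |w x| ^ p := by
  obtain ⟨C, hC0, hC⟩ := hψ.exists_rpow_le hp
  have hp0 : p ≠ 0 := by linarith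
  set W : ℝ → ℝ := (Ioo a b).indicator fun x => ψ (v x) ^ (1 / p) * w x with hWdef
  have hW : Integrable W := by
    refine IntegrableOn.integrable_indicator ?_ measurableSet_Ioo
    refine Integrable.bdd_mul (c := C) h.2.2.2.2.1 ?_ (Eventually.of_forall fun x => ?_)
    · exact (hψ.measurable_rpow.comp_aemeasurable h.2.2.2.1.aemeasurable).aestronglyMeasurable
    · rw [Real.norm_eq_abs, abs_of_pos (hψ.rpow_pos _)]; exact hC _
  have hWp : (fun x => |W x| ^ p) = (Ioo a b).indicator fun x => ψ (v x) * |w x| ^ p := by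
    ext x
    by_cases hx : x ∈ Ioo a b
    · rw [hWdef, indicator_of_mem hx, indicator_of_mem hx, abs_mul, abs_of_pos (hψ.rpow_pos _),
        Real.mul_rpow (hψ.rpow_pos _).le (abs_nonneg _), ← Real.rpow_mul (hψ.pos _).le,
        one_div_mul_cancel hp0, Real.rpow_one]
    · rw [hWdef, indicator_of_notMem hx, indicator_of_notMem hx, abs_zero, Real.zero_rpow hp0]
  set c := (a + b) / 2 with hc
  have hcm : c ∈ Ioo a b := ⟨by linarith, by linarith⟩
  set V : ℝ → ℝ := fun x => Psip ψ p (v c) + ∫ t in c..x, W t with hVdef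
  have hV : ∀ x y, V y - V x = ∫ t in x..y, W t := fun x y => by
    simp only [hVdef, add_sub_add_left_eq_sub]
    exact intervalIntegral.integral_interval_sub_left hW.intervalIntegrable hW.intervalIntegrable
  have hVin : ∀ x ∈ Ioo a b, V x = Psip ψ p (v x) := fun x hx => by
    have hsub : uIcc c x ⊆ Ioo a b := (ordConnected_Ioo (a := a) (b := b)).uIcc_subset hcm hx
    have h1 : ∫ t in c..x, W t = ∫ t in c..x, ψ (v t) ^ (1 / p) * w t :=
      intervalIntegral.integral_congr fun t ht => indicator_of_mem (hsub ht) _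
    have h2 := integral_comp_primitive_on h.2.2.2.2.1 h.2.1 hψ.measurable_rpow
      (C := C) (fun t => by rw [abs_of_pos (hψ.rpow_pos _)]; exact hC t) hcm hx
    simp only [hVdef]
    rw [h1, ← h2, ← hψ.Psip_sub]; ring
  have hVp : ∀ x, V x = V (max a (min b x)) := fun x => by
    by_cases hx : x ∈ Icc a b
    · rw [min_eq_right hx.2, max_eq_right hx.1]
    rw [← sub_eq_zero, hV]
    refine (intervalIntegral.integral_congr fun t ht => ?_).trans intervalIntegral.integral_zero
    refine indicator_of_notMem (fun hta => ?_) _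
    rcases lt_or_ge x a with hxa | hxa
    · rw [min_eq_right (by linarith), max_eq_left hxa.le, uIcc_of_ge hxa.le] at ht
      exact absurd ht.2 (not_le.2 hta.1)
    · have hxb : b ≤ x := (not_le.1 fun hxb => hx ⟨hxa, hxb⟩).le
      rw [min_eq_left hxb, max_eq_right hab.le, uIcc_of_le hxb] at ht
      exact absurd ht.1 (not_le.2 hta.2)
  have hVc := continuous_of_primitive hW hV
  refine ⟨V, W, hW, ?_, hV, hVin, hVp, fun x => ?_, ?_⟩
  · rw [hWp]; exact (h.integrableOn_energy hψ).integrable_indicator measurableSet_Ioo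
  · rw [hVp x]
    have hmem : max a (min b x) ∈ closure (Ioo a b) := by
      rw [closure_Ioo hab.ne]
      exact ⟨le_max_left _ _, max_le hab.le (min_le_left _ _)⟩
    refine isClosed_Icc.closure_subset (map_mem_closure hVc hmem fun y hy => ?_)
    rw [hVin y hy]
    exact ⟨(hψ.Psip_pos _).le, (hψ.Psip_lt _).le⟩
  · rw [hWp, integral_indicator measurableSet_Ioo]

/-- Integration by parts. -/
lemma integral_mul_deriv (h : W2pRep p a b u v w) {φ : ℝ → ℝ} (hφ : ContDiff ℝ 1 φ)
    (hφs : tsupport φ ⊆ Ioo a b) :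
    ∫ x in Ioo a b, u x * deriv φ x = -∫ x in Ioo a b, φ x * v x := by
  have hφc := hasCompactSupport_of_tsupport_subset_Ioo hφs
  have hdc := hφ.continuous_deriv le_rfl
  obtain ⟨K, hK⟩ := hφc.deriv.exists_bound_of_continuous hdc
  obtain ⟨K', hK'⟩ := hφc.exists_bound_of_continuous hφ.continuous
  have hz : ∀ x, x ∉ Ioo a b → φ x = 0 := fun x hx =>
    image_eq_zero_of_notMem_tsupport fun hx' => hx (hφs hx')
  have hz' : ∀ x, x ∉ Ioo a b → deriv φ x = 0 := fun x hx =>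
    image_eq_zero_of_notMem_tsupport fun hx' => hx (hφs (tsupport_deriv_subset hx'))
  have i1 : IntegrableOn (fun x => u x * deriv φ x) (Ioo a b) :=
    Integrable.mul_bdd (c := K) h.2.2.1 hdc.aestronglyMeasurable (Eventually.of_forall hK)
  have i2 : IntegrableOn (fun x => φ x * v x) (Ioo a b) :=
    Integrable.bdd_mul (c := K') h.2.2.2.1 hφ.continuous.aestronglyMeasurable
      (Eventually.of_forall hK')
  have i3 : IntegrableOn (fun x => u x * φ x) (Ioo a b) :=
    Integrable.mul_bdd (c := K') h.2.2.1 hφ.continuous.aestronglyMeasurable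
      (Eventually.of_forall hK')
  have i1' := (integrableOn_iff_integrable_of_support_subset (f := fun x => u x * deriv φ x)
    (fun x hx => by by_contra hc; exact hx (by simp [hz' x hc]))).1 i1
  have i2' := (integrableOn_iff_integrable_of_support_subset (f := fun x => φ x * v x)
    (fun x hx => by by_contra hc; exact hx (by simp [hz x hc]))).1 i2
  have i3' := (integrableOn_iff_integrable_of_support_subset (f := fun x => u x * φ x)
    (fun x hx => by by_contra hc; exact hx (by simp [hz x hc]))).1 i3
  have hd : ∀ x, HasDerivAt (fun x => u x * φ x) (u x * deriv φ x + φ x * v x) x := fun x => by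
    by_cases hx : x ∈ Ioo a b
    · have := (h.1 x hx).mul (hφ.differentiable one_ne_zero x).hasDerivAt
      convert! this using 1; ring
    · rw [hz' x hx, hz x hx, mul_zero, zero_mul, add_zero]
      have hx' : x ∉ tsupport φ := fun h => hx (hφs h)
      refine (hasDerivAt_const x (0 : ℝ)).congr_of_eventuallyEq ?_
      filter_upwards [notMem_tsupport_iff_eventuallyEq.1 hx'] with y hy
      rw [hy]; simp
  have := integral_eq_zero_of_hasDerivAt_of_integrable hd (i1'.add i2') i3'
  rw [integral_add i1' i2'] at this
  rw [setIntegral_eq_integral_of_forall_compl_eq_zero (fun x hx => by simp [hz' x hx]),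
    setIntegral_eq_integral_of_forall_compl_eq_zero (fun x hx => by simp [hz x hx])]
  linarith

end W2pRep

lemma Ultrafilter.exists_tendsto_Icc {ι : Type*} (l : Ultrafilter ι) {f : ι → ℝ} {a b : ℝ}
    (h : ∀ i, f i ∈ Icc a b) : ∃ c ∈ Icc a b, Tendsto f l (𝓝 c) :=
  isCompact_Icc.ultrafilter_le_nhds' (l.map f) (Filter.mem_map.2 (Eventually.of_forall h))

/-- Compactness and lower semicontinuity of the `p`-energy. -/
lemma exists_limit_of_primitive {p : ℝ} (hp : 1 < p) {a b : ℝ} (hab : a < b)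
    (l : Ultrafilter ℕ) {V W : ℕ → ℝ → ℝ} {c M : ℝ} (hW : ∀ k, Integrable (W k))
    (hWp : ∀ k, Integrable (fun x => |W k x| ^ p)) (hc : ∀ k, ∫ x, |W k x| ^ p ≤ c)
    (hV : ∀ k x y, V k y - V k x = ∫ t in x..y, W k t)
    (hVp : ∀ k x, V k x = V k (max a (min b x))) (hVM : ∀ k x, V k x ∈ Icc 0 M) :
    ∃ g w : ℝ → ℝ, Continuous g ∧ (∀ x, Tendsto (fun k => V k x) l (𝓝 (g x))) ∧
      (∀ x, g x ∈ Icc 0 M) ∧ IntegrableOn w (Ioo a b) ∧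
      IntegrableOn (fun x => |w x| ^ p) (Ioo a b) ∧
      (∀ x ∈ Ioo a b, ∀ y ∈ Ioo a b, g y - g x = ∫ t in x..y, w t) ∧
      ∀ B, 0 ≤ B → (∀ᶠ k in l, ∫ x, |W k x| ^ p ≤ B) → ∫ x in Ioo a b, |w x| ^ p ≤ B := by
  choose g hgM hg using fun x => l.exists_tendsto_Icc (fun k => hVM k x)
  have hAC := absolutelyContinuousOnInterval_of_tendsto hp hW hWp hc hV hg
  have hgc : Continuous g := continuous_iff_continuousAt.2 fun x =>
    (hAC (x - 1) (x + 1)).continuousOn.continuousAt (by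
      rw [uIcc_of_le (by linarith)]; exact Icc_mem_nhds (by linarith) (by linarith))
  have hen : ∀ B, (∀ᶠ k in l, ∫ x, |W k x| ^ p ≤ B) →
      ∫⁻ x in Ioo a b, ENNReal.ofReal (|deriv g x| ^ p) ≤ ENNReal.ofReal B := by
    intro B hB
    have hn : ∀ n : ℕ, ∃ k, (∀ x ∈ Icc a b, |V k x - g x| < 1 / ((n : ℝ) + 1)) ∧
        ∫ x, |W k x| ^ p ≤ B := fun n =>
      ((eventually_forall_Icc_abs_sub_lt hp hW hWp hc hV hg a b
        (Nat.one_div_pos_of_nat (n := n))).and hB).exists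
    choose k hk hkB using hn
    refine lintegral_deriv_le_of_tendsto hp (fun n => hW (k n)) (fun n => hWp (k n)) hkB
      (fun n => hV (k n)) (fun x => ?_) a b
    have hpx : g x = g (max a (min b x)) :=
      tendsto_nhds_unique (hg x) ((hg _).congr fun k => (hVp k x).symm)
    simp only [hVp _ x, hpx]
    refine tendsto_iff_dist_tendsto_zero.2 (squeeze_zero (fun _ => dist_nonneg) (fun n => ?_)
      tendsto_one_div_add_atTop_nhds_zero_nat)
    exact (hk n _ ⟨le_max_left _ _, max_le hab.le (min_le_left _ _)⟩).le
  have hfin : IntegrableOn (fun x => |deriv g x| ^ p) (Ioo a b) := by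
    refine (lintegral_ofReal_ne_top_iff_integrable
      ((measurable_deriv g).abs.pow_const p).aestronglyMeasurable
      (Eventually.of_forall fun x => by positivity)).1 ?_
    exact ((hen c (Eventually.of_forall hc)).trans_lt ENNReal.ofReal_lt_top).ne
  refine ⟨g, deriv g, hgc, hg, hgM, ?_, hfin, fun x _ y _ => ?_, fun B hB0 hB => ?_⟩
  · exact ((intervalIntegrable_iff_integrableOn_Ioo_of_le hab.le).1 (hAC a b).intervalIntegrable_deriv)
  · exact (hAC x y).integral_deriv_eq_sub.symm
  · rw [integral_eq_lintegral_of_nonneg_ae (Eventually.of_forall fun x => by positivity)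
      ((measurable_deriv g).abs.pow_const p).aestronglyMeasurable]
    exact ENNReal.toReal_le_of_le_ofReal hB0 (hen B hB)

lemma exists_tendsto_setIntegral_mul (l : Ultrafilter ℕ) {a b : ℝ} {v : ℕ → ℝ → ℝ}
    (hv : ∀ k, IntegrableOn (v k) (Ioo a b)) {c : ℝ} (hc : ∀ k, ∫ x in Ioo a b, |v k x| ≤ c)
    {h : ℝ → ℝ} (hh : Measurable h) (hh0 : ∀ t, 0 ≤ h t) (hht : ∀ t, h t ≤ |t|) :
    ∃ α : Measure ℝ, IsFiniteMeasure α ∧ ∀ φ : ℝ → ℝ, Continuous φ → (∃ C, ∀ x, |φ x| ≤ C) →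
      Tendsto (fun k => ∫ x in Ioo a b, φ x * h (v k x)) l (𝓝 (∫ x, φ x ∂α)) := by
  have hm : ∀ k, AEMeasurable (fun x => h (v k x)) (volume.restrict (Ioo a b)) := fun k =>
    hh.comp_aemeasurable (hv k).aemeasurable
  have hi : ∀ k, IntegrableOn (fun x => h (v k x)) (Ioo a b) := fun k =>
    Integrable.mono (hv k) (hm k).aestronglyMeasurable (Eventually.of_forall fun x => by
      rw [Real.norm_eq_abs, abs_of_nonneg (hh0 _)]; exact hht _)
  obtain ⟨α, h1, -, h3⟩ := exists_tendsto_integral_of_measure_le l (isCompact_Icc (a := a) (b := b))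
    (α := fun k => (volume.restrict (Ioo a b)).withDensity fun x => ENNReal.ofReal (h (v k x)))
    (C := c.toNNReal) (fun k => by
      rw [withDensity_apply _ MeasurableSet.univ, Measure.restrict_univ,
        ← ofReal_integral_eq_lintegral_ofReal (hi k) (Eventually.of_forall fun x => hh0 _)]
      exact ENNReal.ofReal_le_ofReal ((integral_mono (hi k) (hv k).abs fun x => hht _).trans (hc k)))
    (fun k => by
      refine withDensity_absolutelyContinuous _ _ ?_
      rw [Measure.restrict_apply measurableSet_Icc.compl]
      convert! measure_empty (μ := (volume : Measure ℝ))
      rw [← disjoint_iff_inter_eq_empty, Set.disjoint_left]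
      exact fun x hx hx' => hx (Ioo_subset_Icc_self hx'))
  refine ⟨α, h1, fun φ hφ hφb => (h3 φ hφ hφb).congr fun k => ?_⟩
  rw [integral_withDensity_eq_integral_toReal_smul₀ (hm k).ennreal_ofReal
    (Eventually.of_forall fun x => ENNReal.ofReal_lt_top)]
  refine integral_congr_ae (Eventually.of_forall fun x => ?_)
  simp only [ENNReal.toReal_ofReal (hh0 _), smul_eq_mul, mul_comm]

lemma volume_eq_zero_of_forall_le_abs {a b : ℝ} {v : ℕ → ℝ → ℝ}
    (hv : ∀ k, IntegrableOn (v k) (Ioo a b)) {c : ℝ} (hc : ∀ k, ∫ x in Ioo a b, |v k x| ≤ c)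
    {S : Set ℝ} (hSm : MeasurableSet S) (hS : S ⊆ Ioo a b)
    (h : ∀ T : ℝ, ∃ k, ∀ x ∈ S, T ≤ |v k x|) : volume S = 0 := by
  have hfin : volume S ≠ ⊤ := measure_ne_top_of_subset hS (by simp)
  have hT : ∀ T : ℝ, T * volume.real S ≤ c := fun T => by
    obtain ⟨k, hk⟩ := h T
    calc T * volume.real S = ∫ _x in S, T := by
          rw [setIntegral_const, smul_eq_mul, mul_comm]
      _ ≤ ∫ x in S, |v k x| :=
          setIntegral_mono_on (integrableOn_const hfin) ((hv k).mono_set hS).abs hSm hk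
      _ ≤ ∫ x in Ioo a b, |v k x| := setIntegral_mono_set (hv k).abs
          (Eventually.of_forall fun x => abs_nonneg _) hS.eventuallyLE
      _ ≤ c := hc k
  by_contra hne
  have hpos : 0 < volume.real S := ENNReal.toReal_pos hne hfin
  have := hT ((c + 1) / volume.real S)
  rw [div_mul_cancel₀ _ hpos.ne'] at this
  linarith

/-- Sequences of bounded energy have their limit in `X^p_ψ`, with the lower semicontinuity
inequality. -/
lemma exists_memXp_of_energy_le {ψ : ℝ → ℝ} {a b p : ℝ} (hψ : PsiHypP ψ p) (hp : 1 < p)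
    (hab : a < b) {U v w : ℕ → ℝ → ℝ} {u : ℝ → ℝ} (hU : TendstoL1 a b U u)
    (hrep : ∀ k, W2pRep p a b (U k) (v k) (w k)) {c : ℝ}
    (hc : ∀ k, (∫ x in Ioo a b, |v k x|) + ∫ x in Ioo a b, ψ (v k x) * |w k x| ^ p ≤ c) :
    ∃ (μp μn : Measure ℝ) (g ω : ℝ → ℝ), MemXp ψ p a b u μp μn ∧ Continuous g ∧
      (∀ᵐ x ∂(volume.restrict (Ioo a b)), g x = Psip ψ p (uaD μp μn x)) ∧
      IntegrableOn ω (Ioo a b) ∧ IntegrableOn (fun x => |ω x| ^ p) (Ioo a b) ∧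
      (∀ x ∈ Ioo a b, ∀ y ∈ Ioo a b, g y - g x = ∫ t in x..y, ω t) ∧
      (μp + μn) (Ioo a b) + ENNReal.ofReal (∫ x in Ioo a b, |ω x| ^ p) ≤ ENNReal.ofReal c := by
  have hv : ∀ k, IntegrableOn (v k) (Ioo a b) := fun k => (hrep k).2.2.2.1
  have hA0 : ∀ k, 0 ≤ ∫ x in Ioo a b, |v k x| := fun k => integral_nonneg fun x => abs_nonneg _
  have hE0 : ∀ k, 0 ≤ ∫ x in Ioo a b, ψ (v k x) * |w k x| ^ p := fun k =>
    integral_nonneg fun x => mul_nonneg (hψ.pos _).le (by positivity)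
  have hAc : ∀ k, ∫ x in Ioo a b, |v k x| ≤ c := fun k => by linarith [hc k, hE0 k]
  choose V W hW hWp hV hVin hVp hVM hWE using fun k => (hrep k).exists_primitive hψ hp hab
  set l : Ultrafilter ℕ := hyperfilter ℕ with hl
  have hEc : ∀ k, ∫ x, |W k x| ^ p ≤ c := fun k => by rw [hWE]; linarith [hc k, hA0 k]
  obtain ⟨g, ω, hgc, hg, hgM, hω, hωp, hgω, hωB⟩ :=
    exists_limit_of_primitive hp hab l hW hWp hEc hV hVp hVM
  obtain ⟨e, he0, he⟩ := l.exists_tendsto_Icc (f := fun k => ∫ x, |W k x| ^ p) (a := 0) (b := c)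
    fun k => ⟨by rw [hWE]; exact hE0 k, hEc k⟩
  have hωe : ∫ x in Ioo a b, |ω x| ^ p ≤ e := le_of_forall_gt_imp_ge_of_dense fun B hB =>
    hωB B (he0.1.trans hB.le) ((he.eventually (eventually_lt_nhds hB)).mono fun k hk => hk.le)
  have hmp : LipschitzWith 1 fun t : ℝ => max t 0 := LipschitzWith.id.max_const 0
  have hmn : LipschitzWith 1 fun t : ℝ => max (-t) 0 := LipschitzWith.id.neg.max_const 0
  obtain ⟨α, hαf, hα⟩ := exists_tendsto_setIntegral_mul l hv hAc hmp.continuous.measurable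
    (fun t => le_max_right _ _) (fun t => max_le (le_abs_self t) (abs_nonneg t))
  obtain ⟨β, hβf, hβ⟩ := exists_tendsto_setIntegral_mul l hv hAc hmn.continuous.measurable
    (fun t => le_max_right _ _) (fun t => max_le (neg_le_abs t) (abs_nonneg t))
  have hbd : ∀ φ : ℝ → ℝ, ContDiff ℝ 1 φ → tsupport φ ⊆ Ioo a b → ∃ C, ∀ x, |φ x| ≤ C :=
    fun φ hφ hφs =>
      (hasCompactSupport_of_tsupport_subset_Ioo hφs).exists_bound_of_continuous hφ.continuous
  have hα' := fun φ hφ hφs => hα φ (ContDiff.continuous hφ) (hbd φ hφ hφs)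
  have hβ' := fun φ hφ hφs => hβ φ (ContDiff.continuous hφ) (hbd φ hφ hφs)
  have hUn : ∀ ε > 0, ∀ᶠ k in l, ∀ x ∈ Ioo a b, |V k x - g x| < ε := fun ε hε =>
    (eventually_forall_Icc_abs_sub_lt hp hW hWp hEc hV hg a b hε).mono fun k hk x hx =>
      hk x (Ioo_subset_Icc_self hx)
  have hip : ∀ k, IntegrableOn (fun x => max (v k x) 0) (Ioo a b) := fun k => (hv k).pos_part
  have hin : ∀ k, IntegrableOn (fun x => max (-v k x) 0) (Ioo a b) := fun k => (hv k).neg_part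
  have habs : ∀ t : ℝ, max t 0 + max (-t) 0 = |t| := max_zero_add_max_neg_zero_eq_abs_self
  have hsub : ∀ t : ℝ, max t 0 - max (-t) 0 = t := max_zero_sub_max_neg_zero_eq_self
  have hmass : α.real univ + β.real univ + e ≤ c := by
    have h1 := hα (fun _ => 1) continuous_const ⟨1, fun _ => by simp⟩
    have h2 := hβ (fun _ => 1) continuous_const ⟨1, fun _ => by simp⟩
    simp only [integral_const, smul_eq_mul, mul_one, one_mul] at h1 h2
    refine le_of_tendsto ((h1.add h2).add he) (Eventually.of_forall fun k => ?_)
    rw [← integral_add (hip k) (hin k), hWE]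
    simp only [habs]
    exact hc k
  have hPM := hψ.Psip_lt
  have hP0 := hψ.Psip_pos
  have hα0 : α {x ∈ Ioo a b | g x < Psip ψ p 0} = 0 := by
    refine measure_mono_null (fun x hx => ?_) (measure_eq_zero_of_tendsto
      (l := l) (v := v) (h := fun t => max t 0) hα'
      (O := fun n : ℕ => {x ∈ Ioo a b | g x < Psip ψ p 0 - 1 / ((n : ℝ) + 1)})
      (fun n => isOpen_Ioo.inter (isOpen_Iio.preimage hgc)) (fun n x hx => hx.1) fun n => ?_)
    · obtain ⟨n, hn⟩ := exists_nat_one_div_lt (sub_pos.2 hx.2)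
      exact mem_iUnion.2 ⟨n, hx.1, by linarith⟩
    · filter_upwards [hUn _ (Nat.one_div_pos_of_nat (n := n))] with k hk x hx
      have h1 := (abs_lt.1 (hk x hx.1)).2
      have h2 := hx.2
      rw [hVin k x hx.1] at h1
      exact max_eq_right (hψ.Psip_strictMono.lt_iff_lt.1 (by linarith)).le
  have hβ0 : β {x ∈ Ioo a b | Psip ψ p 0 < g x} = 0 := by
    refine measure_mono_null (fun x hx => ?_) (measure_eq_zero_of_tendsto
      (l := l) (v := v) (h := fun t => max (-t) 0) hβ'
      (O := fun n : ℕ => {x ∈ Ioo a b | Psip ψ p 0 + 1 / ((n : ℝ) + 1) < g x})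
      (fun n => isOpen_Ioo.inter (isOpen_Ioi.preimage hgc)) (fun n x hx => hx.1) fun n => ?_)
    · obtain ⟨n, hn⟩ := exists_nat_one_div_lt (sub_pos.2 hx.2)
      exact mem_iUnion.2 ⟨n, hx.1, by linarith⟩
    · filter_upwards [hUn _ (Nat.one_div_pos_of_nat (n := n))] with k hk x hx
      have h1 := (abs_lt.1 (hk x hx.1)).1
      have h2 := hx.2
      rw [hVin k x hx.1] at h1
      exact max_eq_right (neg_nonpos.2 (hψ.Psip_strictMono.lt_iff_lt.1 (by linarith)).le)
  have hSm : ∀ y, MeasurableSet {x ∈ Ioo a b | g x = y} := fun y =>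
    measurableSet_Ioo.inter ((measurableSet_singleton y).preimage hgc.measurable)
  have hS : volume {x ∈ Ioo a b | g x = ∫ t, ψ t ^ (1 / p)} = 0 := by
    refine volume_eq_zero_of_forall_le_abs hv hAc (hSm _) (fun x hx => hx.1) fun T => ?_
    obtain ⟨k, hk⟩ := (hUn _ (sub_pos.2 (hPM T))).exists
    refine ⟨k, fun x hx => ?_⟩
    have := (abs_lt.1 (hk x hx.1)).1
    rw [hx.2, hVin k x hx.1] at this
    exact (hψ.Psip_strictMono.lt_iff_lt.1 (by linarith)).le.trans (le_abs_self _)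
  have hS₀ : volume {x ∈ Ioo a b | g x = 0} = 0 := by
    refine volume_eq_zero_of_forall_le_abs hv hAc (hSm _) (fun x hx => hx.1) fun T => ?_
    obtain ⟨k, hk⟩ := (hUn _ (hP0 (-T))).exists
    refine ⟨k, fun x hx => ?_⟩
    have := (abs_lt.1 (hk x hx.1)).2
    rw [hx.2, hVin k x hx.1, sub_zero] at this
    exact (le_neg.1 (hψ.Psip_strictMono.lt_iff_lt.1 this).le).trans (neg_le_abs _)
  have hder : ∀ φ : ℝ → ℝ, ContDiff ℝ 1 φ → tsupport φ ⊆ Ioo a b →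
      ∫ x in Ioo a b, u x * deriv φ x = (∫ x, φ x ∂β) - ∫ x, φ x ∂α := by
    intro φ hφ hφs
    have hdc := hφ.continuous_deriv le_rfl
    obtain ⟨K, hK⟩ := (hasCompactSupport_of_tsupport_subset_Ioo
      hφs).deriv.exists_bound_of_continuous hdc
    have hi : ∀ f, IntegrableOn f (Ioo a b) → IntegrableOn (fun x => f x * deriv φ x) (Ioo a b) :=
      fun f hf => Integrable.mul_bdd (c := K) hf hdc.aestronglyMeasurable (Eventually.of_forall hK)
    obtain ⟨K', hK'⟩ := hbd φ hφ hφs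
    have hi' : ∀ f, IntegrableOn f (Ioo a b) → IntegrableOn (fun x => φ x * f x) (Ioo a b) :=
      fun f hf => Integrable.bdd_mul (c := K') hf hφ.continuous.aestronglyMeasurable
        (Eventually.of_forall hK')
    have h1 : Tendsto (fun k => ∫ x in Ioo a b, U k x * deriv φ x) l
        (𝓝 (∫ x in Ioo a b, u x * deriv φ x)) := by
      refine Tendsto.mono_left ?_ Nat.hyperfilter_le_atTop
      refine tendsto_iff_dist_tendsto_zero.2 (squeeze_zero (fun _ => dist_nonneg) (fun k => ?_)
        (by simpa using hU.2.2.const_mul K))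
      have hd : IntegrableOn (fun x => U k x - u x) (Ioo a b) := (hU.1 k).sub hU.2.1
      rw [Real.dist_eq, ← integral_sub (hi _ (hU.1 k)) (hi _ hU.2.1), ← integral_const_mul]
      refine (abs_integral_le_integral_abs).trans
        (integral_mono ((hi _ (hU.1 k)).sub (hi _ hU.2.1)).abs (hd.abs.const_mul K) fun x => ?_)
      simp only
      rw [← sub_mul, abs_mul, mul_comm]
      exact mul_le_mul_of_nonneg_right (hK x) (abs_nonneg _)
    refine tendsto_nhds_unique h1 (((hβ' φ hφ hφs).sub (hα' φ hφ hφs)).congr fun k => ?_)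
    rw [(hrep k).integral_mul_deriv hφ hφs, ← integral_sub (hi' _ (hin k)) (hi' _ (hip k)),
      ← integral_neg]
    refine integral_congr_ae (Eventually.of_forall fun x => ?_)
    simp only
    rw [← mul_sub, ← neg_sub, hsub, mul_neg]
  obtain ⟨hX, hgX⟩ := memXp_of_withDensity hψ hU.2.1 hgc (fun x _ => hgM x)
    (restrict_eq_withDensity_restrict_of_tendsto' hψ hp hgc hv hVin hUn hmp (by simp)
      (fun t => le_max_right _ _) hα')
    (restrict_eq_withDensity_restrict_of_tendsto' hψ hp hgc hv hVin hUn hmn (by simp)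
      (fun t => le_max_right _ _) hβ') hα0 hβ0 hS hS₀ hder hω hωp hgω
  refine ⟨_, _, g, ω, hX, hgc, hgX, hω, hωp, hgω, ?_⟩
  calc (α.restrict (Ioo a b) + β.restrict (Ioo a b)) (Ioo a b) +
        ENNReal.ofReal (∫ x in Ioo a b, |ω x| ^ p)
      ≤ (α univ + β univ) + ENNReal.ofReal e := by
        rw [Measure.add_apply]
        exact add_le_add (add_le_add
          ((Measure.restrict_apply_le _ _).trans (measure_mono (subset_univ _)))
          ((Measure.restrict_apply_le _ _).trans (measure_mono (subset_univ _))))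
          (ENNReal.ofReal_le_ofReal hωe)
    _ = ENNReal.ofReal (α.real univ + β.real univ + e) := by
        rw [ENNReal.ofReal_add (by positivity) he0.1, ENNReal.ofReal_add (by positivity)
          (by positivity), ofReal_measureReal, ofReal_measureReal]
    _ ≤ ENNReal.ofReal c := ENNReal.ofReal_le_ofReal hmass

lemma exists_primitive_extension {a b : ℝ} (hab : a < b) {g w : ℝ → ℝ}
    (hw : IntegrableOn w (Ioo a b))
    (hgw : ∀ x ∈ Ioo a b, ∀ y ∈ Ioo a b, g y - g x = ∫ t in x..y, w t) :
    ∃ G : ℝ → ℝ, (∀ x y, G y - G x = ∫ t in x..y, (Ioo a b).indicator w t) ∧ EqOn G g (Ioo a b) := by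
  set c := (a + b) / 2 with hc
  have hcm : c ∈ Ioo a b := ⟨by linarith, by linarith⟩
  have hW : Integrable ((Ioo a b).indicator w) := hw.integrable_indicator measurableSet_Ioo
  refine ⟨fun x => g c + ∫ t in c..x, (Ioo a b).indicator w t, fun x y => ?_, fun x hx => ?_⟩
  · simp only [add_sub_add_left_eq_sub]
    exact intervalIntegral.integral_interval_sub_left hW.intervalIntegrable hW.intervalIntegrable
  · have hsub : uIcc c x ⊆ Ioo a b := (ordConnected_Ioo (a := a) (b := b)).uIcc_subset hcm hx
    have h1 : ∫ t in c..x, (Ioo a b).indicator w t = ∫ t in c..x, w t :=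
      intervalIntegral.integral_congr fun t ht => indicator_of_mem (hsub ht) _
    simp only
    rw [h1, ← hgw c hcm x hx]; ring

lemma continuousOn_of_primitive_on {a b : ℝ} (hab : a < b) {g w : ℝ → ℝ}
    (hw : IntegrableOn w (Ioo a b))
    (hgw : ∀ x ∈ Ioo a b, ∀ y ∈ Ioo a b, g y - g x = ∫ t in x..y, w t) :
    ContinuousOn g (Ioo a b) := by
  obtain ⟨G, hG, hGg⟩ := exists_primitive_extension hab hw hgw
  exact (continuous_of_primitive (hw.integrable_indicator measurableSet_Ioo) hG).continuousOn.congr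
    hGg.symm

/-- The weak derivative is unique. -/
lemma ae_eq_of_primitive_on {a b : ℝ} (hab : a < b) {g w g' w' : ℝ → ℝ}
    (hw : IntegrableOn w (Ioo a b)) (hw' : IntegrableOn w' (Ioo a b))
    (hgw : ∀ x ∈ Ioo a b, ∀ y ∈ Ioo a b, g y - g x = ∫ t in x..y, w t)
    (hgw' : ∀ x ∈ Ioo a b, ∀ y ∈ Ioo a b, g' y - g' x = ∫ t in x..y, w' t)
    (h : g =ᵐ[volume.restrict (Ioo a b)] g') : w =ᵐ[volume.restrict (Ioo a b)] w' := by
  have heq : EqOn g g' (Ioo a b) := Measure.eqOn_open_of_ae_eq h isOpen_Ioo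
    (continuousOn_of_primitive_on hab hw hgw) (continuousOn_of_primitive_on hab hw' hgw')
  obtain ⟨G, hG, hGg⟩ := exists_primitive_extension hab hw hgw
  obtain ⟨G', hG', hGg'⟩ := exists_primitive_extension hab hw' hgw'
  have hder : ∀ {G w : ℝ → ℝ}, IntegrableOn w (Ioo a b) →
      (∀ x y, G y - G x = ∫ t in x..y, (Ioo a b).indicator w t) →
      ∀ᵐ x, x ∈ Ioo a b → HasDerivAt G (w x) x := fun {G w} hw hG => by
    have hW := (hw.integrable_indicator measurableSet_Ioo).locallyIntegrable
    filter_upwards [LocallyIntegrable.ae_hasDerivAt_integral hW] with x hx hxI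
    have h1 := (hx 0).const_add (G 0)
    rw [indicator_of_mem hxI] at h1
    refine h1.congr_of_eventuallyEq (Eventually.of_forall fun y => ?_)
    simp only
    rw [← hG 0 y]; ring
  rw [EventuallyEq, ae_restrict_iff' measurableSet_Ioo]
  filter_upwards [hder hw hG, hder hw' hG'] with x h1 h2 hx
  refine (h1 hx).unique ((h2 hx).congr_of_eventuallyEq ?_)
  filter_upwards [isOpen_Ioo.mem_nhds hx] with y hy
  rw [hGg hy, hGg' hy, heq hy]

lemma exists_memXp_of_liminf_lt {ψ : ℝ → ℝ} {a b p : ℝ} (hψ : PsiHypP ψ p) (hp : 1 < p)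
    (hab : a < b) {U : ℕ → ℝ → ℝ} {u : ℝ → ℝ} (hU : TendstoL1 a b U u) {c : ℝ}
    (hc : liminf (fun k => Fp ψ p a b (U k)) atTop < ENNReal.ofReal c) :
    ∃ (μp μn : Measure ℝ) (g ω : ℝ → ℝ), MemXp ψ p a b u μp μn ∧ Continuous g ∧
      (∀ᵐ x ∂(volume.restrict (Ioo a b)), g x = Psip ψ p (uaD μp μn x)) ∧
      IntegrableOn ω (Ioo a b) ∧ IntegrableOn (fun x => |ω x| ^ p) (Ioo a b) ∧
      (∀ x ∈ Ioo a b, ∀ y ∈ Ioo a b, g y - g x = ∫ t in x..y, ω t) ∧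
      (μp + μn) (Ioo a b) + ENNReal.ofReal (∫ x in Ioo a b, |ω x| ^ p) ≤ ENNReal.ofReal c := by
  obtain ⟨φ, hφ, hlt⟩ := extraction_of_frequently_atTop (frequently_lt_of_liminf_lt (by isBoundedDefault) hc)
  simp only [Fp, iInf_lt_iff] at hlt
  choose v w hrep hlt using hlt
  refine exists_memXp_of_energy_le hψ hp hab (U := fun n => U (φ n))
    ⟨fun k => hU.1 _, hU.2.1, hU.2.2.comp hφ.tendsto_atTop⟩ hrep fun k => ?_
  exact (ENNReal.ofReal_lt_ofReal_iff'.1 (hlt k)).1.le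

lemma le_FpRel {ψ : ℝ → ℝ} {a b p : ℝ} (hψ : PsiHypP ψ p) (hp : 1 < p)
    (hab : a < b) {u : ℝ → ℝ} {μp μn : Measure ℝ} {g w : ℝ → ℝ} (hX : MemXp ψ p a b u μp μn)
    (hg : ∀ᵐ x ∂(volume.restrict (Ioo a b)), g x = Psip ψ p (uaD μp μn x))
    (hw : IntegrableOn w (Ioo a b))
    (hgw : ∀ x ∈ Ioo a b, ∀ y ∈ Ioo a b, g y - g x = ∫ t in x..y, w t) :
    (μp + μn) (Ioo a b) + ENNReal.ofReal (∫ x in Ioo a b, |w x| ^ p) ≤ FpRel ψ p a b u := by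
  refine le_iInf₂ fun U hU => le_of_forall_gt_imp_ge_of_dense fun c hc => ?_
  rcases eq_or_ne c ⊤ with rfl | hct
  · exact le_top
  rw [← ENNReal.ofReal_toReal hct] at hc
  obtain ⟨μp', μn', g', w', hX', -, hg', hw', -, hgw', hle⟩ :=
    exists_memXp_of_liminf_lt hψ hp hab hU hc
  obtain ⟨rfl, rfl⟩ := hX.1.unique hX'.1
  have hww : w =ᵐ[volume.restrict (Ioo a b)] w' :=
    ae_eq_of_primitive_on hab hw hw' hgw hgw' (by
      filter_upwards [hg, hg'] with x h1 h2; rw [h1, h2])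
  rw [ENNReal.ofReal_toReal hct] at hle
  have hint : ∫ x in Ioo a b, |w x| ^ p = ∫ x in Ioo a b, |w' x| ^ p :=
    integral_congr_ae (hww.mono fun x hx => by simp only [hx])
  rwa [hint]

lemma exists_memXp_of_FpRel_ne_top {ψ : ℝ → ℝ} {a b p : ℝ} (hψ : PsiHypP ψ p) (hp : 1 < p)
    (hab : a < b) {u : ℝ → ℝ} (h : FpRel ψ p a b u ≠ ⊤) :
    ∃ μp μn : Measure ℝ, MemXp ψ p a b u μp μn := by
  obtain ⟨U, hU, hlt⟩ : ∃ U, ∃ _ : TendstoL1 a b U u,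
      liminf (fun k => Fp ψ p a b (U k)) atTop < ⊤ := by
    simpa only [FpRel, iInf_lt_iff] using h.lt_top
  obtain ⟨c, hc, hct⟩ := exists_between hlt
  rw [← ENNReal.ofReal_toReal hct.ne] at hc
  obtain ⟨μp, μn, g, w, hX, -⟩ := exists_memXp_of_liminf_lt hψ hp hab hU hc
  exact ⟨μp, μn, hX⟩

lemma tendsto_real_Iio_nhdsLT (μ : Measure ℝ) [IsFiniteMeasure μ] (x : ℝ) :
    Tendsto (fun t => μ.real (Iio t)) (𝓝[<] x) (𝓝 (μ.real (Iio x))) := by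
  obtain ⟨s, hs, hsx, hlim⟩ := exists_seq_strictMono_tendsto x
  have h1 := (monotone_real_Iio μ).tendsto_nhdsLT x
  have h2 : Tendsto s atTop (𝓝[<] x) :=
    tendsto_nhdsWithin_iff.2 ⟨hlim, Eventually.of_forall hsx⟩
  have h3 : Tendsto (fun n => μ.real (Iio (s n))) atTop (𝓝 (μ.real (Iio x))) := by
    have hU : ⋃ n, Iio (s n) = Iio x := by
      ext y
      simp only [mem_iUnion, mem_Iio]
      exact ⟨fun ⟨n, hn⟩ => hn.trans (hsx n), fun hy => (hlim.eventually (lt_mem_nhds hy)).exists⟩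
    have := tendsto_measure_iUnion_atTop (μ := μ) (s := fun n => Iio (s n))
      fun m n hmn => Iio_subset_Iio (hs.monotone hmn)
    rw [hU] at this
    exact (ENNReal.tendsto_toReal (measure_ne_top _ _)).comp this
  rwa [tendsto_nhds_unique h3 (h1.comp h2)]

/-- The left inverse of `x ↦ x + ν(]-∞,x[)`, which spends additional time `ν {x}` at every
atom `x` of `ν`. -/
def timeChange (ν : Measure ℝ) (s : ℝ) : ℝ :=
  sSup {x | x + ν.real (Iio x) ≤ s}

section TimeChange

variable (ν : Measure ℝ)

lemma bddAbove_timeChange (s : ℝ) : BddAbove {x | x + ν.real (Iio x) ≤ s} :=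
  ⟨s, fun x hx => by
    have : 0 ≤ ν.real (Iio x) := measureReal_nonneg
    simp only [mem_ofPred_eq] at hx
    linarith⟩

variable [IsFiniteMeasure ν]

lemma sub_mem_timeChange (s : ℝ) : s - ν.real univ ∈ {x | x + ν.real (Iio x) ≤ s} := by
  have : ν.real (Iio (s - ν.real univ)) ≤ ν.real univ := measureReal_mono (subset_univ _)
  simp only [mem_ofPred_eq]
  linarith

lemma le_timeChange_iff {x s : ℝ} : x ≤ timeChange ν s ↔ x + ν.real (Iio x) ≤ s := by
  refine ⟨fun h => ?_, fun h => le_csSup (bddAbove_timeChange ν s) h⟩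
  have h1 : ∀ y < x, y + ν.real (Iio y) ≤ s := fun y hy => by
    obtain ⟨z, hz, hyz⟩ := exists_lt_of_lt_csSup ⟨_, sub_mem_timeChange ν s⟩ (hy.trans_le h)
    exact (add_le_add hyz.le (monotone_real_Iio ν hyz.le)).trans hz
  have h2 : Tendsto (fun y => y + ν.real (Iio y)) (𝓝[<] x) (𝓝 (x + ν.real (Iio x))) :=
    (tendsto_id.mono_left nhdsWithin_le_nhds).add (tendsto_real_Iio_nhdsLT ν x)
  exact le_of_tendsto h2 (eventually_nhdsWithin_of_forall h1)

lemma timeChange_lt_iff {x s : ℝ} : timeChange ν s < x ↔ s < x + ν.real (Iio x) := by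
  rw [← not_le, le_timeChange_iff, not_le]

lemma timeChange_le (s : ℝ) : timeChange ν s ≤ s := by
  have h1 := (le_timeChange_iff ν (s := s)).1 le_rfl
  have h2 : 0 ≤ ν.real (Iio (timeChange ν s)) := measureReal_nonneg
  linarith

lemma sub_le_timeChange (s : ℝ) : s - ν.real univ ≤ timeChange ν s :=
  le_csSup (bddAbove_timeChange ν s) (sub_mem_timeChange ν s)

lemma monotone_timeChange : Monotone (timeChange ν) := fun _ _ h =>
  (le_timeChange_iff ν).2 (((le_timeChange_iff ν).1 le_rfl).trans h)

lemma preimage_timeChange_Ico (x y : ℝ) :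
    timeChange ν ⁻¹' Ico x y = Ico (x + ν.real (Iio x)) (y + ν.real (Iio y)) := by
  ext s
  simp [le_timeChange_iff, timeChange_lt_iff]

lemma map_timeChange : volume.map (timeChange ν) = volume + ν := by
  have : IsLocallyFiniteMeasure (volume + ν) := ⟨fun x => by
    obtain ⟨s, hs, h⟩ := (volume : Measure ℝ).finiteAt_nhds x
    exact ⟨s, hs, by simpa using ENNReal.add_lt_top.2 ⟨h, measure_lt_top ν s⟩⟩⟩
  refine (Measure.ext_of_Ico _ _ fun x y hxy => ?_).symm
  have h1 : ν.real (Ico x y) = ν.real (Iio y) - ν.real (Iio x) := by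
    rw [← measureReal_sdiff (Iio_subset_Iio hxy.le) measurableSet_Iio]
    congr 1
    ext z
    simp
  rw [Measure.map_apply (monotone_timeChange ν).measurable measurableSet_Ico,
    preimage_timeChange_Ico, Real.volume_Ico, Measure.add_apply, Real.volume_Ico,
    ← ofReal_measureReal (μ := ν) (s := Ico x y), ← ENNReal.ofReal_add (by linarith)
      measureReal_nonneg, h1]
  congr 1
  ring

variable {ν} {W : ℝ → ℝ}

lemma integrable_comp_timeChange (hW : Integrable W) (hν : ∀ᵐ x ∂ν, W x = 0) :
    Integrable fun s => W (timeChange ν s) := by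
  have h0 : Integrable W ν := (integrable_zero ℝ ℝ ν).congr (hν.mono fun x hx => hx.symm)
  have h := hW.add_measure h0
  rw [← map_timeChange] at h
  exact (integrable_map_measure h.aestronglyMeasurable
    (monotone_timeChange ν).measurable.aemeasurable).1 h

lemma integral_comp_timeChange (hW : Integrable W) (hν : ∀ᵐ x ∂ν, W x = 0) :
    ∫ s, W (timeChange ν s) = ∫ x, W x := by
  have h0 : Integrable W ν := (integrable_zero ℝ ℝ ν).congr (hν.mono fun x hx => hx.symm)
  have h := hW.add_measure h0
  rw [← map_timeChange] at h
  rw [← integral_map (monotone_timeChange ν).measurable.aemeasurable h.aestronglyMeasurable,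
    map_timeChange, integral_add_measure hW h0, integral_congr_ae (g := 0) hν]
  simp

lemma ae_timeChange_ne (hν : ∀ᵐ x ∂ν, W x = 0) (x : ℝ) :
    ∀ᵐ s, timeChange ν s = x → W x = 0 := by
  by_cases hx : W x = 0
  · exact Eventually.of_forall fun _ _ => hx
  · have h1 : volume (timeChange ν ⁻¹' {x}) = 0 := by
      rw [← Measure.map_apply (monotone_timeChange ν).measurable (measurableSet_singleton x),
        map_timeChange, Measure.add_apply, Real.volume_singleton, zero_add]
      exact measure_mono_null (by simpa using hx) hν
    filter_upwards [compl_mem_ae_iff.2 h1] with s hs h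
    exact absurd h hs

lemma intervalIntegral_comp_timeChange (hW : Integrable W) (hν : ∀ᵐ x ∂ν, W x = 0) (x y : ℝ) :
    ∫ s in x..y, W (timeChange ν s) = ∫ t in (timeChange ν x)..(timeChange ν y), W t := by
  wlog hxy : x ≤ y generalizing x y
  · rw [intervalIntegral.integral_symm, this y x (le_of_not_ge hxy),
      intervalIntegral.integral_symm, neg_neg]
  have hr := monotone_timeChange ν
  rw [intervalIntegral.integral_of_le hxy, intervalIntegral.integral_of_le (hr hxy),
    ← integral_indicator measurableSet_Ioc, ← integral_indicator measurableSet_Ioc,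
    ← integral_comp_timeChange (ν := ν) (hW.indicator measurableSet_Ioc)]
  · refine integral_congr_ae ?_
    filter_upwards [ae_timeChange_ne hν (timeChange ν x), ae_timeChange_ne hν (timeChange ν y)]
      with s h1 h2
    by_cases hs : W (timeChange ν s) = 0
    · simp [indicator, hs]
    have h1' : timeChange ν s ≠ timeChange ν x := fun h => hs (by rw [h, h1 h])
    have h2' : timeChange ν s ≠ timeChange ν y := fun h => hs (by rw [h, h2 h])
    have : s ∈ Ioc x y ↔ timeChange ν s ∈ Ioc (timeChange ν x) (timeChange ν y) := by
      refine ⟨fun h => ⟨lt_of_le_of_ne (hr h.1.le) h1'.symm, hr h.2⟩, fun h => ?_⟩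
      exact ⟨hr.reflect_lt h.1, (hr.reflect_lt (lt_of_le_of_ne h.2 h2')).le⟩
    by_cases ht : s ∈ Ioc x y
    · rw [indicator_of_mem ht, indicator_of_mem (this.1 ht)]
    · rw [indicator_of_notMem ht, indicator_of_notMem (fun h => ht (this.2 h))]
  · filter_upwards [hν] with z hz
    simp [indicator, hz]

end TimeChange

/-- The inverse of `Ψ_p`, truncated to take values in `[-T, T]`. -/
def truncInv (ψ : ℝ → ℝ) (p T y : ℝ) : ℝ :=
  invPsip ψ p (max (Psip ψ p (-T)) (min (Psip ψ p T) y))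

/-- The derivative of `truncInv`. -/
def truncInvDeriv (ψ : ℝ → ℝ) (p T : ℝ) : ℝ → ℝ :=
  (Ioc (Psip ψ p (-T)) (Psip ψ p T)).indicator fun y => (ψ (truncInv ψ p T y) ^ (1 / p))⁻¹

namespace PsiHypP

variable {ψ : ℝ → ℝ} {p T : ℝ}

lemma truncInv_Psip (hψ : PsiHypP ψ p) (t : ℝ) :
    truncInv ψ p T (Psip ψ p t) = max (-T) (min T t) := by
  rw [truncInv, ← hψ.Psip_strictMono.monotone.map_min, ← hψ.Psip_strictMono.monotone.map_max,
    hψ.invPsip_Psip]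

lemma truncInv_of_ge (hψ : PsiHypP ψ p) (hT : 0 ≤ T) {y : ℝ} (hy : Psip ψ p T ≤ y) :
    truncInv ψ p T y = T := by
  rw [truncInv, min_eq_left hy, max_eq_right (hψ.Psip_strictMono.monotone (by linarith)),
    hψ.invPsip_Psip]

lemma truncInv_of_le (hψ : PsiHypP ψ p) {y : ℝ} (hy : y ≤ Psip ψ p (-T)) :
    truncInv ψ p T y = -T := by
  rw [truncInv, max_eq_left ((min_le_right _ _).trans hy), hψ.invPsip_Psip]

lemma exists_truncInv_eq (hψ : PsiHypP ψ p) (hT : 0 ≤ T) (y : ℝ) :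
    ∃ t ∈ Icc (-T) T, truncInv ψ p T y = t ∧
      Psip ψ p t = max (Psip ψ p (-T)) (min (Psip ψ p T) y) := by
  have hm := hψ.Psip_strictMono.monotone (show -T ≤ T by linarith)
  rcases le_total y (Psip ψ p (-T)) with h | h
  · exact ⟨-T, ⟨le_rfl, by linarith⟩, hψ.truncInv_of_le h,
      (max_eq_left ((min_le_right _ _).trans h)).symm⟩
  rcases le_total (Psip ψ p T) y with h' | h'
  · exact ⟨T, ⟨by linarith, le_rfl⟩, hψ.truncInv_of_ge hT h', by
      rw [min_eq_left h', max_eq_right hm]⟩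
  obtain ⟨t, rfl⟩ := hψ.exists_Psip_eq ((hψ.Psip_pos _).trans_le h) (h'.trans_lt (hψ.Psip_lt _))
  rw [hψ.Psip_strictMono.le_iff_le] at h h'
  refine ⟨t, ⟨h, h'⟩, ?_, ?_⟩
  · rw [hψ.truncInv_Psip, min_eq_right h', max_eq_right h]
  · rw [← hψ.Psip_strictMono.monotone.map_min, ← hψ.Psip_strictMono.monotone.map_max,
      min_eq_right h', max_eq_right h]

lemma truncInv_mem (hψ : PsiHypP ψ p) (hT : 0 ≤ T) (y : ℝ) : truncInv ψ p T y ∈ Icc (-T) T := by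
  obtain ⟨t, ht, h, -⟩ := hψ.exists_truncInv_eq hT y
  rwa [h]

lemma Psip_truncInv (hψ : PsiHypP ψ p) (hT : 0 ≤ T) (y : ℝ) :
    Psip ψ p (truncInv ψ p T y) = max (Psip ψ p (-T)) (min (Psip ψ p T) y) := by
  obtain ⟨t, -, h, h'⟩ := hψ.exists_truncInv_eq hT y
  rwa [h]

lemma abs_truncInv_Psip_le (hψ : PsiHypP ψ p) (hT : 0 ≤ T) (t : ℝ) :
    |truncInv ψ p T (Psip ψ p t)| ≤ |t| := by
  rw [hψ.truncInv_Psip]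
  rcases le_total 0 t with h | h
  · rw [max_eq_right (by have := le_min hT h; linarith), abs_of_nonneg (le_min hT h),
      abs_of_nonneg h]
    exact min_le_right _ _
  · rw [min_eq_right (h.trans hT), abs_of_nonpos h, abs_of_nonpos (max_le (by linarith) h)]
    exact neg_le_neg (le_max_right _ _)

lemma measurable_truncInv (hψ : PsiHypP ψ p) : Measurable (truncInv ψ p T) :=
  hψ.measurable_invPsip.comp (measurable_const.max (measurable_const.min measurable_id))

lemma measurable_truncInvDeriv (hψ : PsiHypP ψ p) : Measurable (truncInvDeriv ψ p T) :=
  (hψ.measurable_rpow.comp hψ.measurable_truncInv).inv.indicator measurableSet_Ioc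

lemma truncInvDeriv_nonneg (hψ : PsiHypP ψ p) (y : ℝ) : 0 ≤ truncInvDeriv ψ p T y :=
  indicator_nonneg (fun _ _ => inv_nonneg.2 (hψ.rpow_pos _).le) _

lemma exists_truncInvDeriv_le (hψ : PsiHypP ψ p) (hp : 1 < p) (hT : 0 ≤ T) :
    ∃ C, ∀ y, |truncInvDeriv ψ p T y| ≤ C := by
  obtain ⟨δ, hδ, h⟩ := hψ.exists_le_rpow hp T
  refine ⟨δ⁻¹, fun y => ?_⟩
  rw [abs_of_nonneg (hψ.truncInvDeriv_nonneg y)]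
  exact indicator_le' (fun y _ => inv_anti₀ hδ (h _ (hψ.truncInv_mem hT y)))
    (fun _ _ => inv_nonneg.2 hδ.le) y

lemma mul_truncInvDeriv_rpow_le (hψ : PsiHypP ψ p) (hp : 1 < p) (y : ℝ) :
    ψ (truncInv ψ p T y) * truncInvDeriv ψ p T y ^ p ≤ 1 := by
  by_cases hy : y ∈ Ioc (Psip ψ p (-T)) (Psip ψ p T)
  · rw [truncInvDeriv, indicator_of_mem hy, Real.inv_rpow (hψ.rpow_pos _).le,
      ← Real.rpow_mul (hψ.pos _).le, one_div_mul_cancel (by linarith), Real.rpow_one,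
      mul_inv_cancel₀ (hψ.pos _).ne']
  · rw [truncInvDeriv, indicator_of_notMem hy, Real.zero_rpow (by linarith)]
    simp

lemma truncInv_sub (hψ : PsiHypP ψ p) (hp : 1 < p) (hT : 0 ≤ T) (x y : ℝ) :
    truncInv ψ p T y - truncInv ψ p T x = ∫ s in x..y, truncInvDeriv ψ p T s := by
  obtain ⟨C, hC⟩ := hψ.exists_truncInvDeriv_le hp hT
  have hint : ∀ x y, IntervalIntegrable (truncInvDeriv ψ p T) volume x y := fun x y =>
    (intervalIntegrable_const (c := C)).mono_fun
      hψ.measurable_truncInvDeriv.aestronglyMeasurable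
      (Eventually.of_forall fun s => (hC s).trans (le_abs_self C))
  have hm := hψ.Psip_strictMono.monotone (show -T ≤ T by linarith)
  have h0 : ∀ y, ∫ s in y..(max (Psip ψ p (-T)) (min (Psip ψ p T) y)),
      truncInvDeriv ψ p T s = 0 := fun y => by
    refine intervalIntegral.integral_zero_ae (Eventually.of_forall fun s hs => ?_)
    refine indicator_of_notMem (fun hs' => ?_) _
    rcases le_total y (Psip ψ p (-T)) with h | h
    · rw [max_eq_left ((min_le_right _ _).trans h), uIoc_of_le h] at hs
      exact hs'.1.not_ge hs.2
    rcases le_total (Psip ψ p T) y with h' | h'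
    · rw [min_eq_left h', max_eq_right hm, uIoc_of_ge h'] at hs
      exact hs'.2.not_gt hs.1
    · rw [min_eq_right h', max_eq_right h] at hs
      simp at hs
  have h1 : ∫ s in Psip ψ p (truncInv ψ p T x)..Psip ψ p (truncInv ψ p T y),
      truncInvDeriv ψ p T s = truncInv ψ p T y - truncInv ψ p T x := by
    rw [integral_comp_primitive hψ.integrable hψ.Psip_sub hψ.measurable_truncInvDeriv hC]
    rw [intervalIntegral.integral_congr_ae (g := fun _ => 1)]
    · simp
    · refine Eventually.of_forall fun t ht => ?_
      have hx := hψ.truncInv_mem hT x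
      have hy := hψ.truncInv_mem hT y
      have ht' : t ∈ Ioc (-T) T :=
        ⟨(le_min hx.1 hy.1).trans_lt ht.1, ht.2.trans (max_le hx.2 hy.2)⟩
      have hmem : Psip ψ p t ∈ Ioc (Psip ψ p (-T)) (Psip ψ p T) :=
        ⟨hψ.Psip_strictMono ht'.1, hψ.Psip_strictMono.monotone ht'.2⟩
      rw [truncInvDeriv, indicator_of_mem hmem, hψ.truncInv_Psip, min_eq_right ht'.2,
        max_eq_right ht'.1.le]
      exact inv_mul_cancel₀ (hψ.rpow_pos t).ne'
  rw [hψ.Psip_truncInv hT, hψ.Psip_truncInv hT] at h1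
  have hx := h0 x
  have hy := h0 y
  have e1 := intervalIntegral.integral_add_adjacent_intervals
    (hint x (max (Psip ψ p (-T)) (min (Psip ψ p T) x))) (hint _ y)
  have e2 := intervalIntegral.integral_add_adjacent_intervals
    (hint (max (Psip ψ p (-T)) (min (Psip ψ p T) x)) (max (Psip ψ p (-T)) (min (Psip ψ p T) y)))
    (hint _ y)
  rw [intervalIntegral.integral_symm y] at e2
  linarith

end PsiHypP

lemma notMem_ZPlus_of_ae_le {a b : ℝ} {D : ℝ → ℝ} (hD : Integrable D) {x T ε : ℝ} (hε : 0 < ε)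
    (h : ∀ᵐ y, y ∈ Ioo (x - ε) (x + ε) → D y ≤ T) : x ∉ ZPlus a b D := by
  rintro ⟨-, hx⟩
  obtain ⟨η, hη, hT⟩ := ((show ∀ᶠ η in 𝓝[>] (0 : ℝ), η ∈ Ioo 0 ε from
    Ioo_mem_nhdsGT hε).and (hx.eventually (eventually_gt_atTop T))).exists
  rw [lt_div_iff₀ (by linarith [hη.1])] at hT
  have h1 : ∫ t in Ioo (x - η) (x + η), D t ≤ ∫ t in Ioo (x - η) (x + η), T := by
    refine setIntegral_mono_on_ae hD.integrableOn (by simp) measurableSet_Ioo ?_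
    filter_upwards [h] with y hy hy'
    exact hy ⟨by linarith [hy'.1, hη.2], by linarith [hy'.2, hη.2]⟩
  simp only [setIntegral_const, measureReal_def, Real.volume_Ioo, smul_eq_mul] at h1
  rw [ENNReal.toReal_ofReal (by linarith [hη.1])] at h1
  linarith

lemma notMem_ZMinus_of_le_ae {a b : ℝ} {D : ℝ → ℝ} (hD : Integrable D) {x T ε : ℝ} (hε : 0 < ε)
    (h : ∀ᵐ y, y ∈ Ioo (x - ε) (x + ε) → T ≤ D y) : x ∉ ZMinus a b D := by
  rintro ⟨hx, hx'⟩
  refine notMem_ZPlus_of_ae_le (a := a) (b := b) (T := -T) hD.neg hε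
    (h.mono fun y hy hy' => neg_le_neg (hy hy')) ⟨hx, ?_⟩
  refine (tendsto_neg_atBot_atTop.comp hx').congr fun ε => ?_
  simp only [Function.comp_apply, Pi.neg_apply, integral_neg, neg_div]

lemma exists_ae_mem_Ioo {a b x : ℝ} (hx : x ∈ Ioo a b) {s : Set ℝ} (hs : s ∈ 𝓝 x)
    {P : ℝ → Prop} (h : ∀ᵐ y ∂volume.restrict (Ioo a b), y ∈ s → P y) :
    ∃ ε > 0, ∀ᵐ y, y ∈ Ioo (x - ε) (x + ε) → P y := by
  obtain ⟨ε, hε, hsub⟩ := Metric.mem_nhds_iff.1 (inter_mem hs (isOpen_Ioo.mem_nhds hx))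
  rw [ae_restrict_iff' measurableSet_Ioo] at h
  refine ⟨ε, hε, h.mono fun y hy hy' => ?_⟩
  rw [← Real.ball_eq_Ioo] at hy'
  exact hy (hsub hy').2 (hsub hy').1

namespace PsiHypP

variable {ψ : ℝ → ℝ} {p a b : ℝ} {f G : ℝ → ℝ}

lemma le_of_mem_ZPlus (hψ : PsiHypP ψ p) (hf : Integrable f) (hG : Continuous G)
    (hGf : ∀ᵐ x ∂volume.restrict (Ioo a b), G x = Psip ψ p (f x)) {x : ℝ}
    (hx : x ∈ ZPlus a b f) : ∫ t, ψ t ^ (1 / p) ≤ G x := by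
  by_contra! h
  obtain ⟨t, ht⟩ := (hψ.tendsto_Psip_atTop.eventually (lt_mem_nhds h)).exists
  obtain ⟨ε, hε, h1⟩ := exists_ae_mem_Ioo (P := fun y => f y ≤ t) hx.1
    (hG.continuousAt.eventually (gt_mem_nhds ht)) (hGf.mono fun y hy hy' => by
      rw [mem_ofPred_eq, hy, hψ.Psip_strictMono.lt_iff_lt] at hy'
      exact hy'.le)
  exact notMem_ZPlus_of_ae_le hf hε h1 hx

lemma le_zero_of_mem_ZMinus (hψ : PsiHypP ψ p) (hf : Integrable f) (hG : Continuous G)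
    (hGf : ∀ᵐ x ∂volume.restrict (Ioo a b), G x = Psip ψ p (f x)) {x : ℝ}
    (hx : x ∈ ZMinus a b f) : G x ≤ 0 := by
  by_contra! h
  obtain ⟨t, ht⟩ := (hψ.tendsto_Psip_atBot.eventually (gt_mem_nhds h)).exists
  obtain ⟨ε, hε, h1⟩ := exists_ae_mem_Ioo (P := fun y => t ≤ f y) hx.1
    (hG.continuousAt.eventually (lt_mem_nhds ht)) (hGf.mono fun y hy hy' => by
      rw [mem_ofPred_eq, hy, hψ.Psip_strictMono.lt_iff_lt] at hy'
      exact hy'.le)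
  exact notMem_ZMinus_of_le_ae hf hε h1 hx

end PsiHypP

section TimeChangeEstimates

variable {a b : ℝ} {ν m : Measure ℝ} [IsFiniteMeasure ν] {h : ℝ → ℝ}

lemma lintegral_comp_timeChange (hh : Measurable h) {S : Set ℝ} (hS : MeasurableSet S) :
    ∫⁻ s in timeChange ν ⁻¹' S, ‖h (timeChange ν s)‖ₑ = ∫⁻ x in S, ‖h x‖ₑ ∂(volume + ν) := by
  rw [← map_timeChange, setLIntegral_map hS hh.enorm (monotone_timeChange ν).measurable]

lemma timeChange_mem_Ico (hν : ν (Iio a) = 0) {s : ℝ} (hs : s ∈ Ico a b) :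
    timeChange ν s ∈ Ico a b :=
  ⟨(le_timeChange_iff ν).2 (by simpa [measureReal_def, hν] using hs.1),
    (timeChange_le ν s).trans_lt hs.2⟩

lemma lintegral_comp_timeChange_le (hν : ν (Iio a) = 0) (hh : Measurable h)
    (hE : ∀ S, MeasurableSet S → S ⊆ Ico a b → ∫⁻ x in S, ‖h x‖ₑ ∂(volume + ν) ≤ m S) :
    ∫⁻ s in Ioo a b, ‖h (timeChange ν s)‖ₑ ≤ m univ := by
  calc ∫⁻ s in Ioo a b, ‖h (timeChange ν s)‖ₑ
      ≤ ∫⁻ s in timeChange ν ⁻¹' Ico a b, ‖h (timeChange ν s)‖ₑ :=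
        lintegral_mono_set fun s hs => timeChange_mem_Ico hν (Ioo_subset_Ico_self hs)
    _ ≤ m (Ico a b) := by
        rw [lintegral_comp_timeChange hh measurableSet_Ico]
        exact hE _ measurableSet_Ico subset_rfl
    _ ≤ m univ := measure_mono (subset_univ _)

lemma abs_integral_comp_timeChange_sub_le [IsFiniteMeasure m] (hν : ν (Iio a) = 0)
    (hh : Measurable h) {C : ℝ} (hC : ∀ x, |h x| ≤ C)
    (hE : ∀ S, MeasurableSet S → S ⊆ Ico a b → ∫⁻ x in S, ‖h x‖ₑ ∂(volume + ν) ≤ m S)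
    {x : ℝ} (hx : x ∈ Ioo a b) :
    |(∫ z in Ico a x, h z ∂(volume + ν)) - ∫ s in a..x, h (timeChange ν s)| ≤
      m.real (Iio x) - m.real (Iio (x - ν.real univ)) := by
  have hr := (monotone_timeChange ν).measurable
  have hFx : x ≤ x + ν.real (Iio x) := le_add_of_nonneg_right measureReal_nonneg
  have hint : ∀ s t, IntegrableOn (fun s => h (timeChange ν s)) (Ico s t) := fun s t =>
    Measure.integrableOn_of_bounded (M := C) (by simp) (hh.comp hr).aestronglyMeasurable
      (Eventually.of_forall fun s => hC _)
  have h1 : ∫ z in Ico a x, h z ∂(volume + ν) =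
      ∫ s in Ico a (x + ν.real (Iio x)), h (timeChange ν s) := by
    rw [← map_timeChange, setIntegral_map measurableSet_Ico hh.aestronglyMeasurable
      hr.aemeasurable, preimage_timeChange_Ico]
    simp [measureReal_def, hν]
  have h2 : ∫ s in a..x, h (timeChange ν s) = ∫ s in Ico a x, h (timeChange ν s) := by
    rw [intervalIntegral.integral_of_le hx.1.le, integral_Ico_eq_integral_Ioc]
  have h3 : Ico a (x + ν.real (Iio x)) = Ico a x ∪ Ico x (x + ν.real (Iio x)) :=
    (Ico_union_Ico_eq_Ico hx.1.le hFx).symm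
  rw [h1, h2, h3, setIntegral_union (Ico_disjoint_Ico_same) measurableSet_Ico (hint _ _) (hint _ _),
    add_sub_cancel_left]
  set S := Ico (max a (x - ν.real univ)) x with hS
  have hsub : Ico x (x + ν.real (Iio x)) ⊆ timeChange ν ⁻¹' S := fun s hs => by
    refine ⟨max_le ?_ ?_, (timeChange_lt_iff ν).2 hs.2⟩
    · exact (le_timeChange_iff ν).2 (by
        simpa [measureReal_def, hν] using hx.1.le.trans hs.1)
    · linarith [sub_le_timeChange ν s, hs.1]
  have h4 : ∫⁻ s in Ico x (x + ν.real (Iio x)), ‖h (timeChange ν s)‖ₑ ≤ m S :=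
    (lintegral_mono_set hsub).trans <| by
      rw [lintegral_comp_timeChange hh measurableSet_Ico]
      exact hE _ measurableSet_Ico (Ico_subset_Ico (le_max_left _ _) hx.2.le)
  have h5 : |∫ s in Ico x (x + ν.real (Iio x)), h (timeChange ν s)| ≤ m.real S := by
    rw [← Real.norm_eq_abs, ← toReal_enorm]
    exact ENNReal.toReal_mono (measure_ne_top _ _) ((enorm_integral_le_lintegral_enorm _).trans h4)
  refine h5.trans ?_
  have h6 : Iio (x - ν.real univ) ⊆ Iio x :=
    Iio_subset_Iio (sub_le_self _ measureReal_nonneg)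
  rw [← measureReal_sdiff h6 measurableSet_Iio]
  exact measureReal_mono fun z hz => ⟨hz.2, not_lt.2 ((le_max_right _ _).trans hz.1)⟩

end TimeChangeEstimates

lemma tendsto_real_Iio_sub (m : Measure ℝ) [IsFiniteMeasure m] (x : ℝ) {δ : ℕ → ℝ}
    (hδ : ∀ k, 0 ≤ δ k) (hlim : Tendsto δ atTop (𝓝 0)) :
    Tendsto (fun k => m.real (Iio x) - m.real (Iio (x - δ k))) atTop (𝓝 0) := by
  have h1 : ContinuousWithinAt (fun t => m.real (Iio t)) (Iic x) x :=
    continuousWithinAt_Iio_iff_Iic.1 (tendsto_real_Iio_nhdsLT m x)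
  have h2 : Tendsto (fun k => x - δ k) atTop (𝓝[≤] x) :=
    tendsto_nhdsWithin_iff.2 ⟨by simpa using hlim.const_sub x,
      Eventually.of_forall fun k => sub_le_self _ (hδ k)⟩
  simpa using (h1.tendsto.comp h2).const_sub (m.real (Iio x))

section LebesgueDecomposition

variable {μp μn : Measure ℝ} [IsFiniteMeasure μp] [IsFiniteMeasure μn]

lemma setLIntegral_uaD_add_singularPart_le {S : Set ℝ} (hS : MeasurableSet S) :
    (∫⁻ x in S, ‖uaD μp μn x‖ₑ) + (μp.singularPart volume + μn.singularPart volume) S ≤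
      (μp + μn) S := by
  have h1 : ∀ μ : Measure ℝ, IsFiniteMeasure μ →
      (∫⁻ x in S, ‖(μ.rnDeriv volume x).toReal‖ₑ) + μ.singularPart volume S = μ S := by
    intro μ _
    conv_rhs => rw [← μ.rnDeriv_add_singularPart volume]
    rw [Measure.add_apply, withDensity_apply _ hS]
    congr 1
    refine lintegral_congr_ae (ae_restrict_of_ae ?_)
    filter_upwards [μ.rnDeriv_lt_top volume] with x hx
    rw [Real.enorm_eq_ofReal ENNReal.toReal_nonneg, ENNReal.ofReal_toReal hx.ne]
  have h2 : ∫⁻ x in S, ‖uaD μp μn x‖ₑ ≤ (∫⁻ x in S, ‖(μp.rnDeriv volume x).toReal‖ₑ) +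
      ∫⁻ x in S, ‖(μn.rnDeriv volume x).toReal‖ₑ := by
    rw [← lintegral_add_left (Measure.measurable_rnDeriv _ _).ennreal_toReal.enorm]
    exact lintegral_mono fun x => enorm_sub_le
  rw [Measure.add_apply, Measure.add_apply, ← h1 μp inferInstance, ← h1 μn inferInstance]
  refine (add_le_add_left h2 _).trans (le_of_eq ?_)
  ring

lemma real_sub_real_eq_integral_uaD_add (S : Set ℝ) :
    μp.real S - μn.real S = (∫ x in S, uaD μp μn x) +
      ((μp.singularPart volume).real S - (μn.singularPart volume).real S) := by
  have h1 : ∀ μ : Measure ℝ, IsFiniteMeasure μ →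
      μ.real S = (∫ x in S, (μ.rnDeriv volume x).toReal) + (μ.singularPart volume).real S := by
    intro μ _
    rw [Measure.setIntegral_toReal_rnDeriv_eq_withDensity]
    conv_lhs => rw [← μ.rnDeriv_add_singularPart volume]
    exact measureReal_add_apply
  simp only [uaD]
  rw [integral_sub Measure.integrable_toReal_rnDeriv.integrableOn
    Measure.integrable_toReal_rnDeriv.integrableOn]
  linarith [h1 μp inferInstance, h1 μn inferInstance]

end LebesgueDecomposition

lemma PsiHypP.exists_deriv_truncInv_comp_timeChange {ψ : ℝ → ℝ} {p T : ℝ} (hψ : PsiHypP ψ p)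
    (hp : 1 < p) (hT : 0 ≤ T) {G W : ℝ → ℝ} (hW : Integrable W)
    (hWp : Integrable fun x => |W x| ^ p) (hG : ∀ x y, G y - G x = ∫ t in x..y, W t)
    {ν : Measure ℝ} [IsFiniteMeasure ν] (hν : ∀ᵐ x ∂ν, W x = 0) :
    ∃ w : ℝ → ℝ, Integrable w ∧ (Integrable fun x => |w x| ^ p) ∧
      (∀ x y, truncInv ψ p T (G (timeChange ν y)) - truncInv ψ p T (G (timeChange ν x)) =
        ∫ t in x..y, w t) ∧
      ∀ S : Set ℝ, ∫ x in S, ψ (truncInv ψ p T (G (timeChange ν x))) * |w x| ^ p ≤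
        ∫ x, |W x| ^ p := by
  have hGc := continuous_of_primitive hW hG
  have hp0 : p ≠ 0 := by linarith
  have hν' : ∀ᵐ x ∂ν, |W x| ^ p = 0 := hν.mono fun x hx => by
    rw [hx, abs_zero, Real.zero_rpow hp0]
  have h1 := integrable_comp_timeChange hW hν
  have h2 := integrable_comp_timeChange hWp hν'
  have h3 := integral_comp_timeChange hWp hν'
  obtain ⟨C, hC⟩ := hψ.exists_truncInvDeriv_le hp hT
  have hm : Measurable fun s => truncInvDeriv ψ p T (G (timeChange ν s)) :=
    hψ.measurable_truncInvDeriv.comp (hGc.measurable.comp (monotone_timeChange ν).measurable)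
  have hw : ∀ s, |truncInvDeriv ψ p T (G (timeChange ν s)) * W (timeChange ν s)| ^ p =
      truncInvDeriv ψ p T (G (timeChange ν s)) ^ p * |W (timeChange ν s)| ^ p := fun s => by
    rw [abs_mul, Real.mul_rpow (abs_nonneg _) (abs_nonneg _),
      abs_of_nonneg (hψ.truncInvDeriv_nonneg _)]
  refine ⟨fun s => truncInvDeriv ψ p T (G (timeChange ν s)) * W (timeChange ν s),
    h1.bdd_mul (c := C) hm.aestronglyMeasurable (Eventually.of_forall fun s => hC _), ?_, ?_, ?_⟩
  · simp only [hw]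
    refine h2.bdd_mul (c := C ^ p) (hm.pow_const p).aestronglyMeasurable
      (Eventually.of_forall fun s => ?_)
    have h0 := hψ.truncInvDeriv_nonneg (T := T) (G (timeChange ν s))
    rw [Real.norm_eq_abs, abs_of_nonneg (Real.rpow_nonneg h0 _)]
    exact Real.rpow_le_rpow h0 ((le_abs_self _).trans (hC _)) (by linarith)
  · intro x y
    rw [hψ.truncInv_sub hp hT]
    refine integral_comp_primitive (v := fun s => G (timeChange ν s)) h1 (fun x y => ?_)
      hψ.measurable_truncInvDeriv hC x y
    rw [hG, intervalIntegral_comp_timeChange hW hν]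
  · intro S
    rw [← h3]
    refine (integral_mono_of_nonneg (Eventually.of_forall fun s => ?_) h2.integrableOn
      (Eventually.of_forall fun s => ?_)).trans
        (setIntegral_le_integral h2 (Eventually.of_forall fun s => ?_))
    · exact mul_nonneg (hψ.pos _).le (Real.rpow_nonneg (abs_nonneg _) _)
    · simp only [hw, ← mul_assoc]
      exact mul_le_of_le_one_left (Real.rpow_nonneg (abs_nonneg _) _)
        (hψ.mul_truncInvDeriv_rpow_le hp _)
    · exact Real.rpow_nonneg (abs_nonneg _) _

namespace PsiHypP

variable {ψ : ℝ → ℝ} {p a b : ℝ} {f G : ℝ → ℝ}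

lemma lintegral_truncInv_le (hψ : PsiHypP ψ p)
    (hGf : ∀ᵐ x ∂volume.restrict (Ioo a b), G x = Psip ψ p (f x)) {σ m : Measure ℝ}
    (hm : ∀ S, MeasurableSet S → (∫⁻ x in S, ‖f x‖ₑ) + σ S ≤ m S) {c : ℝ≥0} {T : ℝ}
    (hT : 0 ≤ T) (hc : c * T = 1) {S : Set ℝ} (hS : MeasurableSet S) (hSI : S ⊆ Ico a b) :
    ∫⁻ x in S, ‖truncInv ψ p T (G x)‖ₑ ∂(volume + c • σ) ≤ m S := by
  rw [Measure.restrict_add, lintegral_add_measure, Measure.restrict_smul, lintegral_smul_measure]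
  refine le_trans (add_le_add ?_ ?_) (hm S hS)
  · refine lintegral_mono_ae (ae_restrict_of_ae_restrict_of_subset hSI ?_)
    rw [← restrict_Ioo_eq_restrict_Ico]
    filter_upwards [hGf] with x hx
    rw [hx, Real.enorm_eq_ofReal_abs, Real.enorm_eq_ofReal_abs]
    exact ENNReal.ofReal_le_ofReal (hψ.abs_truncInv_Psip_le hT _)
  · calc c • ∫⁻ x in S, ‖truncInv ψ p T (G x)‖ₑ ∂σ
        ≤ c • ∫⁻ x in S, ENNReal.ofReal T ∂σ := by
          refine smul_le_smul_of_nonneg_left (lintegral_mono fun x => ?_) (by simp)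
          rw [Real.enorm_eq_ofReal_abs]
          exact ENNReal.ofReal_le_ofReal (abs_le.2 (hψ.truncInv_mem hT _))
      _ = σ S := by
          rw [setLIntegral_const, ENNReal.smul_def, smul_eq_mul, ← mul_assoc,
            ← ENNReal.ofReal_coe_nnreal, ← ENNReal.ofReal_mul c.coe_nonneg, hc, ENNReal.ofReal_one, one_mul]

lemma setIntegral_truncInv_eq (hψ : PsiHypP ψ p) (hG : Continuous G) {σp σn : Measure ℝ}
    [IsFiniteMeasure σp] [IsFiniteMeasure σn] (hσp : ∀ᵐ x ∂σp, ∫ t, ψ t ^ (1 / p) ≤ G x)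
    (hσn : ∀ᵐ x ∂σn, G x ≤ 0) {c : ℝ≥0} {T : ℝ} (hT : 0 ≤ T) (hc : c * T = 1) {S : Set ℝ}
    (hS : volume S ≠ ∞) :
    ∫ x in S, truncInv ψ p T (G x) ∂(volume + c • (σp + σn)) =
      (∫ x in S, truncInv ψ p T (G x)) + (σp.real S - σn.real S) := by
  have hm : Measurable fun x => truncInv ψ p T (G x) := hψ.measurable_truncInv.comp hG.measurable
  have hb : ∀ x, ‖truncInv ψ p T (G x)‖ ≤ T := fun x => abs_le.2 (hψ.truncInv_mem hT _)
  have hi : ∀ μ : Measure ℝ, μ S ≠ ∞ → IntegrableOn (fun x => truncInv ψ p T (G x)) S μ :=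
    fun μ hμ => Measure.integrableOn_of_bounded (M := T) hμ hm.aestronglyMeasurable
      (Eventually.of_forall hb)
  rw [Measure.restrict_add, integral_add_measure (hi _ hS) (hi _ (measure_ne_top _ _)),
    Measure.restrict_smul, integral_smul_nnreal_measure, Measure.restrict_add,
    integral_add_measure (hi _ (measure_ne_top _ _)) (hi _ (measure_ne_top _ _)),
    integral_congr_ae (μ := σp.restrict S) (g := fun _ => T) (ae_restrict_of_ae (hσp.mono
      fun x hx => hψ.truncInv_of_ge hT ((hψ.Psip_lt T).le.trans hx))),
    integral_congr_ae (μ := σn.restrict S) (g := fun _ => -T) (ae_restrict_of_ae (hσn.mono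
      fun x hx => hψ.truncInv_of_le (hx.trans (hψ.Psip_pos (-T)).le)))]
  simp only [integral_const, measureReal_restrict_apply_univ, smul_eq_mul, NNReal.smul_def]
  linear_combination (σp.real S - σn.real S) * hc

lemma tendsto_setIntegral_truncInv (hψ : PsiHypP ψ p) (hf : Integrable f) (hG : Continuous G)
    (hGf : ∀ᵐ x ∂volume.restrict (Ioo a b), G x = Psip ψ p (f x)) {S : Set ℝ} (hS : S ⊆ Ico a b) :
    Tendsto (fun k : ℕ => ∫ x in S, truncInv ψ p (k + 1) (G x)) atTop (𝓝 (∫ x in S, f x)) := by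
  have hGf' : ∀ᵐ x ∂volume.restrict S, G x = Psip ψ p (f x) := by
    rw [restrict_Ioo_eq_restrict_Ico] at hGf
    exact ae_restrict_of_ae_restrict_of_subset hS hGf
  refine tendsto_integral_of_dominated_convergence (fun x => |f x|)
    (fun k => (hψ.measurable_truncInv.comp hG.measurable).aestronglyMeasurable)
    hf.abs.integrableOn (fun k => ?_) ?_
  · filter_upwards [hGf'] with x hx
    rw [hx]
    exact hψ.abs_truncInv_Psip_le (by positivity) _
  · filter_upwards [hGf'] with x hx
    refine tendsto_const_nhds.congr' ?_
    filter_upwards [eventually_ge_atTop ⌈|f x|⌉₊] with k hk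
    have hk' : |f x| ≤ k := Nat.ceil_le.1 hk
    rw [hx, hψ.truncInv_Psip, min_eq_right (by linarith [le_abs_self (f x)]),
      max_eq_right (by linarith [neg_abs_le (f x)])]

end PsiHypP

lemma tendstoL1_of_dominated {a b : ℝ} {U : ℕ → ℝ → ℝ} {u : ℝ → ℝ} {C : ℝ}
    (hU : ∀ k, ContinuousOn (U k) (Ioo a b)) (hu : IntegrableOn u (Ioo a b))
    (hC : ∀ k, ∀ x ∈ Ioo a b, |U k x| ≤ C)
    (hlim : ∀ᵐ x ∂volume.restrict (Ioo a b), Tendsto (fun k => U k x) atTop (𝓝 (u x))) :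
    TendstoL1 a b U u := by
  have hm : ∀ k, AEStronglyMeasurable (U k) (volume.restrict (Ioo a b)) := fun k =>
    (hU k).aestronglyMeasurable measurableSet_Ioo
  have hCa : ∀ k, ∀ᵐ x ∂volume.restrict (Ioo a b), |U k x| ≤ C := fun k =>
    ae_restrict_of_forall_mem measurableSet_Ioo (hC k)
  refine ⟨fun k => (integrable_const C).mono' (hm k) (hCa k), hu, ?_⟩
  rw [← integral_zero ℝ ℝ (μ := volume.restrict (Ioo a b))]
  refine tendsto_integral_of_dominated_convergence (fun x => C + |u x|)
    (fun k => ((hm k).sub hu.aestronglyMeasurable).norm) ((integrable_const C).add hu.abs)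
    (fun k => ?_) ?_
  · filter_upwards [hCa k] with x hx
    rw [Real.norm_eq_abs, abs_abs]
    exact (abs_sub _ _).trans (by gcongr)
  · filter_upwards [hlim] with x hx
    simpa using (hx.sub_const (u x)).abs

/-- Recovery sequences: on the set carrying the singular part of the derivative, time is slowed
down so that the jumps and the Cantor part are followed at the maximal speed `±T`. -/
lemma FpRel_le {ψ : ℝ → ℝ} {a b p : ℝ} (hψ : PsiHypP ψ p) (hp : 1 < p)
    (hab : a < b) {u : ℝ → ℝ} {μp μn : Measure ℝ} {g w : ℝ → ℝ} (hX : MemXp ψ p a b u μp μn)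
    (hg : ∀ᵐ x ∂(volume.restrict (Ioo a b)), g x = Psip ψ p (uaD μp μn x))
    (hw : IntegrableOn w (Ioo a b)) (hwp : IntegrableOn (fun x => |w x| ^ p) (Ioo a b))
    (hgw : ∀ x ∈ Ioo a b, ∀ y ∈ Ioo a b, g y - g x = ∫ t in x..y, w t) :
    FpRel ψ p a b u ≤ (μp + μn) (Ioo a b) + ENNReal.ofReal (∫ x in Ioo a b, |w x| ^ p) := by
  obtain ⟨hD, -, hZp, hZn⟩ := hX
  obtain ⟨C, hC⟩ := hD.exists_ae_eq hab
  obtain ⟨hu, hfp, hfn, -, hpI, hnI, -⟩ := hD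
  have hp0 : p ≠ 0 := by linarith
  have hf : Integrable (uaD μp μn) := integrable_uaD μp μn
  set σp := μp.singularPart volume with hσp
  set σn := μn.singularPart volume with hσn
  obtain ⟨N, hN, hσN, hvN⟩ : (σp + σn) ⟂ₘ volume :=
    (Measure.mutuallySingular_singularPart _ _).add_left
      (Measure.mutuallySingular_singularPart _ _)
  obtain ⟨G, hG₀, hGg⟩ := exists_primitive_extension hab hw hgw
  have hW₀ : Integrable ((Ioo a b).indicator w) := hw.integrable_indicator measurableSet_Ioo
  have hGc : Continuous G := continuous_of_primitive hW₀ hG₀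
  have hGf : ∀ᵐ x ∂volume.restrict (Ioo a b), G x = Psip ψ p (uaD μp μn x) := by
    filter_upwards [hg, ae_restrict_mem measurableSet_Ioo] with x hx hx'
    rw [hGg hx', hx]
  set W : ℝ → ℝ := N.indicator ((Ioo a b).indicator w) with hWdef
  have hWae : W =ᵐ[volume] (Ioo a b).indicator w := by
    filter_upwards [compl_mem_ae_iff.2 hvN] with x hx
    exact indicator_of_mem (not_notMem.1 hx) _
  have hW : Integrable W := hW₀.congr hWae.symm
  have hWpae : (fun x => |W x| ^ p) =ᵐ[volume] (Ioo a b).indicator fun x => |w x| ^ p := by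
    filter_upwards [hWae] with x hx
    rw [hx]
    by_cases hx' : x ∈ Ioo a b
    · simp [hx']
    · simp [hx', Real.zero_rpow hp0]
  have hWp : Integrable fun x => |W x| ^ p :=
    (hwp.integrable_indicator measurableSet_Ioo).congr hWpae.symm
  have hWpint : ∫ x, |W x| ^ p = ∫ x in Ioo a b, |w x| ^ p := by
    rw [integral_congr_ae hWpae, integral_indicator measurableSet_Ioo]
  have hG : ∀ x y, G y - G x = ∫ t in x..y, W t := fun x y => by
    rw [hG₀, intervalIntegral.integral_congr_ae]
    filter_upwards [hWae] with t ht _ using ht.symm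
  have hσW : ∀ᵐ x ∂(σp + σn), W x = 0 := by
    filter_upwards [compl_mem_ae_iff.2 hσN] with x hx
    exact indicator_of_notMem hx _
  have hσpG : ∀ᵐ x ∂σp, ∫ t, ψ t ^ (1 / p) ≤ G x := by
    filter_upwards [compl_mem_ae_iff.2 hZp] with x hx
    exact hψ.le_of_mem_ZPlus hf hGc hGf (not_notMem.1 hx)
  have hσnG : ∀ᵐ x ∂σn, G x ≤ 0 := by
    filter_upwards [compl_mem_ae_iff.2 hZn] with x hx
    exact hψ.le_zero_of_mem_ZMinus hf hGc hGf (not_notMem.1 hx)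
  have hIio : Iio a ⊆ (Ioo a b)ᶜ := fun x hx hx' => lt_asymm hx hx'.1
  have hpa : μp (Iio a) = 0 := measure_mono_null hIio hpI
  have hna : μn (Iio a) = 0 := measure_mono_null hIio hnI
  let T : ℕ → ℝ := fun k => k + 1
  let c : ℕ → ℝ≥0 := fun k => (k + 1 : ℝ≥0)⁻¹
  have hT : ∀ k, 0 ≤ T k := fun k => by positivity
  have hc : ∀ k, c k * T k = 1 := fun k => by
    simp only [c, T]
    push_cast
    exact inv_mul_cancel₀ (by positivity)
  let ν : ℕ → Measure ℝ := fun k => c k • (σp + σn)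
  have hνa : ∀ k, ν k (Iio a) = 0 := fun k => by
    have h1 : σp (Iio a) = 0 := le_antisymm ((μp.singularPart_le volume _).trans hpa.le) bot_le
    have h2 : σn (Iio a) = 0 := le_antisymm ((μn.singularPart_le volume _).trans hna.le) bot_le
    simp [ν, h1, h2]
  have hνW : ∀ k, ∀ᵐ x ∂ν k, W x = 0 := fun k => Measure.ae_smul_measure hσW _
  have hνlim : Tendsto (fun k => (ν k).real univ) atTop (𝓝 0) := by
    have : ∀ k, (ν k).real univ = 1 / ((k : ℝ) + 1) * (σp + σn).real univ := fun k => by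
      rw [measureReal_nnreal_smul_apply]
      simp [c]
    simp only [this]
    simpa using tendsto_one_div_add_atTop_nhds_zero_nat.mul_const ((σp + σn).real univ)
  have hh : ∀ k, Measurable fun x => truncInv ψ p (T k) (G x) := fun k =>
    hψ.measurable_truncInv.comp hGc.measurable
  have hE : ∀ k S, MeasurableSet S → S ⊆ Ico a b →
      ∫⁻ x in S, ‖truncInv ψ p (T k) (G x)‖ₑ ∂(volume + ν k) ≤ (μp + μn) S := fun k S hS hSI =>
    hψ.lintegral_truncInv_le hGf (fun S hS => setLIntegral_uaD_add_singularPart_le hS) (hT k)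
      (hc k) hS hSI
  have hmuniv : (μp + μn) univ = (μp + μn) (Ioo a b) := by
    rw [← measure_add_measure_compl (measurableSet_Ioo (a := a) (b := b))]
    simp [hpI, hnI]
  let v : ℕ → ℝ → ℝ := fun k s => truncInv ψ p (T k) (G (timeChange (ν k) s))
  choose ω hω hωp hvω hEω using fun k => hψ.exists_deriv_truncInv_comp_timeChange hp (hT k) hW
    hWp hG (hνW k)
  have hvc : ∀ k, Continuous (v k) := fun k => continuous_of_primitive (hω k) (hvω k)
  have hvI : ∀ k, IntegrableOn (v k) (Ioo a b) := fun k =>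
    ((hvc k).integrableOn_Icc).mono_set Ioo_subset_Icc_self
  have hvle : ∀ k, ∫⁻ s in Ioo a b, ‖v k s‖ₑ ≤ (μp + μn) univ := fun k =>
    lintegral_comp_timeChange_le (hνa k) (hh k) (hE k)
  have hvle' : ∀ k, ∫ s in Ioo a b, |v k s| ≤ (μp + μn).real univ := fun k => by
    simp only [← Real.norm_eq_abs]
    rw [integral_norm_eq_lintegral_enorm (hvI k).aestronglyMeasurable]
    exact ENNReal.toReal_mono (measure_ne_top _ _) (hvle k)
  let U : ℕ → ℝ → ℝ := fun k x => C + ∫ s in a..x, v k s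
  have hUd : ∀ k x, HasDerivAt (U k) (v k x) x := fun k x =>
    ((hvc k).integral_hasStrictDerivAt a x).hasDerivAt.const_add C
  have hUc : ∀ k, Continuous (U k) := fun k =>
    continuous_iff_continuousAt.2 fun x => (hUd k x).continuousAt
  have hUle : ∀ k, ∀ x ∈ Ioo a b, |U k x| ≤ |C| + (μp + μn).real univ := fun k x hx => by
    refine (abs_add_le _ _).trans (add_le_add_right ?_ _)
    refine le_trans ?_ (hvle' k)
    rw [← integral_Ioc_eq_integral_Ioo]
    refine (intervalIntegral.abs_integral_le_integral_abs hx.1.le).trans ?_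
    rw [intervalIntegral.integral_of_le hx.1.le]
    exact setIntegral_mono_set ((hvc k).abs.integrableOn_Icc.mono_set Ioc_subset_Icc_self)
      (Eventually.of_forall fun _ => abs_nonneg _) (Ioc_subset_Ioc_right hx.2.le).eventuallyLE
  have hlim : ∀ᵐ x ∂volume.restrict (Ioo a b), Tendsto (fun k => U k x) atTop (𝓝 (u x)) := by
    filter_upwards [hC, ae_restrict_mem measurableSet_Ioo] with x hx hxI
    rw [hx]
    refine Tendsto.const_add C ?_
    have hreal : ∀ m : Measure ℝ, IsFiniteMeasure m → m (Iio a) = 0 →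
        m.real (Iio x) = m.real (Ico a x) := fun m _ hm => by
      rw [← Iio_union_Ico_eq_Iio hxI.1.le, measureReal_union _ measurableSet_Ico,
        measureReal_def, hm]
      · simp
      · exact disjoint_left.2 fun y hy hy' => not_le.2 hy hy'.1
    rw [hreal μp hfp hpa, hreal μn hfn hna, real_sub_real_eq_integral_uaD_add]
    have h1 : Tendsto (fun k => ∫ z in Ico a x, truncInv ψ p (T k) (G z) ∂(volume + ν k)) atTop
        (𝓝 ((∫ z in Ico a x, uaD μp μn z) + (σp.real (Ico a x) - σn.real (Ico a x)))) := by
      simp only [ν, hψ.setIntegral_truncInv_eq hGc hσpG hσnG (hT _) (hc _)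
        (show volume (Ico a x) ≠ ∞ by simp)]
      exact (hψ.tendsto_setIntegral_truncInv hf hGc hGf (Ico_subset_Ico_right hxI.2.le)).add_const _
    have h2 : Tendsto (fun k => (∫ z in Ico a x, truncInv ψ p (T k) (G z) ∂(volume + ν k)) -
        ∫ s in a..x, v k s) atTop (𝓝 0) :=
      squeeze_zero_norm (fun k => abs_integral_comp_timeChange_sub_le (hνa k) (hh k)
        (fun x => abs_le.2 (hψ.truncInv_mem (hT k) _)) (hE k) hxI)
        (tendsto_real_Iio_sub (μp + μn) x (fun k => measureReal_nonneg) hνlim)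
    simpa using h1.sub h2
  have hrep : ∀ k, W2pRep p a b (U k) (v k) (ω k) := fun k =>
    ⟨fun x _ => hUd k x, fun x _ y _ => hvω k x y,
      (hUc k).integrableOn_Icc.mono_set Ioo_subset_Icc_self, hvI k, (hω k).integrableOn,
      (hωp k).integrableOn⟩
  have hFp : ∀ k, Fp ψ p a b (U k) ≤
      (μp + μn) (Ioo a b) + ENNReal.ofReal (∫ x in Ioo a b, |w x| ^ p) := fun k => by
    refine (iInf₂_le_of_le (v k) (ω k) (iInf_le _ (hrep k))).trans ?_
    refine ENNReal.ofReal_add_le.trans (add_le_add ?_ (ENNReal.ofReal_le_ofReal ?_))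
    · rw [← hmuniv]
      exact ENNReal.ofReal_le_of_le_toReal (hvle' k)
    · rw [← hWpint]
      exact hEω k _
  refine (iInf₂_le U (tendstoL1_of_dominated (fun k => (hUc k).continuousOn) hu hUle hlim)).trans ?_
  exact (liminf_le_liminf (Eventually.of_forall hFp)).trans (liminf_const _).le

/-- the relaxation of `F_p` (`p > 1`) with respect to strong `L¹`
convergence: `F̄_p(u) = |u'|(]a,b[) + ∫_a^b |v'|^p` on `X^p_ψ(]a,b[)`, `+∞` otherwise. -/
theorem statement_9 (a b p : ℝ) (hab : a < b) (hp : 1 < p)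
    (ψ : ℝ → ℝ) (hψ : PsiHypP ψ p)
    (u : ℝ → ℝ) (hu : MeasureTheory.IntegrableOn u (Set.Ioo a b)) :
    (∀ (μp μn : Measure ℝ) (g w : ℝ → ℝ), MemXp ψ p a b u μp μn →
      (∀ᵐ x ∂(MeasureTheory.volume.restrict (Set.Ioo a b)),
        g x = Psip ψ p (uaD μp μn x)) →
      MeasureTheory.IntegrableOn w (Set.Ioo a b) →
      MeasureTheory.IntegrableOn (fun x => |w x| ^ p) (Set.Ioo a b) →
      (∀ x ∈ Set.Ioo a b, ∀ y ∈ Set.Ioo a b, g y - g x = ∫ t in x..y, w t) →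
      FpRel ψ p a b u =
        (μp + μn) (Set.Ioo a b) + ENNReal.ofReal (∫ x in Set.Ioo a b, |w x| ^ p)) ∧
    ((¬ ∃ μp μn : Measure ℝ, MemXp ψ p a b u μp μn) → FpRel ψ p a b u = ⊤) := by
  refine ⟨fun μp μn g w hX hg hw hwp hgw => ?_, fun h => ?_⟩
  · exact le_antisymm (FpRel_le hψ hp hab hX hg hw hwp hgw) (le_FpRel hψ hp hab hX hg hw hgw)
  · by_contra hne
    exact h (exists_memXp_of_FpRel_ne_top hψ hp hab hne)
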